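/- For w a Grassmannian permutation with ℓ(w) ≥ 1 and B ∈ BPD(w), one has jdt(Q̃(φ(B))) = Q̃(φ(∇B)); that is, applying a jeu de taquin slide (removing the top-left box and rectifying) to the recording tableau of φ(B) yields the recording tableau of φ(∇B). -/

import Mathlib

/- Common definitions for formalizing "Lenart's bijection via bumpless pipe dreams"
   (Gregory–Hamaker). -/

namespace BPDPaper

/-! ### Permutations of the positive integers -/

/-- We model permutations of the positive integers as permutations of `ℕ`
(fixing `0`, with finite support). -/
abbrev Perm' := Equiv.Perm ℕ

/-- The simple transposition `s_a = t_{a,a+1}`. -/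
def sT (a : ℕ) : Perm' := Equiv.swap a (a + 1)

/-- The transposition `t_{ij}`. -/
def tT (i j : ℕ) : Perm' := Equiv.swap i j

/-- The product `s_{a_1} ⋯ s_{a_p}` of a word. -/
def wordProd (l : List ℕ) : Perm' := (l.map sT).prod

/-- `l` is a word for `w` (in the letters `s_1, s_2, …`). -/
def IsWord (w : Perm') (l : List ℕ) : Prop := (∀ x ∈ l, 1 ≤ x) ∧ wordProd l = w

/-- The Coxeter length `ℓ(w)`: the minimal length of a word for `w`. -/
noncomputable def plen (w : Perm') : ℕ :=
  sInf {m | ∃ l : List ℕ, IsWord w l ∧ l.length = m}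

/-- `l` is a reduced word for `w`. -/
def IsReducedWord (w : Perm') (l : List ℕ) : Prop := IsWord w l ∧ l.length = plen w

/-- A permutation of the positive integers: fixes `0` and all but finitely many points. -/
def IsPerm (w : Perm') : Prop := w 0 = 0 ∧ {k | w k ≠ k}.Finite

/-- `k` is a descent of `w`. -/
def Descent (w : Perm') (k : ℕ) : Prop := 1 ≤ k ∧ w (k + 1) < w k

/-- `w` is Grassmannian: at most one descent. -/
def Grassmannian (w : Perm') : Prop := IsPerm w ∧ Set.Subsingleton {k | Descent w k}

/-- `w` is vexillary: no indices `i < j < k < l` with `w j < w i < w l < w k`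
(pattern 2143 avoidance). -/
def Vexillary (w : Perm') : Prop := IsPerm w ∧
  ¬ ∃ i j k l : ℕ, 1 ≤ i ∧ i < j ∧ j < k ∧ k < l ∧ w j < w i ∧ w i < w l ∧ w l < w k

/-- The code `c_i(w) = #{j > i : w j < w i}`. -/
noncomputable def codeOf (w : Perm') (i : ℕ) : ℕ := Nat.card {j : ℕ | i < j ∧ w j < w i}

/-- Insert into a weakly decreasing list, keeping it weakly decreasing. -/
def insDesc (x : ℕ) : List ℕ → List ℕ
  | [] => [x]
  | y :: ys => if y < x then x :: y :: ys else y :: insDesc x ys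

/-- Sort a list into weakly decreasing order. -/
def sortDesc (l : List ℕ) : List ℕ := l.foldr insDesc []

/-- The shape `λ(w)`: the code `(c_1(w), …, c_n(w))` sorted decreasingly, zeros dropped
(`n` is any bound on the support of `w`). -/
noncomputable def shapeOf (w : Perm') (n : ℕ) : List ℕ :=
  (sortDesc ((List.range' 1 n).map (codeOf w))).filter (fun x => decide (0 < x))

/-- The Rothe diagram `D_w = {(i, w j) : i < j, w j < w i}` (matrix coordinates). -/
def RotheDiagram (w : Perm') : Set (ℕ × ℕ) :=
  {p | 1 ≤ p.1 ∧ ∃ j, p.1 < j ∧ w j < w p.1 ∧ p.2 = w j}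

/-- `φ_i`: the row index of the southeast-most box of `D_w` on the diagonal through
`(i, λ_i)`. -/
noncomputable def flagEntry (w : Perm') (i li : ℕ) : ℕ :=
  sSup {r : ℕ | ∃ c : ℕ, (r, c) ∈ RotheDiagram w ∧ (c : ℤ) - (r : ℤ) = (li : ℤ) - (i : ℤ)}

/-- The flag `φ(w) = (φ_1, …, φ_m)` of a vexillary permutation. -/
noncomputable def flagOf (w : Perm') (n : ℕ) : List ℕ :=
  (List.range (shapeOf w n).length).map (fun k => flagEntry w (k + 1) ((shapeOf w n).getD k 0))

/-- `ρ(w)_i`: the `i`-th row of the smallest partition whose Young diagram contains `D_w`. -/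
noncomputable def rhoRow (w : Perm') (i : ℕ) : ℕ :=
  sSup {c : ℕ | ∃ r : ℕ, i ≤ r ∧ (r, c) ∈ RotheDiagram w}

/-! ### Tableaux (lists of rows), flagged SSYT, jeu de taquin -/

/-- Semistandard Young tableau of partition shape, presented as a list of rows. -/
def IsSSYT (T : List (List ℕ)) : Prop :=
  (∀ row ∈ T, row ≠ []) ∧
  List.Chain' (fun r1 r2 : List ℕ => r2.length ≤ r1.length) T ∧
  (∀ row ∈ T, List.Chain' (· ≤ ·) row) ∧
  (∀ i j : ℕ, i + 1 < T.length → j < (T.getD (i + 1) []).length →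
    (T.getD i []).getD j 0 < (T.getD (i + 1) []).getD j 0)

/-- `φ`-flagged semistandard Young tableaux of shape `λ`: the last entry of row `i`
is at most `φ_i`. -/
def IsFlaggedSSYT (lam phi : List ℕ) (T : List (List ℕ)) : Prop :=
  IsSSYT T ∧ T.map List.length = lam ∧
  ∀ i : ℕ, i < T.length → (T.getD i []).getLastD 0 ≤ phi.getD i 0

/-- Semistandard Young tableaux with all entries at most `k` (`SSYT_k`). -/
def IsSSYTBounded (k : ℕ) (T : List (List ℕ)) : Prop :=
  IsSSYT T ∧ ∀ row ∈ T, ∀ x ∈ row, x ≤ k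

/-- Set an entry of a tableau. -/
def setEntry (T : List (List ℕ)) (r c x : ℕ) : List (List ℕ) :=
  T.set r ((T.getD r []).set c x)

/-- One jeu de taquin slide with the empty tile at `(r, c)` (0-indexed):
swap the empty tile with the smaller of the entries to its right and below
(ties move down; missing boxes are `∞`); when both are missing, delete the cell. -/
def jdtAux : ℕ → List (List ℕ) → ℕ → ℕ → List (List ℕ)
  | 0, T, _, _ => T
  | fuel + 1, T, r, c =>
    match (T.getD r [])[c + 1]?, (T.getD (r + 1) [])[c]? with
    | none, none => (T.set r ((T.getD r []).take c)).filter (fun row => !row.isEmpty)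
    | some x, none => jdtAux fuel (setEntry T r c x) r (c + 1)
    | none, some y => jdtAux fuel (setEntry T r c y) (r + 1) c
    | some x, some y =>
      if x < y then jdtAux fuel (setEntry T r c x) r (c + 1)
      else jdtAux fuel (setEntry T r c y) (r + 1) c

/-- `jdt(T)`: remove the top-left box of `T` and rectify by jeu de taquin. -/
def jdt (T : List (List ℕ)) : List (List ℕ) :=
  jdtAux ((T.map List.length).sum + 1) T 0 0

/-! ### Edelman–Greene column insertion and the recording tableau -/

/-- Edelman–Greene insertion of `x` into one increasing column `C`.
Returns the new column together with `none` (if `x` was appended, creating a new box)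
or `some y` (where `y` is to be inserted into the next column). -/
def colIns (x : ℕ) (C : List ℕ) : List ℕ × Option ℕ :=
  if C.all (fun c => decide (c < x)) then (C ++ [x], none)
  else if x ∈ C ∧ (x + 1) ∈ C then (C, some (x + 1))
  else
    match C.find? (fun c => decide (x < c)) with
    | some ck => (C.map (fun c => if c = ck then x else c), some ck)
    | none => (C, none)

/-- Edelman–Greene insertion of `x` into a tableau presented as a list of columns.
Returns the new columns and the (0-indexed) column containing the new box. -/
def egInsert : List (List ℕ) → ℕ → (List (List ℕ)) × ℕ
  | [], x => ([[x]], 0)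
  | C :: rest, x =>
    match colIns x C with
    | (C', none) => (C' :: rest, 0)
    | (C', some y) =>
      let res := egInsert rest y
      (C' :: res.1, res.2 + 1)

/-- One step of the Edelman–Greene algorithm on the pair (insertion, recording) tableau:
insert `ra.2` into `P` and record `ra.1` in the new box of `Q`. -/
def egStep (PQ : (List (List ℕ)) × (List (List ℕ))) (ra : ℕ × ℕ) :
    (List (List ℕ)) × (List (List ℕ)) :=
  let res := egInsert PQ.1 ra.2
  let Q := PQ.2
  let Q' := if res.2 < Q.length then Q.set res.2 (Q.getD res.2 [] ++ [ra.1]) else Q ++ [[ra.1]]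
  (res.1, Q')

/-- A biword `(r_1,…,r_l ; a_1,…,a_l)`. -/
structure Biword where
  top : List ℕ
  bot : List ℕ

/-- The (insertion, recording) column tableaux of a biword under Edelman–Greene insertion. -/
def egPQ (P : Biword) : (List (List ℕ)) × (List (List ℕ)) :=
  (P.top.zip P.bot).foldl egStep ([], [])

/-- Convert a tableau presented as a list of columns into a list of rows. -/
def colsToRows (cols : List (List ℕ)) : List (List ℕ) :=
  (List.range ((cols.map List.length).foldr max 0)).map
    (fun i => cols.filterMap (fun col => col[i]?))

/-- The Edelman–Greene recording tableau `Q̃` of a biword (as a list of rows). -/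
def Qtilde (P : Biword) : List (List ℕ) := colsToRows (egPQ P).2

/-- The Edelman–Greene insertion tableau `P̃` of a biword (as a list of rows). -/
def Ptilde (P : Biword) : List (List ℕ) := colsToRows (egPQ P).1

/-- `(r ; a)` is a reduced compatible sequence for `w`: `a` is a reduced word for `w`,
`r` is weakly increasing, `r_i ≤ a_i`, and `r_i < r_{i+1}` whenever `a_i < a_{i+1}`.
Membership in `PD(w)`. -/
def IsCompatible (w : Perm') (P : Biword) : Prop :=
  IsReducedWord w P.bot ∧
  List.Chain' (· ≤ ·) P.top ∧
  List.Forall₂ (· ≤ ·) P.top P.bot ∧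
  (∀ m : ℕ, m + 1 < P.bot.length →
    P.bot.getD m 0 < P.bot.getD (m + 1) 0 → P.top.getD m 0 < P.top.getD (m + 1) 0)

/-! ### Bumpless pipe dreams -/

/-- The tiles: blank, vertical, horizontal, ⌐-elbow (S–E, "r"), ⌟-elbow (W–N, "j"),
crossing, and the bump tile (for almost bumpless pipe dreams). -/
inductive Tile
  | blank | vert | horiz | se | nw | cross | bump
deriving DecidableEq

/-- A square grid of tiles; rows and columns are 1-indexed, rows increase downward. -/
structure Grid where
  n : ℕ
  tile : ℕ → ℕ → Tile

inductive Dir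
  | north | east
deriving DecidableEq

def hasN : Tile → Bool
  | .vert => true | .nw => true | .cross => true | .bump => true | _ => false
def hasS : Tile → Bool
  | .vert => true | .se => true | .cross => true | .bump => true | _ => false
def hasE : Tile → Bool
  | .horiz => true | .se => true | .cross => true | .bump => true | _ => false
def hasW : Tile → Bool
  | .horiz => true | .nw => true | .cross => true | .bump => true | _ => false

/-- The outgoing direction of a pipe through a tile, given the incoming heading
(`north` = entered through the south edge, `east` = entered through the west edge). -/
def outDir : Tile → Dir → Option Dir
  | .vert, .north => some .north
  | .cross, .north => some .north
  | .se, .north => some .east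
  | .bump, .north => some .east
  | .horiz, .east => some .east
  | .cross, .east => some .east
  | .nw, .east => some .north
  | .bump, .east => some .north
  | _, _ => none

/-- Trace a pipe; returns the row in which it exits through the east edge of the grid. -/
def traceAux (g : Grid) : ℕ → ℕ → ℕ → Dir → Option ℕ
  | 0, _, _, _ => none
  | fuel + 1, x, y, d =>
    match outDir (g.tile x y) d with
    | none => none
    | some Dir.north => if x ≤ 1 then none else traceAux g fuel (x - 1) y Dir.north
    | some Dir.east => if g.n ≤ y then some x else traceAux g fuel x (y + 1) Dir.east

/-- The exit row of the pipe entering at the bottom of column `c`. -/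
def exitRow (g : Grid) (c : ℕ) : Option ℕ := traceAux g (2 * g.n + 2) g.n c Dir.north

/-- The list of states `(row, column, heading)` visited by a pipe. -/
def pathAux (g : Grid) : ℕ → ℕ → ℕ → Dir → List (ℕ × ℕ × Dir)
  | 0, _, _, _ => []
  | fuel + 1, x, y, d =>
    (x, y, d) ::
      (match outDir (g.tile x y) d with
       | none => []
       | some Dir.north => if x ≤ 1 then [] else pathAux g fuel (x - 1) y Dir.north
       | some Dir.east => if g.n ≤ y then [] else pathAux g fuel x (y + 1) Dir.east)

/-- The path of the pipe entering at the bottom of column `c`. -/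
def pipePath (g : Grid) (c : ℕ) : List (ℕ × ℕ × Dir) := pathAux g (2 * g.n + 2) g.n c Dir.north

/-- Pipe `c` passes through position `z`. -/
def passes (g : Grid) (c : ℕ) (z : ℕ × ℕ) : Prop :=
  ∃ d : Dir, (z.1, z.2, d) ∈ pipePath g c

def InGrid (g : Grid) (i j : ℕ) : Prop := 1 ≤ i ∧ i ≤ g.n ∧ 1 ≤ j ∧ j ≤ g.n

/-- A (reduced) bumpless pipe dream: tiles match along edges; pipes enter along the
bottom and exit along the right; no bump tiles; no two pipes cross more than once.
(Tiles outside the grid are normalized to `horiz`.) -/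
def IsBPD (g : Grid) : Prop :=
  1 ≤ g.n ∧
  (∀ i j, ¬ InGrid g i j → g.tile i j = Tile.horiz) ∧
  (∀ i j, InGrid g i j → g.tile i j ≠ Tile.bump) ∧
  (∀ i j, 1 ≤ i → i < g.n → 1 ≤ j → j ≤ g.n → hasS (g.tile i j) = hasN (g.tile (i + 1) j)) ∧
  (∀ i j, 1 ≤ i → i ≤ g.n → 1 ≤ j → j < g.n → hasE (g.tile i j) = hasW (g.tile i (j + 1))) ∧
  (∀ j, 1 ≤ j → j ≤ g.n → hasN (g.tile 1 j) = false) ∧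
  (∀ j, 1 ≤ j → j ≤ g.n → hasS (g.tile g.n j) = true) ∧
  (∀ i, 1 ≤ i → i ≤ g.n → hasW (g.tile i 1) = false) ∧
  (∀ i, 1 ≤ i → i ≤ g.n → hasE (g.tile i g.n) = true) ∧
  (∀ c c', 1 ≤ c → c ≤ g.n → 1 ≤ c' → c' ≤ g.n → c ≠ c' →
    Set.Subsingleton {z : ℕ × ℕ | g.tile z.1 z.2 = Tile.cross ∧ passes g c z ∧ passes g c' z})

/-- `g ∈ BPD(w)`: `g` is a bumpless pipe dream whose permutation is `w`, i.e. the pipe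
entering at the bottom of column `c` exits to the right in row `w⁻¹(c)`. -/
def MemBPD (w : Perm') (g : Grid) : Prop :=
  IsBPD g ∧ w 0 = 0 ∧ (∀ k, g.n < k → w k = k) ∧
  (∀ c, 1 ≤ c → c ≤ g.n → exitRow g c = some (w.symm c))

/-! ### Weigandt's map γ -/

/-- The blank tiles on the diagonal `{(i,j) : j - i = d}`, from northwest to southeast. -/
def blanksOnDiag (g : Grid) (d : ℤ) : List (ℕ × ℕ) :=
  (List.range' 1 g.n).filterMap (fun (i : ℕ) =>
    let jz : ℤ := (i : ℤ) + d
    if 1 ≤ jz ∧ jz ≤ (g.n : ℤ) then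
      (if g.tile i jz.toNat = Tile.blank then some (i, jz.toNat) else none)
    else none)

/-- The number of pipes passing above position `(i,j)`: tiles above it in column `j`
in which a pipe travels eastward. -/
def pipesAbove (g : Grid) (i j : ℕ) : ℕ :=
  ((List.range' 1 g.n).filter (fun x => decide (x < i) && hasE (g.tile x j))).length

/-- Weigandt's map `γ` (for vexillary permutations): fill each blank tile with the number
of pipes above it, slide the filled tiles northwest along their diagonals into the Young
diagram of `lam`, and add `i` to every entry in row `i`. -/
def weigandt (g : Grid) (lam : List ℕ) : List (List ℕ) :=
  (List.range lam.length).map (fun (r0 : ℕ) =>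
    (List.range (lam.getD r0 0)).map (fun (c0 : ℕ) =>
      let r : ℕ := r0 + 1
      let c : ℕ := c0 + 1
      let p := (blanksOnDiag g ((c : ℤ) - (r : ℤ))).getD (min r c - 1) (0, 0)
      pipesAbove g p.1 p.2 + r))

/-! ### The Gao–Huang operator ∇, pop, and the bijection φ -/

/-- Backward tracing: enter tile `(x,y)` through its north edge (`viaN = true`) or its
east edge (`viaN = false`) and follow the pipe backwards; returns the bottom column
at which the pipe enters the grid. -/
def backAux (g : Grid) : ℕ → ℕ → ℕ → Bool → Option ℕ
  | 0, _, _, _ => none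
  | fuel + 1, x, y, viaN =>
    if g.n < x then none
    else if viaN then
      match g.tile x y with
      | .vert | .cross => if x = g.n then some y else backAux g fuel (x + 1) y true
      | .nw | .bump => backAux g fuel x (y - 1) false
      | _ => none
    else
      match g.tile x y with
      | .horiz | .cross => backAux g fuel x (y - 1) false
      | .se | .bump => if x = g.n then some y else backAux g fuel (x + 1) y true
      | _ => none

/-- The label of the pipe passing through `(x,y)` entering from the south. -/
def pipeFromS (g : Grid) (x y : ℕ) : Option ℕ :=
  if x = g.n then some y else backAux g (2 * g.n + 2) (x + 1) y true

/-- Move the mark east to the rightmost blank tile in its contiguous block of blanks. -/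
def slideEast (g : Grid) (i j : ℕ) : ℕ :=
  ((List.range' j (g.n + 1)).takeWhile (fun y => g.tile i y == Tile.blank)).getLastD j

/-- Tile rewrite for the undroop of the pipe `p` (from `(i', j+1)` into `(i, j)`)
performed in one iteration of the Gao–Huang procedure; the `(i', j+1)` case `cross → se`
is the final uncrossing step. -/
def nablaUndroop (T : ℕ → ℕ → Tile) (i i' j : ℕ) : ℕ → ℕ → Tile := fun x y =>
  let t := T x y
  if x = i ∧ y = j then (match t with | Tile.blank => Tile.se | _ => t)
  else if x = i' ∧ y = j then
    (match t with | Tile.se => Tile.vert | Tile.horiz => Tile.nw | _ => t)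
  else if x = i ∧ y = j + 1 then
    (match t with | Tile.se => Tile.horiz | Tile.vert => Tile.nw | _ => t)
  else if x = i' ∧ y = j + 1 then
    (match t with | Tile.nw => Tile.blank | Tile.cross => Tile.se | _ => t)
  else if y = j ∧ i < x ∧ x < i' then
    (match t with | Tile.blank => Tile.vert | Tile.horiz => Tile.cross | _ => t)
  else if y = j + 1 ∧ i < x ∧ x < i' then
    (match t with | Tile.vert => Tile.blank | Tile.cross => Tile.horiz | _ => t)
  else t

/-- Tile rewrite for the droop (from `(k, j)` into `(k', j+1)`) of a pipe `q` having both
a ⌐-turn and a ⌟-turn in column `j`, performed after the undroop of `p`. -/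
def nablaQDroop (T : ℕ → ℕ → Tile) (k k' j : ℕ) : ℕ → ℕ → Tile := fun x y =>
  let t := T x y
  if x = k ∧ y = j then (match t with | Tile.se => Tile.vert | _ => t)
  else if x = k' ∧ y = j then (match t with | Tile.nw => Tile.cross | _ => t)
  else if x = k ∧ y = j + 1 then (match t with | Tile.horiz => Tile.se | _ => t)
  else if x = k' ∧ y = j + 1 then (match t with | Tile.blank => Tile.nw | _ => t)
  else if y = j + 1 ∧ k < x ∧ x < k' then
    (match t with | Tile.blank => Tile.vert | Tile.horiz => Tile.cross | _ => t)
  else t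

/-- The ⌐/⌟ elbow pairs `(k, k')` of pipes in column `j` strictly between rows `i` and `i'`. -/
def qPairs (g : Grid) (i i' j : ℕ) : List (ℕ × ℕ) :=
  (List.range' 1 g.n).filterMap (fun k =>
    if i < k ∧ k < i' ∧ g.tile k j = Tile.se then
      match (List.range' 1 g.n).find?
          (fun k' => decide (k < k' ∧ k' < i' ∧ g.tile k' j = Tile.nw)) with
      | some k' => some (k, k')
      | none => none
    else none)

/-- One iteration of the marked-tile procedure on the rectangle with corners
`(i, j)` and `(i', j+1)`: undroop `p`, then droop the intersecting pipes. -/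
def nablaIter (g : Grid) (i i' j : ℕ) : Grid :=
  ⟨g.n, (qPairs g i i' j).foldl (fun T kk => nablaQDroop T kk.1 kk.2 j)
    (nablaUndroop g.tile i i' j)⟩

/-- The marked-tile loop of the Gao–Huang procedure; returns `(∇B, a)`. -/
def nablaLoop (g : Grid) : ℕ → ℕ × ℕ → Grid × ℕ
  | 0, _ => (g, 0)
  | fuel + 1, (i, j0) =>
    let j := slideEast g i j0
    match pipeFromS g i (j + 1) with
    | none => (g, 0)
    | some p =>
      if p = j + 1 then
        match (List.range' 1 g.n).find? (fun x =>
            decide (i < x) && (g.tile x (j + 1) == Tile.cross) &&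
            (backAux g (2 * g.n + 2) x (j + 1) false == some j)) with
        | some i' => (nablaIter g i i' j, j)
        | none => (g, 0)
      else
        match (List.range' 1 g.n).find? (fun x =>
            decide (i < x) && (g.tile x (j + 1) == Tile.nw)) with
        | some i' => nablaLoop (nablaIter g i i' j) fuel (i', j + 1)
        | none => (g, 0)

/-- The Gao–Huang procedure: returns `(∇B, (r, a))` where `pop(B) = (r, a)`. -/
def nablaPop (g : Grid) : Grid × ℕ × ℕ :=
  match (List.range' 1 g.n).find?
      (fun i => (List.range' 1 g.n).any (fun j => g.tile i j == Tile.blank)) with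
  | none => (g, 0, 0)
  | some r =>
    let j0 := ((List.range' 1 g.n).filter (fun j => g.tile r j == Tile.blank)).getLastD 0
    let res := nablaLoop g (g.n + 1) (r, j0)
    (res.1, r, res.2)

/-- The Gao–Huang operator `∇`. -/
def nabla (g : Grid) : Grid := (nablaPop g).1

/-- `pop(B) = (r, a)`. -/
def pop (g : Grid) : ℕ × ℕ := (nablaPop g).2

/-- The number of crossing tiles of `g` (which equals `ℓ(w)` for `g ∈ BPD(w)`). -/
def crossCount (g : Grid) : ℕ :=
  ((List.range' 1 g.n).map (fun i =>
    ((List.range' 1 g.n).filter (fun j => g.tile i j == Tile.cross)).length)).sum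

def phiAux : ℕ → Grid → List (ℕ × ℕ)
  | 0, _ => []
  | l + 1, g => pop g :: phiAux l (nabla g)

/-- The Gao–Huang bijection `φ : BPD(w) → PD(w)`,
`φ(B) = (r_1,…,r_l ; a_1,…,a_l)` with `(r_i, a_i) = pop(∇^{i-1} B)`. -/
def phi (g : Grid) : Biword :=
  ⟨(phiAux (crossCount g) g).map Prod.fst, (phiAux (crossCount g) g).map Prod.snd⟩

/-! ### Little bumps (relational) -/

/-- The reflection labelling the crossing at position `m` (0-indexed) of the word `a`:
deleting the letter at position `m` from `a` yields a word for `wordProd a * crossingRefl a m`.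
The wires `i` and `j` cross at position `m` iff `crossingRefl a m = t_{ij}`. -/
def crossingRefl (a : List ℕ) (m : ℕ) : Perm' :=
  (wordProd (a.drop (m + 1)))⁻¹ * sT (a.getD m 0) * wordProd (a.drop (m + 1))

/-- `a` is a reduced word (for its own product). -/
def IsReducedSelf (a : List ℕ) : Prop := IsReducedWord (wordProd a) a

/-- Increment the entry of `a` at position `m`. -/
def incrAt (a : List ℕ) (m : ℕ) : List ℕ := a.set m (a.getD m 0 + 1)

/-- The (upward) Little bump `L_{ij}` as a relation on biwords: starting at the position
`m_1` where wires `i` and `j` cross, repeatedly increment the current entry; stop when the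
bottom word becomes reduced, and otherwise move to the unique other position whose crossing
involves the same pair of wires. -/
def LittleBumpRel (i j : ℕ) (P P' : Biword) : Prop :=
  P'.top = P.top ∧
  ∃ ms : List ℕ, ∃ ws : List (List ℕ),
    ms ≠ [] ∧
    ws.length = ms.length + 1 ∧
    ws.getD 0 [] = P.bot ∧
    ws.getLastD [] = P'.bot ∧
    (∀ t : ℕ, t < ms.length → ws.getD (t + 1) [] = incrAt (ws.getD t []) (ms.getD t 0)) ∧
    crossingRefl P.bot (ms.getD 0 0) = tT i j ∧
    (∀ t : ℕ, t + 1 < ms.length →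
      ¬ IsReducedSelf (ws.getD (t + 1) []) ∧
      ms.getD (t + 1) 0 ≠ ms.getD t 0 ∧
      crossingRefl (ws.getD (t + 1) []) (ms.getD t 0)
        = crossingRefl (ws.getD (t + 1) []) (ms.getD (t + 1) 0)) ∧
    IsReducedSelf P'.bot

/-! ### Huang bumps -/

/-- Least offset `t ≥ 1` satisfying `p` (searched up to `bound + 1`). -/
def leastOff (p : ℕ → Bool) (bound : ℕ) : ℕ :=
  ((List.range' 1 (bound + 1)).filter p).headD 1

/-- The southeast corner `(x + k, y + l)` of the min-droop at `(x, y)`: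
`k, l ≥ 1` minimal with `(x+k, y)` and `(x, y+l)` not crossing tiles. -/
def minDroopCorner (g : Grid) (x y : ℕ) : ℕ × ℕ :=
  (x + leastOff (fun k => !(g.tile (x + k) y == Tile.cross)) g.n,
   y + leastOff (fun l => !(g.tile x (y + l) == Tile.cross)) g.n)

/-- The min-droop at `(x, y)`: droop the ⌐-turn at `(x, y)` into `(x+k, y+l)`. -/
def minDroopT (g : Grid) (x y : ℕ) : Grid :=
  let k := leastOff (fun k => !(g.tile (x + k) y == Tile.cross)) g.n
  let l := leastOff (fun l => !(g.tile x (y + l) == Tile.cross)) g.n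
  ⟨g.n, fun a b =>
    let t := g.tile a b
    if a = x ∧ b = y then
      (match t with | Tile.se => Tile.blank | Tile.bump => Tile.nw | _ => t)
    else if a = x + k ∧ b = y then (match t with | Tile.vert => Tile.se | _ => t)
    else if a = x ∧ b = y + l then
      (match t with | Tile.horiz => Tile.se | Tile.nw => Tile.vert | _ => t)
    else if a = x + k ∧ b = y + l then
      (match t with | Tile.blank => Tile.nw | Tile.se => Tile.bump | _ => t)
    else if b = y ∧ x < a ∧ a < x + k then
      (match t with | Tile.cross => Tile.horiz | Tile.vert => Tile.blank | _ => t)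
    else if a = x ∧ y < b ∧ b < y + l then
      (match t with | Tile.cross => Tile.vert | Tile.horiz => Tile.blank | _ => t)
    else if a = x + k ∧ y < b ∧ b < y + l then
      (match t with | Tile.blank => Tile.horiz | Tile.vert => Tile.cross | _ => t)
    else if b = y + l ∧ x < a ∧ a < x + k then
      (match t with | Tile.blank => Tile.vert | Tile.horiz => Tile.cross | _ => t)
    else t⟩

/-- Replace a single tile. -/
def setTile (g : Grid) (x y : ℕ) (t : Tile) : Grid :=
  ⟨g.n, fun a b => if a = x ∧ b = y then t else g.tile a b⟩

/-- Pipe `c` passes through `(x, y)` (Boolean). -/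
def onPath (g : Grid) (c : ℕ) (x y : ℕ) : Bool :=
  decide ((x, y, Dir.north) ∈ pipePath g c) || decide ((x, y, Dir.east) ∈ pipePath g c)

/-- The position of the crossing tile where pipes `c` and `c'` cross, if any. -/
def findCrossing (g : Grid) (c c' : ℕ) : Option (ℕ × ℕ) :=
  (pipePath g c).findSome? (fun s =>
    if (g.tile s.1 s.2.1 == Tile.cross) && onPath g c' s.1 s.2.1 then some (s.1, s.2.1)
    else none)

/-- The column of the ⌐-turn of pipe `c` in row `row`, if any. -/
def seTurnCol (g : Grid) (c row : ℕ) : Option ℕ :=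
  (pipePath g c).findSome? (fun s =>
    if s.1 = row ∧ s.2.2 = Dir.north ∧
        (g.tile s.1 s.2.1 = Tile.se ∨ g.tile s.1 s.2.1 = Tile.bump) then some s.2.1
    else none)

/-- The iteration of the Huang bump: min-droops and cross-bump-swaps until a bump tile
is turned into a crossing tile. -/
def huangLoop (iPipe : ℕ) : ℕ → Grid → ℕ × ℕ → Grid
  | 0, g, _ => g
  | fuel + 1, g, (x, y) =>
    let c := minDroopCorner g x y
    let g1 := minDroopT g x y
    match g1.tile c.1 c.2 with
    | Tile.nw =>
      match seTurnCol g1 iPipe c.1 with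
      | some col => huangLoop iPipe fuel g1 (c.1, col)
      | none => g1
    | Tile.bump =>
      match backAux g1 (2 * g1.n + 2) c.1 c.2 false with
      | some q =>
        match findCrossing g1 iPipe q with
        | some z =>
          huangLoop iPipe fuel (setTile (setTile g1 c.1 c.2 Tile.cross) z.1 z.2 Tile.bump) z
        | none => setTile g1 c.1 c.2 Tile.cross
      | none => g1
    | _ => g1

/-- Fuel exceeding the number of states of the procedure. -/
def huangFuel (g : Grid) : ℕ := 7 ^ (g.n * g.n) * (g.n * g.n) + 2

/-- The Huang bump `H_{ij}`: replace the crossing of pipes `i` and `j` by a bump tile,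
then repeatedly min-droop and cross-bump-swap until a new crossing tile is created. -/
def huang (i j : ℕ) (g : Grid) : Grid :=
  match findCrossing g i j with
  | some z => huangLoop i (huangFuel g) (setTile g z.1 z.2 Tile.bump) z
  | none => g




/-! ### Column insertion on finsets -/

/-- Number of elements of `C` strictly below `v`. -/
def NN (C : Finset ℕ) (v : ℕ) : ℕ := (C.filter (fun c => c < v)).card

theorem NN_insert {C : Finset ℕ} {y : ℕ} (h : y ∉ C) (v : ℕ) :
    NN (insert y C) v = NN C v + if y < v then 1 else 0 := by
  unfold NN
  rw [Finset.filter_insert]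
  split_ifs with hy
  · rw [Finset.card_insert_of_notMem]; simp [h]
  · simp

theorem NN_erase {C : Finset ℕ} {y : ℕ} (h : y ∈ C) (v : ℕ) :
    NN C v = NN (C.erase y) v + if y < v then 1 else 0 := by
  have := NN_insert (C := C.erase y) (y := y) (by simp) v
  rwa [Finset.insert_erase h] at this

theorem NN_mono (C : Finset ℕ) {u v : ℕ} (h : u ≤ v) : NN C u ≤ NN C v := by
  unfold NN
  apply Finset.card_le_card
  intro x hx
  simp only [Finset.mem_filter] at hx ⊢
  exact ⟨hx.1, by omega⟩

theorem NN_le (C : Finset ℕ) (v : ℕ) : NN C v ≤ C.card := Finset.card_filter_le _ _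

theorem NN_lt {C : Finset ℕ} {x u v : ℕ} (hx : x ∈ C) (hu : u ≤ x) (hv : x < v) :
    NN C u < NN C v := by
  have h1 := NN_erase hx u
  have h2 := NN_erase hx v
  have h3 := NN_mono (C.erase x) (show u ≤ v by omega)
  rw [if_neg (by omega)] at h1
  rw [if_pos hv] at h2
  omega

theorem NN_eq {C : Finset ℕ} {u v : ℕ} (huv : u ≤ v) (h : ∀ c ∈ C, u ≤ c → v ≤ c) :
    NN C u = NN C v := by
  unfold NN
  congr 1
  ext x
  simp only [Finset.mem_filter]
  constructor
  · rintro ⟨a, b⟩; exact ⟨a, by omega⟩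
  · rintro ⟨a, b⟩; refine ⟨a, ?_⟩
    by_contra hc
    have := h x a (by omega)
    omega

theorem NN_all {C : Finset ℕ} {v : ℕ} (h : ∀ c ∈ C, c < v) : NN C v = C.card := by
  unfold NN
  rw [Finset.filter_true_of_mem h]

theorem NN_card_all {C : Finset ℕ} {v : ℕ} (h : C.card ≤ NN C v) : ∀ c ∈ C, c < v := by
  intro c hc
  by_contra hv
  have h1 := NN_lt (u := v) (v := c + 1) hc (by omega) (by omega)
  have := NN_le C (c + 1)
  omega

@[simp] theorem NN_empty (v : ℕ) : NN ∅ v = 0 := by simp [NN]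

/-- One step of column insertion on finsets. -/
def fcol (C : Finset ℕ) (y : ℕ) : Finset ℕ × Option ℕ :=
  if h : (C.filter (fun c => y < c)).Nonempty then
    (insert y (C.erase ((C.filter (fun c => y < c)).min' h)),
      some ((C.filter (fun c => y < c)).min' h))
  else (insert y C, none)

theorem fcol_none {C : Finset ℕ} {y : ℕ} (hy : y ∉ C) (h : ∀ c ∈ C, c < y) :
    fcol C y = (insert y C, none) := by
  unfold fcol
  rw [dif_neg]
  rintro ⟨c, hc⟩
  simp only [Finset.mem_filter] at hc
  have := h c hc.1
  omega

theorem fcol_some {C : Finset ℕ} {y g : ℕ} (hg : g ∈ C) (hyg : y < g)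
    (h : ∀ c ∈ C, y < c → g ≤ c) : fcol C y = (insert y (C.erase g), some g) := by
  unfold fcol
  have hne : (C.filter (fun c => y < c)).Nonempty := ⟨g, by simp [hg, hyg]⟩
  have : (C.filter (fun c => y < c)).min' hne = g := by
    apply le_antisymm
    · apply Finset.min'_le; simp [hg, hyg]
    · apply Finset.le_min'
      intro c hc
      simp only [Finset.mem_filter] at hc
      exact h c hc.1 hc.2
  rw [dif_pos hne, this]

theorem col_cases (C : Finset ℕ) (y : ℕ) (hy : y ∉ C) :
    (∀ c ∈ C, c < y) ∨ ∃ g ∈ C, y < g ∧ ∀ c ∈ C, y < c → g ≤ c := by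
  by_cases hne : (C.filter (fun c => y < c)).Nonempty
  · right
    refine ⟨(C.filter (fun c => y < c)).min' hne, ?_, ?_, ?_⟩
    · exact (Finset.mem_filter.1 (Finset.min'_mem _ hne)).1
    · exact (Finset.mem_filter.1 (Finset.min'_mem _ hne)).2
    · intro c hc hyc
      apply Finset.min'_le; simp [hc, hyc]
  · left
    intro c hc
    by_contra h
    apply hne
    refine ⟨c, ?_⟩
    simp only [Finset.mem_filter]
    refine ⟨hc, ?_⟩
    have : c ≠ y := by rintro rfl; exact hy hc
    omega

/-- Column insertion into a list of finset columns. -/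
def fins : List (Finset ℕ) → ℕ → List (Finset ℕ) × ℕ
  | [], y => ([{y}], 0)
  | C :: R, y =>
    match fcol C y with
    | (C', none) => (C' :: R, 0)
    | (C', some g) => (C' :: (fins R g).1, (fins R g).2 + 1)

theorem fins_none {C : Finset ℕ} {y : ℕ} (R) (hy : y ∉ C) (h : ∀ c ∈ C, c < y) :
    fins (C :: R) y = (insert y C :: R, 0) := by
  simp [fins, fcol_none hy h]

theorem fins_some {C : Finset ℕ} {y g : ℕ} (R) (hg : g ∈ C) (hyg : y < g)
    (h : ∀ c ∈ C, y < c → g ≤ c) :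
    fins (C :: R) y = (insert y (C.erase g) :: (fins R g).1, (fins R g).2 + 1) := by
  simp [fins, fcol_some hg hyg h]

/-! ### Admissible words -/

/-- Update of the set of blocked letters. -/
def updL (L : Finset ℕ) (y : ℕ) : Finset ℕ := insert y (L.erase (y + 1))

theorem mem_updL {L : Finset ℕ} {x y : ℕ} : x ∈ updL L y ↔ x = y ∨ (x ≠ y + 1 ∧ x ∈ L) := by
  simp [updL]

def Adm : Finset ℕ → List ℕ → Prop
  | _, [] => True
  | L, a :: as => a ∉ L ∧ Adm (updL L a) as

theorem Adm_mono : ∀ (as : List ℕ) (L L' : Finset ℕ), L' ⊆ L → Adm L as → Adm L' as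
  | [], _, _, _, _ => trivial
  | a :: as, L, L', h, ⟨h1, h2⟩ => ⟨fun h' => h1 (h h'), Adm_mono as _ _ (by
      intro x hx
      rw [mem_updL] at hx ⊢
      rcases hx with hx | ⟨hx, hx'⟩
      · exact Or.inl hx
      · exact Or.inr ⟨hx, h hx'⟩) h2⟩

def Inv : Finset ℕ → List (Finset ℕ) → Prop
  | _, [] => True
  | L, C :: R => C ⊆ L ∧ ∃ L' : Finset ℕ,
      (∀ x ∈ L', (∃ u ∈ C, u + 1 = x) ∨ (x ∈ L ∧ x ∉ C)) ∧ Inv L' R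

theorem Inv_next {L L' : Finset ℕ} {C : Finset ℕ} {y g : ℕ} (hC : C ⊆ L)
    (hJ : ∀ x ∈ L', (∃ u ∈ C, u + 1 = x) ∨ (x ∈ L ∧ x ∉ C)) (hy : y ∉ L)
    (hg : g ∈ C) (hyg : y < g) (h : ∀ c ∈ C, y < c → g ≤ c) : g ∉ L' := by
  intro hgL
  rcases hJ g hgL with ⟨u, hu, hug⟩ | ⟨_, h2⟩
  · by_cases huy : y < u
    · have := h u hu huy
      omega
    · have : u = y := by omega
      subst this
      exact hy (hC hu)
  · exact h2 hg

theorem Inv_step : ∀ (F : List (Finset ℕ)) (L : Finset ℕ) (y : ℕ), Inv L F → y ∉ L →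
    Inv (updL L y) (fins F y).1
  | [], L, y, _, hy => by
    refine ⟨?_, ∅, by simp, trivial⟩
    intro x hx
    simp at hx
    simp [mem_updL, hx]
  | C :: R, L, y, ⟨hC, L', hJ, hR⟩, hy => by
    have hyC : y ∉ C := fun h => hy (hC h)
    rcases col_cases C y hyC with h | ⟨g, hg, hyg, h⟩
    · rw [fins_none R hyC h]
      refine ⟨?_, L', ?_, hR⟩
      · intro x hx
        rw [Finset.mem_insert] at hx
        rw [mem_updL]
        rcases hx with hx | hx
        · exact Or.inl hx
        · have := h x hx
          exact Or.inr ⟨by omega, hC hx⟩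
      · intro x hx
        rcases hJ x hx with ⟨u, hu, hux⟩ | ⟨h1, h2⟩
        · exact Or.inl ⟨u, by simp [hu], hux⟩
        · by_cases hxy : x = y + 1
          · exact Or.inl ⟨y, by simp, hxy.symm⟩
          · right
            have hxy' : x ≠ y := by rintro rfl; exact hy h1
            simp [mem_updL, h1, h2, hxy, hxy']
    · rw [fins_some R hg hyg h]
      have hgL := Inv_next hC hJ hy hg hyg h
      refine ⟨?_, updL L' g, ?_, Inv_step R L' g hR hgL⟩
      · intro x hx
        rw [Finset.mem_insert, Finset.mem_erase] at hx
        rw [mem_updL]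
        rcases hx with hx | ⟨hx, hx'⟩
        · exact Or.inl hx
        · refine Or.inr ⟨?_, hC hx'⟩
          rintro rfl
          have := h _ hx' (by omega)
          omega
      · intro x hx
        rw [mem_updL] at hx
        rcases hx with rfl | ⟨hxg, hx⟩
        · by_cases hxy : x = y + 1
          · exact Or.inl ⟨y, by simp, hxy.symm⟩
          · right
            refine ⟨?_, ?_⟩
            · rw [mem_updL]; exact Or.inr ⟨hxy, hC hg⟩
            · simp; omega
        · rcases hJ x hx with ⟨u, hu, hux⟩ | ⟨h1, h2⟩
          · refine Or.inl ⟨u, ?_, hux⟩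
            simp [hu]; right; omega
          · by_cases hxy : x = y + 1
            · exact Or.inl ⟨y, by simp, hxy.symm⟩
            · right
              have hxy' : x ≠ y := by rintro rfl; exact hy h1
              simp [mem_updL, h1, h2, hxy, hxy']

/-! ### Row condition -/

def RC (C D : Finset ℕ) : Prop := ∀ v, NN D (v + 1) ≤ NN C v

def Tab : List (Finset ℕ) → Prop
  | [] => True
  | C :: R => RC C (R.headD ∅) ∧ Tab R

theorem RC_empty (C : Finset ℕ) : RC C ∅ := by intro v; simp

theorem RC_card {C D : Finset ℕ} (h : RC C D) : D.card ≤ C.card := by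
  obtain ⟨v, hv⟩ : ∃ v, ∀ c ∈ D, c < v := ⟨D.sup id + 1, fun c hc => by
    have := Finset.le_sup (f := id) hc
    simp at this; omega⟩
  have h1 := h v
  have h2 := NN_mono D (Nat.le_succ v)
  rw [NN_all hv] at h2
  have := NN_le C v
  simp only [Nat.succ_eq_add_one] at h2
  omega

/-- row condition after inserting `y` into `C`, bumping `g` into `D`. -/
theorem RC_bump {C D D1 : Finset ℕ} {y g : ℕ} (h : RC C D) (hyC : y ∉ C) (hg : g ∈ C) (hyg : y < g)
    (hgD : g ∉ D)
    (hD1 : (D1 = insert g D ∧ ∀ c ∈ D, c < g) ∨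
      ∃ k ∈ D, g < k ∧ (∀ c ∈ D, g < c → k ≤ c) ∧ D1 = insert g (D.erase k)) :
    RC (insert y (C.erase g)) D1 := by
  intro v
  have e1 := NN_insert (C := C.erase g) (y := y) (by simp [hyC]) v
  have e2 := NN_erase hg v
  have e3 : g ≤ v → NN C g + (if g < v then 1 else 0) ≤ NN C v := by
    intro hv
    by_cases hgv : g < v
    · have := NN_lt hg le_rfl hgv
      simp [hgv]; omega
    · simp [hgv]; exact NN_mono C hv
  have e4 := h v
  have e5 := h g
  rcases hD1 with ⟨rfl, hall⟩ | ⟨k, hk, hgk, hmin, rfl⟩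
  · rw [NN_insert hgD]
    have e6 : g ≤ v → NN D (v + 1) = NN D (g + 1) := by
      intro hv
      symm
      apply NN_eq (by omega)
      intro c hc h1
      have := hall c hc
      omega
    by_cases hv : g ≤ v
    · have := e6 hv
      have := e3 hv
      split_ifs at * <;> omega
    · split_ifs at * <;> omega
  · have e7 := NN_insert (C := D.erase k) (y := g) (by simp [hgD]) (v + 1)
    have e8 := NN_erase hk (v + 1)
    have e6 : g ≤ v → v < k → NN D (v + 1) = NN D (g + 1) := by
      intro hv hvk
      symm
      apply NN_eq (by omega)
      intro c hc h1
      have := hmin c hc (by omega)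
      omega
    by_cases hv : g ≤ v
    · have := e3 hv
      by_cases hvk : v < k
      · have := e6 hv hvk
        split_ifs at * <;> omega
      · split_ifs at * <;> omega
    · split_ifs at * <;> omega

theorem RC_mono_left {C D : Finset ℕ} {y : ℕ} (h : RC C D) (hy : y ∉ C) : RC (insert y C) D := by
  intro v
  rw [NN_insert hy]
  have := h v
  omega

theorem Tab_step : ∀ (F : List (Finset ℕ)) (L : Finset ℕ) (y : ℕ), Inv L F → y ∉ L → Tab F →
    Tab (fins F y).1
  | [], L, y, _, hy, _ => ⟨RC_empty _, trivial⟩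
  | C :: R, L, y, ⟨hC, L', hJ, hR⟩, hy, ⟨hT1, hT2⟩ => by
    have hyC : y ∉ C := fun h => hy (hC h)
    rcases col_cases C y hyC with h | ⟨g, hg, hyg, h⟩
    · rw [fins_none R hyC h]
      exact ⟨RC_mono_left hT1 hyC, hT2⟩
    · rw [fins_some R hg hyg h]
      have hgL := Inv_next hC hJ hy hg hyg h
      refine ⟨?_, Tab_step R L' g hR hgL hT2⟩
      cases R with
      | nil =>
        refine RC_bump (D := ∅) hT1 hyC hg hyg (by simp) (Or.inl ⟨?_, by simp⟩)
        rfl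
      | cons D R =>
        have hgD : g ∉ D := fun h => hgL (hR.1 h)
        refine RC_bump hT1 hyC hg hyg hgD ?_
        rcases col_cases D g hgD with h' | ⟨k, hk, hgk, h'⟩
        · left
          rw [fins_none R hgD h']
          exact ⟨rfl, h'⟩
        · right
          rw [fins_some R hk hgk h']
          exact ⟨k, hk, hgk, h', rfl⟩



/-! ### The relation between inserting a word and its tail -/

def RelA : ℕ → ℕ → List (Finset ℕ) → List (Finset ℕ) → Prop
  | _, n, [], [] => n = 0
  | z, n, D :: R, D' :: R' => z ∉ D ∧ NN D z = n ∧
      ∃ z2, z2 ≤ z ∧ z2 ∉ D' ∧ insert z D = insert z2 D' ∧ RelA z2 (NN D z2) R R'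
  | _, _, _, _ => False

theorem mem_of_insert_eq {z z2 : ℕ} {D D' : Finset ℕ} (h : insert z D = insert z2 D') (x : ℕ) :
    (x = z ∨ x ∈ D) ↔ (x = z2 ∨ x ∈ D') := by
  rw [← Finset.mem_insert, h, Finset.mem_insert]

set_option maxHeartbeats 4000000 in
theorem RelA_step : ∀ (F F' : List (Finset ℕ)) (L L' : Finset ℕ) (z n : ℕ),
    Inv L F → Inv L' F' → Tab F → Tab F' → RelA z n F F' →
    (∀ y, y ∉ L → y ∉ L' → y ≠ z → (y < z → NN (F.headD ∅) y < n) →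
      RelA z n (fins F y).1 (fins F' y).1 ∧ (fins F y).2 = (fins F' y).2) ∧
    (∀ z', z < z' → z ∉ L → z' ∉ L' → NN (F'.headD ∅) (z' + 1) ≤ n →
      RelA z' (n + 1) (fins F z).1 (fins F' z').1 ∧ (fins F z).2 = (fins F' z').2)
  | [], [], L, L', z, n, _, _, _, _, hn => by
    simp only [RelA] at hn
    subst hn
    constructor
    · intro y _ _ hyz h
      have hzy : z < y := by
        by_contra hc
        have := h (by omega)
        omega
      refine ⟨⟨by simp; omega, ?_, z, le_rfl, by simp; omega, rfl, ?_⟩, rfl⟩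
      · simp [NN, hzy.le]
      · simp [RelA, NN, hzy.le]
    · intro z' hz _ _ _
      refine ⟨⟨by simp; omega, ?_, z, hz.le, by simp; omega, ?_, ?_⟩, rfl⟩
      · have : ({z} : Finset ℕ).filter (fun c => c < z') = {z} := by
          ext x; simp; omega
        simp [NN, this]
      · ext x; simp; tauto
      · simp [RelA, NN]
  | [], _ :: _, _, _, _, _, _, _, _, _, h => by simp [RelA] at h
  | _ :: _, [], _, _, _, _, _, _, _, _, h => by simp [RelA] at h
  | D :: R, D' :: R', L, L', z, n, hI, hI', hT, hT', ⟨hzD, hn, z2, hz2, hz2D, hF, hRel⟩ => by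
    obtain ⟨hDL, M, hJ, hIR⟩ := hI
    obtain ⟨hDL', M', hJ', hIR'⟩ := hI'
    obtain ⟨hRC, hTR⟩ := hT
    obtain ⟨hRC', hTR'⟩ := hT'
    have hmem := mem_of_insert_eq hF
    have ih := RelA_step R R' M M' z2 (NN D z2) hIR hIR' hTR hTR' hRel
    constructor
    · intro y hy hy' hyz hH
      have hyD : y ∉ D := fun h => hy (hDL h)
      have hyD' : y ∉ D' := fun h => hy' (hDL' h)
      have hyz2 : y ≠ z2 := by
        rintro rfl
        have := (hmem y).2 (Or.inl rfl)
        rcases this with h | h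
        · exact hyz h
        · exact hyD h
      simp only [List.headD_cons] at hH
      rcases col_cases D y hyD with h | ⟨g, hg, hyg, h⟩
      · -- append
        have hzy : z < y := by
          by_contra hc
          have h1 := hH (by omega)
          have h2 : NN D y = NN D z := NN_eq (by omega) (fun c hc1 hc2 => by
            have := h c hc1; omega)
          omega
        have h' : ∀ c ∈ D', c < y := by
          intro c hc
          rcases (hmem c).2 (Or.inr hc) with h3 | h3
          · omega
          · exact h c h3
        rw [fins_none R hyD h, fins_none R' hyD' h']
        refine ⟨⟨?_, ?_, z2, hz2, ?_, ?_, ?_⟩, rfl⟩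
        · simp [hzD, Ne.symm hyz]
        · rw [NN_insert hyD, if_neg (by omega)]; simpa using hn
        · simp [hz2D, Ne.symm hyz2]
        · rw [Finset.insert_comm, hF, Finset.insert_comm]
        · rw [NN_insert hyD, if_neg (by omega)]; simpa using hRel
      · have hkey : y < z → g < z := by
          intro hyz'
          by_contra hc
          have h1 := hH hyz'
          have h2 : NN D y = NN D z := NN_eq (by omega) (fun c hc1 hc2 => by
            have : c ≠ y := by rintro rfl; exact hyD hc1
            have := h c hc1 (by omega); omega)
          omega
        have hgz : g ≠ z := by rintro rfl; exact hzD hg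
        have e1 := NN_insert (C := D.erase g) (y := y) (by simp [hyD]) z
        have e2 := NN_erase hg z
        have hNz : NN (insert y (D.erase g)) z = n := by
          by_cases hyz' : y < z
          · have := hkey hyz'
            rw [if_pos hyz'] at e1
            rw [if_pos this] at e2
            omega
          · rw [if_neg hyz'] at e1
            rw [if_neg (by omega)] at e2
            omega
        by_cases hgz2 : g = z2
        · -- f = z2
          subst hgz2
          have hgltz : g < z := by omega
          have hzD' : z ∈ D' := by
            rcases (hmem z).1 (Or.inl rfl) with h3 | h3
            · omega
            · exact h3
          obtain ⟨f, hf, hyf, hfmin⟩ : ∃ f ∈ D', y < f ∧ ∀ c ∈ D', y < c → f ≤ c := by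
            rcases col_cases D' y hyD' with h3 | h3
            · have := h3 z hzD'; omega
            · exact h3
          have hgf : g < f := by
            rcases (hmem f).2 (Or.inr hf) with h3 | h3
            · omega
            · have := h f h3 hyf
              have : f ≠ g := by rintro rfl; exact hz2D hf
              omega
          have hfz : f ≤ z := hfmin z hzD' (by omega)
          have hgM : g ∉ M := Inv_next hDL hJ hy hg hyg h
          have hfM : f ∉ M' := Inv_next hDL' hJ' hy' hf hyf hfmin
          rw [fins_some R hg hyg h, fins_some R' hf hyf hfmin]
          have hcond : NN (R'.headD ∅) (f + 1) ≤ NN D g := by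
            have h3 := hRC' f
            have h4 : NN D' f = NN D g := by
              have h5 : NN D' y = NN D' f := NN_eq (by omega) (fun c hc1 hc2 => by
                have : c ≠ y := by rintro rfl; exact hyD' hc1
                exact hfmin c hc1 (by omega))
              have h6 : NN D y = NN D g := NN_eq (by omega) (fun c hc1 hc2 => by
                have : c ≠ y := by rintro rfl; exact hyD hc1
                exact h c hc1 (by omega))
              have h7 := NN_insert hzD y
              have h8 := NN_insert hz2D y
              rw [hF] at h7
              rw [if_neg (by omega)] at h7 h8
              omega
            omega
          obtain ⟨r1, r2⟩ := ih.2 f hgf hgM hfM hcond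
          refine ⟨⟨?_, hNz, f, hfz, ?_, ?_, ?_⟩, by simp only [r2]⟩
          · simp [hzD, Ne.symm hyz]
          · simp; omega
          · ext x
            have := hmem x
            simp only [Finset.mem_insert, Finset.mem_erase]
            by_cases hx1 : x = f
            · subst hx1
              simp only [true_or, iff_true]
              rcases (hmem x).2 (Or.inr hf) with h3 | h3
              · exact Or.inl h3
              · exact Or.inr (Or.inr ⟨by omega, h3⟩)
            · by_cases hx2 : x = g
              · subst hx2
                simp [hz2D, hx1]
                omega
              · simp only [hx1, hx2] at this ⊢
                clear * - this hx1 hx2; tauto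
          · have e3 := NN_insert (C := D.erase g) (y := y) (by simp [hyD]) f
            have e4 := NN_erase hg f
            have e5 : NN D f = NN D g + 1 := by
              have h5 : NN (D.erase g) g = NN (D.erase g) f := NN_eq (by omega)
                (fun c hc1 hc2 => by
                  rw [Finset.mem_erase] at hc1
                  rcases (hmem c).1 (Or.inr hc1.2) with h3 | h3
                  · omega
                  · exact hfmin c h3 (by omega))
              have h6 := NN_erase hg g
              simp at h6
              rw [if_pos hgf] at e4
              omega
            rw [if_pos hgf] at e4
            rw [if_pos hyf] at e3
            have : NN (insert y (D.erase g)) f = NN D g + 1 := by omega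
            rw [this]
            exact r1
        · -- same output
          have hgD' : g ∈ D' := by
            rcases (hmem g).1 (Or.inr hg) with h3 | h3
            · exact absurd h3 hgz2
            · exact h3
          have h' : ∀ c ∈ D', y < c → g ≤ c := by
            intro c hc hyc
            rcases (hmem c).2 (Or.inr hc) with h3 | h3
            · subst h3
              exact (hkey hyc).le
            · exact h c h3 hyc
          have hgM : g ∉ M := Inv_next hDL hJ hy hg hyg h
          have hgM' : g ∉ M' := Inv_next hDL' hJ' hy' hgD' hyg h'
          have hcond : g < z2 → NN (R.headD ∅) g < NN D z2 := by
            intro hlt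
            have h3 := hRC g
            have h4 := NN_lt hg le_rfl hlt
            have := NN_mono (R.headD ∅) (Nat.le_succ g)
            simp only [Nat.succ_eq_add_one] at this
            omega
          obtain ⟨r1, r2⟩ := ih.1 g hgM hgM' hgz2 hcond
          rw [fins_some R hg hyg h, fins_some R' hgD' hyg h']
          refine ⟨⟨?_, hNz, z2, hz2, ?_, ?_, ?_⟩, by simp only [r2]⟩
          · simp [hzD, Ne.symm hyz]
          · simp [hz2D, Ne.symm hyz2]
          · ext x
            have := hmem x
            simp only [Finset.mem_insert, Finset.mem_erase]
            by_cases hx1 : x = g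
            · subst hx1; simp [hgz, hgz2]
            · clear * - this hx1; tauto
          · have e3 := NN_insert (C := D.erase g) (y := y) (by simp [hyD]) z2
            have e4 := NN_erase hg z2
            have : NN (insert y (D.erase g)) z2 = NN D z2 := by
              have hz2' : y < z2 ↔ g < z2 := by
                constructor
                · intro h3
                  rcases (hmem z2).2 (Or.inl rfl) with h4 | h4
                  · subst h4; exact hkey h3
                  · have := h z2 h4 h3; omega
                · omega
              simp only [hz2'] at e3
              omega
            rw [this]
            exact r1
    · intro z' hzz hz hz' hcond
      simp only [List.headD_cons] at hcond
      have hz'D' : z' ∉ D' := fun h => hz' (hDL' h)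
      have hnoD : ∀ c ∈ D, z < c → z' < c := by
        intro c hc hzc
        by_contra hcon
        have h1 := NN_lt (u := z) (v := z' + 1) hc (by omega) (by omega)
        have h7 := NN_insert hzD (z' + 1)
        have h8 := NN_insert hz2D (z' + 1)
        rw [hF] at h7
        rw [if_pos (by omega)] at h7 h8
        omega
      have hz'D : z' ∉ D := fun h => by have := hnoD z' h hzz; omega
      rcases col_cases D z hzD with h | ⟨g, hg, hyg, h⟩
      · have h' : ∀ c ∈ D', c < z' := by
          intro c hc
          rcases (hmem c).2 (Or.inr hc) with h3 | h3
          · omega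
          · have := h c h3; omega
        rw [fins_none R hzD h, fins_none R' hz'D' h']
        refine ⟨⟨?_, ?_, z2, by omega, ?_, ?_, ?_⟩, rfl⟩
        · simp [hz'D]; omega
        · rw [NN_insert hzD, if_pos hzz, ← hn]
          congr 1
          symm
          apply NN_eq (by omega)
          intro c hc hcz
          have := h c hc; omega
        · simp [hz2D]; omega
        · rw [hF, Finset.insert_comm]
        · rw [NN_insert hzD, if_neg (by omega)]; simpa using hRel
      · have hgz' : z' < g := hnoD g hg hyg
        have hgz2 : g ≠ z2 := by omega
        have hgD' : g ∈ D' := by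
          rcases (hmem g).1 (Or.inr hg) with h3 | h3
          · exact absurd h3 hgz2
          · exact h3
        have h' : ∀ c ∈ D', z' < c → g ≤ c := by
          intro c hc hyc
          rcases (hmem c).2 (Or.inr hc) with h3 | h3
          · omega
          · exact h c h3 (by omega)
        have hgM : g ∉ M := Inv_next hDL hJ hz hg hyg h
        have hgM' : g ∉ M' := Inv_next hDL' hJ' hz' hgD' hgz' h'
        obtain ⟨r1, r2⟩ := ih.1 g hgM hgM' hgz2 (by omega)
        rw [fins_some R hg hyg h, fins_some R' hgD' hgz' h']
        refine ⟨⟨?_, ?_, z2, by omega, ?_, ?_, ?_⟩, by simp only [r2]⟩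
        · simp [hz'D]; omega
        · have e3 := NN_insert (C := D.erase g) (y := z) (by simp [hzD]) z'
          have e4 := NN_erase hg z'
          rw [if_neg (by omega)] at e4
          rw [if_pos hzz] at e3
          have : NN D z = NN D z' := NN_eq hzz.le (fun c hc h3 => by
            have : c ≠ z := by rintro rfl; exact hzD hc
            exact (hnoD c hc (by omega)).le)
          omega
        · simp [hz2D]; omega
        · ext x
          have := hmem x
          simp only [Finset.mem_insert, Finset.mem_erase]
          by_cases hx1 : x = g
          · subst hx1
            simp [hgz2]; omega
          · clear * - this hx1; tauto
        · have e3 := NN_insert (C := D.erase g) (y := z) (by simp [hzD]) z2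
          have e4 := NN_erase hg z2
          rw [if_neg (by omega)] at e3 e4
          have : NN (insert z (D.erase g)) z2 = NN D z2 := by omega
          rw [this]
          exact r1

/-- `F` is obtained from `F'` by adding one box in column `c`. -/
def RelB : ℕ → List (Finset ℕ) → List (Finset ℕ) → Prop
  | 0, C :: R, [] => (∃ z, C = {z}) ∧ R = []
  | 0, C :: R, C' :: R' => ∃ z, z ∉ C' ∧ C = insert z C' ∧ RelA z (NN C z) R R'
  | c + 1, C :: R, C' :: R' => C = C' ∧ RelB c R R'
  | _, _, _ => False

def sz (F : List (Finset ℕ)) (c : ℕ) : ℕ := (F.getD c ∅).card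

theorem RelB_step : ∀ (F F' : List (Finset ℕ)) (L L' : Finset ℕ) (c y : ℕ),
    Inv L F → Inv L' F' → Tab F → Tab F' → RelB c F F' → y ∉ L → y ∉ L' →
    ((fins F y).2 = (fins F' y).2 ∧ RelB c (fins F y).1 (fins F' y).1) ∨
    ((fins F' y).2 = c ∧ (fins F y).2 = c + 1 ∧ RelB (c + 1) (fins F y).1 (fins F' y).1 ∧
      sz F c = sz F (c + 1) + 1)
  | [], F', _, _, c, _, _, _, _, _, h, _, _ => by
    cases c <;> simp [RelB] at h
  | C :: R, [], L, L', c, y, hI, hI', hT, hT', h, hy, hy' => by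
    cases c with
    | succ c => simp [RelB] at h
    | zero =>
      obtain ⟨⟨z, rfl⟩, rfl⟩ := h
      have hyz : y ≠ z := by
        rintro rfl
        exact hy (hI.1 (by simp))
      by_cases hlt : z < y
      · left
        rw [fins_none [] (by simpa using hyz) (by simpa using hlt)]
        refine ⟨rfl, z, by simp; omega, ?_, ?_⟩
        · ext x; simp; tauto
        · have : NN (insert y {z}) z = 0 := by
            unfold NN
            rw [Finset.card_eq_zero, Finset.filter_eq_empty_iff]
            simp; omega
          simp only [RelA, this]
      · right
        rw [fins_some (g := z) [] (by simp) (by omega) (by simp)]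
        refine ⟨rfl, rfl, ⟨by simp, ⟨z, rfl⟩, rfl⟩, by simp [sz]⟩
  | C :: R, C' :: R', L, L', 0, y, hI, hI', hT, hT', ⟨z, hzC, hC, hRel⟩, hy, hy' => by
    obtain ⟨hDL, M, hJ, hIR⟩ := hI
    obtain ⟨hDL', M', hJ', hIR'⟩ := hI'
    obtain ⟨hRC, hTR⟩ := hT
    obtain ⟨hRC', hTR'⟩ := hT'
    have hyC : y ∉ C := fun h => hy (hDL h)
    have hyC' : y ∉ C' := fun h => hy' (hDL' h)
    have hzC1 : z ∈ C := by simp [hC]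
    have hmem : ∀ x, x ∈ C ↔ x = z ∨ x ∈ C' := by simp [hC]
    have hyz : y ≠ z := by rintro rfl; exact hyC hzC1
    have ih := RelA_step R R' M M' z (NN C z) hIR hIR' hTR hTR' hRel
    rcases col_cases C y hyC with h | ⟨g, hg, hyg, h⟩
    · left
      have hzy := h z hzC1
      have h' : ∀ c ∈ C', c < y := fun c hc => h c ((hmem c).2 (Or.inr hc))
      rw [fins_none R hyC h, fins_none R' hyC' h']
      refine ⟨rfl, z, ?_, ?_, ?_⟩
      · simp [hzC]; omega
      · rw [hC, Finset.insert_comm]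
      · rw [NN_insert hyC, if_neg (by omega)]; simpa using hRel
    · have hgM : g ∉ M := Inv_next hDL hJ hy hg hyg h
      by_cases hgz : g = z
      · subst hgz
        rcases col_cases C' y hyC' with h' | ⟨f, hf, hyf, h'⟩
        · right
          have hCg : NN C g = C'.card := by
            have h1 := NN_erase hg g
            simp at h1
            have h2 : C.erase g = C' := by rw [hC, Finset.erase_insert hzC]
            rw [h2] at h1
            rw [h1]
            apply NN_all
            intro c hc
            have := h' c hc
            omega
          rw [fins_some R hg hyg h, fins_none R' hyC' h']
          have hCC : insert y (C.erase g) = insert y C' := by rw [hC, Finset.erase_insert hzC]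
          refine ⟨rfl, ?_⟩
          cases R with
          | nil =>
            cases R' with
            | cons _ _ => simp [RelA] at hRel
            | nil =>
              simp only [RelA] at hRel
              refine ⟨rfl, ⟨hCC, ⟨g, rfl⟩, rfl⟩, ?_⟩
              have : C.card = C'.card + 1 := by rw [hC, Finset.card_insert_of_notMem hzC]
              simp [sz]; omega
          | cons D R =>
            cases R' with
            | nil => simp [RelA] at hRel
            | cons D' R' =>
              obtain ⟨hgD, hn, z2, hz2, hz2D, hF, hRel⟩ := hRel
              have hcards : D.card = D'.card := by
                have := congrArg Finset.card hF
                rw [Finset.card_insert_of_notMem hgD, Finset.card_insert_of_notMem hz2D] at this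
                omega
              have hle := RC_card hRC'
              simp only [List.headD_cons] at hle
              have hall : ∀ c ∈ D, c < g := NN_card_all (by omega)
              have hDc : D.card = C'.card := by
                have := NN_le D g; omega
              rw [fins_none R hgD hall]
              refine ⟨rfl, ⟨hCC, z2, hz2D, hF, ?_⟩, ?_⟩
              · rw [NN_insert hgD, if_neg (by omega)]; simpa using hRel
              · have : C.card = C'.card + 1 := by rw [hC, Finset.card_insert_of_notMem hzC]
                simp [sz]; omega
        · left
          have hgf : g < f := by
            have := h f ((hmem f).2 (Or.inr hf)) hyf
            have : f ≠ g := by rintro rfl; exact hzC hf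
            omega
          have hfM : f ∉ M' := Inv_next hDL' hJ' hy' hf hyf h'
          have hC'f : NN C' f = NN C g := by
            have h1 := NN_erase hg g
            simp at h1
            have h2 : C.erase g = C' := by rw [hC, Finset.erase_insert hzC]
            rw [h2] at h1
            rw [h1]
            symm
            apply NN_eq (by omega)
            intro c hc h3
            exact h' c hc (by omega)
          have hcond : NN (R'.headD ∅) (f + 1) ≤ NN C g := by
            have := hRC' f
            omega
          obtain ⟨r1, r2⟩ := ih.2 f hgf hgM hfM hcond
          rw [fins_some R hg hyg h, fins_some R' hf hyf h']
          have hCC : C.erase g = C' := by rw [hC, Finset.erase_insert hzC]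
          rw [hCC]
          refine ⟨by simp only [r2], f, ?_, ?_, ?_⟩
          · simp; omega
          · rw [Finset.insert_comm, Finset.insert_erase hf]
          · rw [NN_insert hyC', if_pos hyf, hC'f]
            exact r1
      · left
        have hgC' : g ∈ C' := by
          rcases (hmem g).1 hg with h3 | h3
          · exact absurd h3 hgz
          · exact h3
        have h' : ∀ c ∈ C', y < c → g ≤ c := fun c hc => h c ((hmem c).2 (Or.inr hc))
        have hgM' : g ∉ M' := Inv_next hDL' hJ' hy' hgC' hyg h'
        have hcond : g < z → NN (R.headD ∅) g < NN C z := by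
          intro hlt
          have h3 := hRC g
          have h4 := NN_lt hg le_rfl hlt
          have := NN_mono (R.headD ∅) (Nat.le_succ g)
          simp only [Nat.succ_eq_add_one] at this
          omega
        obtain ⟨r1, r2⟩ := ih.1 g hgM hgM' hgz hcond
        rw [fins_some R hg hyg h, fins_some R' hgC' hyg h']
        refine ⟨by simp only [r2], z, ?_, ?_, ?_⟩
        · simp [hzC]; omega
        · ext x
          have := hmem x
          simp only [Finset.mem_insert, Finset.mem_erase]
          by_cases hx1 : x = g
          · subst hx1; simp [hgz]
          · clear * - this hx1; tauto
        · have e3 := NN_insert (C := C.erase g) (y := y) (by simp [hyC]) z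
          have e4 := NN_erase hg z
          have : NN (insert y (C.erase g)) z = NN C z := by
            have hz2' : y < z ↔ g < z := by
              constructor
              · intro h3
                have := h z hzC1 h3; omega
              · omega
            simp only [hz2'] at e3
            omega
          rw [this]
          exact r1
  | C :: R, C' :: R', L, L', c + 1, y, hI, hI', hT, hT', ⟨hC, hRel⟩, hy, hy' => by
    subst hC
    obtain ⟨hDL, M, hJ, hIR⟩ := hI
    obtain ⟨hDL', M', hJ', hIR'⟩ := hI'
    obtain ⟨hRC, hTR⟩ := hT
    obtain ⟨hRC', hTR'⟩ := hT'
    have hyC : y ∉ C := fun h => hy (hDL h)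
    rcases col_cases C y hyC with h | ⟨g, hg, hyg, h⟩
    · left
      rw [fins_none R hyC h, fins_none R' hyC h]
      exact ⟨rfl, rfl, hRel⟩
    · have hgM : g ∉ M := Inv_next hDL hJ hy hg hyg h
      have hgM' : g ∉ M' := Inv_next hDL' hJ' hy' hg hyg h
      rw [fins_some R hg hyg h, fins_some R' hg hyg h]
      rcases RelB_step R R' M M' c g hIR hIR' hTR hTR' hRel hgM hgM' with ⟨h1, h2⟩ | ⟨h1, h2, h3, h4⟩
      · left
        exact ⟨by simp only [h1], rfl, h2⟩
      · right
        refine ⟨by simp only [h1], by simp only [h2], ⟨rfl, h3⟩, ?_⟩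
        simpa [sz] using h4

/-- inserting a smaller letter creates a box strictly to the right. -/
theorem fins_lt : ∀ (F : List (Finset ℕ)) (L : Finset ℕ) (y1 y2 : ℕ), Inv L F → y1 ∉ L →
    y2 ∉ updL L y1 → y2 < y1 → (fins F y1).2 < (fins (fins F y1).1 y2).2
  | [], L, y1, y2, _, _, _, hlt => by
    show 0 < (fins [{y1}] y2).2
    rw [fins_some (g := y1) [] (by simp) hlt (by simp)]
    simp
  | C :: R, L, y1, y2, ⟨hC, L', hJ, hR⟩, hy1, hy2, hlt => by
    have hyC : y1 ∉ C := fun h => hy1 (hC h)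
    have hstep := Inv_step (C :: R) L y1 ⟨hC, L', hJ, hR⟩ hy1
    rcases col_cases C y1 hyC with h | ⟨g, hg, hyg, h⟩
    · rw [fins_none R hyC h] at hstep ⊢
      have hy2C : y2 ∉ insert y1 C := fun h => hy2 (hstep.1 h)
      rcases col_cases _ y2 hy2C with h2 | ⟨g2, hg2, hyg2, h2⟩
      · have := h2 y1 (by simp); omega
      · rw [fins_some R hg2 hyg2 h2]
        simp
    · rw [fins_some R hg hyg h] at hstep ⊢
      have hgL := Inv_next hC hJ hy1 hg hyg h
      have hy2C : y2 ∉ insert y1 (C.erase g) := fun h => hy2 (hstep.1 h)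
      rcases col_cases _ y2 hy2C with h2 | ⟨g2, hg2, hyg2, h2⟩
      · have := h2 y1 (by simp); omega
      · rw [fins_some _ hg2 hyg2 h2]
        have hg2le := h2 y1 (by simp) hlt
        simp only
        have : g2 ∉ updL L' g := by
          rw [mem_updL]
          rintro (h3 | ⟨h3, h4⟩)
          · omega
          · rw [Finset.mem_insert, Finset.mem_erase] at hg2
            have hg2u : g2 ∈ L' := h4
            rcases hJ g2 h4 with ⟨u, hu, hu2⟩ | ⟨h5, h6⟩
            · -- u = g2 - 1 ∈ C
              by_cases huy : y2 < u
              · have := h2 u (by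
                  rw [Finset.mem_insert, Finset.mem_erase]
                  right; exact ⟨by omega, hu⟩) huy
                omega
              · have : u = y2 := by omega
                subst this
                apply hy2C
                rw [Finset.mem_insert, Finset.mem_erase]
                right; exact ⟨by omega, hu⟩
            · rcases hg2 with h7 | h7
              · subst h7; exact hy1 h5
              · exact h6 h7.2
        have := fins_lt R L' g g2 hR hgL this (by omega)
        omega



/-! ### From lists of columns to lists of finsets -/

def toF (P : List (List ℕ)) : List (Finset ℕ) := P.map List.toFinset

theorem toF_cons (C : List ℕ) (P) : toF (C :: P) = C.toFinset :: toF P := rfl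

theorem colIns_none {C : List ℕ} {x : ℕ} (h : ∀ c ∈ C.toFinset, c < x) :
    colIns x C = (C ++ [x], none) := by
  unfold colIns
  rw [if_pos]
  simpa using h

theorem find_sorted : ∀ (C : List ℕ) (x g : ℕ), C.Pairwise (· < ·) → g ∈ C → x < g →
    (∀ c ∈ C, x < c → g ≤ c) → C.find? (fun c => decide (x < c)) = some g
  | [], _, _, _, h, _, _ => by simp at h
  | c :: C, x, g, hs, hg, hxg, h => by
    rw [List.pairwise_cons] at hs
    by_cases hc : x < c
    · have h1 := h c (by simp) hc
      have : c = g := by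
        rcases List.mem_cons.1 hg with h2 | h2
        · exact h2.symm
        · have := hs.1 g h2; omega
      subst this; simp [hc]
    · rw [List.find?_cons_of_neg (by simpa using hc)]
      apply find_sorted C x g hs.2 _ hxg
      · intro c hc; exact h c (by simp [hc])
      · rcases List.mem_cons.1 hg with h2 | h2
        · subst h2; exact absurd hxg hc
        · exact h2

theorem colIns_some {C : List ℕ} {x g : ℕ} (hs : C.Pairwise (· < ·)) (hx : x ∉ C.toFinset)
    (hg : g ∈ C.toFinset) (hxg : x < g)
    (h : ∀ c ∈ C.toFinset, x < c → g ≤ c) :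
    colIns x C = (C.map (fun c => if c = g then x else c), some g) := by
  unfold colIns
  rw [List.mem_toFinset] at hx hg
  rw [if_neg, if_neg (fun h => hx h.1), find_sorted C x g hs hg hxg]
  · intro c hc; exact h c (by simpa using hc)
  · simp only [List.all_eq_true, decide_eq_true_eq]
    intro h'
    have := h' g hg
    omega

theorem map_sorted {C : List ℕ} {x g : ℕ} (hs : C.Pairwise (· < ·)) (hx : x ∉ C) (hxg : x < g)
    (h : ∀ c ∈ C, x < c → g ≤ c) :
    (C.map (fun c => if c = g then x else c)).Pairwise (· < ·) := by
  rw [List.pairwise_map]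
  refine hs.imp_of_mem ?_
  intro a b ha hb hab
  have h1 : a ≠ x := by rintro rfl; exact hx ha
  have h3 := h a ha
  split_ifs <;> omega

theorem map_toFinset {C : List ℕ} {x g : ℕ} (hg : g ∈ C) :
    (C.map (fun c => if c = g then x else c)).toFinset = insert x (C.toFinset.erase g) := by
  ext y
  simp only [List.mem_toFinset, List.mem_map, Finset.mem_insert, Finset.mem_erase]
  constructor
  · rintro ⟨c, hc, rfl⟩
    split_ifs with h
    · exact Or.inl rfl
    · exact Or.inr ⟨h, hc⟩
  · rintro (rfl | ⟨h1, h2⟩)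
    · exact ⟨g, hg, by simp⟩
    · exact ⟨y, h2, by simp [h1]⟩

theorem egInsert_fins : ∀ (P : List (List ℕ)) (L : Finset ℕ) (y : ℕ),
    (∀ C ∈ P, C.Pairwise (· < ·)) → Inv L (toF P) → y ∉ L →
    toF (egInsert P y).1 = (fins (toF P) y).1 ∧ (egInsert P y).2 = (fins (toF P) y).2 ∧
    (∀ C ∈ (egInsert P y).1, C.Pairwise (· < ·))
  | [], L, y, _, _, _ => by
    simp [egInsert, toF, fins]
  | C :: R, L, y, hs, ⟨hC, L', hJ, hR⟩, hy => by
    have hyC : y ∉ C.toFinset := fun h => hy (hC h)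
    have hsC := hs C (by simp)
    have hsR : ∀ C ∈ R, C.Pairwise (· < ·) := fun D hD => hs D (by simp [hD])
    rcases col_cases _ y hyC with h | ⟨g, hg, hyg, h⟩
    · rw [toF_cons, fins_none _ hyC h]
      unfold egInsert
      rw [colIns_none h]
      refine ⟨?_, rfl, ?_⟩
      · simp only [toF_cons]
        congr 1
        ext x; simp [or_comm]
      · intro D hD
        rcases List.mem_cons.1 hD with rfl | hD
        · rw [List.pairwise_append]
          refine ⟨hsC, by simp, ?_⟩
          intro a ha b hb
          simp at hb; subst hb
          exact h a (by simpa using ha)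
        · exact hsR D hD
    · have hgL := Inv_next hC hJ hy hg hyg h
      rw [toF_cons, fins_some _ hg hyg h]
      obtain ⟨i1, i2, i3⟩ := egInsert_fins R L' g hsR hR hgL
      unfold egInsert
      rw [colIns_some hsC hyC hg hyg h]
      refine ⟨?_, ?_, ?_⟩
      · simp only [toF_cons, i1]
        rw [map_toFinset (by simpa using hg)]
      · simp only [i2]
      · intro D hD
        rcases List.mem_cons.1 hD with rfl | hD
        · exact map_sorted hsC (by simpa using hyC) hyg (fun c hc => h c (by simpa using hc))
        · exact i3 D hD

theorem fins_sz : ∀ (F : List (Finset ℕ)) (L : Finset ℕ) (y : ℕ), Inv L F → y ∉ L →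
    (fins F y).2 ≤ F.length ∧
    (∀ c, sz (fins F y).1 c = sz F c + if c = (fins F y).2 then 1 else 0) ∧
    (fins F y).1.length = if (fins F y).2 < F.length then F.length else F.length + 1
  | [], L, y, _, _ => by
    refine ⟨by simp [fins], ?_, by simp [fins]⟩
    intro c
    cases c <;> simp [fins, sz]
  | C :: R, L, y, ⟨hC, L', hJ, hR⟩, hy => by
    have hyC : y ∉ C := fun h => hy (hC h)
    rcases col_cases _ y hyC with h | ⟨g, hg, hyg, h⟩
    · rw [fins_none _ hyC h]
      refine ⟨by simp, ?_, by simp⟩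
      intro c
      cases c <;> simp [sz, hyC]
    · have hgL := Inv_next hC hJ hy hg hyg h
      rw [fins_some _ hg hyg h]
      obtain ⟨i1, i2, i3⟩ := fins_sz R L' g hR hgL
      refine ⟨by simpa using i1, ?_, ?_⟩
      · intro c
        cases c with
        | zero =>
          have : 0 < C.card := Finset.card_pos.2 ⟨g, hg⟩
          simp [sz, hyC, Finset.card_erase_of_mem hg]; omega
        | succ c =>
          have := i2 c
          simpa [sz] using this
      · simp only [List.length_cons, i3]
        split_ifs <;> omega

theorem Tab_sz : ∀ (F : List (Finset ℕ)) (c : ℕ), Tab F → sz F (c + 1) ≤ sz F c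
  | [], c, _ => by simp [sz]
  | C :: R, 0, ⟨h, _⟩ => by
    have := RC_card h
    cases R <;> simpa [sz] using this
  | C :: R, c + 1, ⟨_, h⟩ => by
    have := Tab_sz R c h
    simpa [sz] using this

theorem sz_of_ge {F : List (Finset ℕ)} {c : ℕ} (h : F.length ≤ c) : sz F c = 0 := by
  simp [sz, List.getElem?_eq_none h]

theorem RelA_sz : ∀ (F F' : List (Finset ℕ)) (z n c : ℕ), RelA z n F F' → sz F c = sz F' c
  | [], [], _, _, _, _ => rfl
  | [], _ :: _, _, _, _, h => by simp [RelA] at h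
  | _ :: _, [], _, _, _, h => by simp [RelA] at h
  | D :: R, D' :: R', z, n, c, ⟨h1, _, z2, _, h3, h4, h5⟩ => by
    cases c with
    | zero =>
      have := congrArg Finset.card h4
      rw [Finset.card_insert_of_notMem h1, Finset.card_insert_of_notMem h3] at this
      simp [sz]; omega
    | succ c =>
      have := RelA_sz R R' _ _ c h5
      simpa [sz] using this

theorem RelB_sz : ∀ (c : ℕ) (F F' : List (Finset ℕ)) (x : ℕ), RelB c F F' →
    sz F x = sz F' x + if x = c then 1 else 0
  | 0, [], _, _, h => by simp [RelB] at h
  | c + 1, [], _, _, h => by simp [RelB] at h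
  | c + 1, _ :: _, [], _, h => by simp [RelB] at h
  | 0, C :: R, [], x, ⟨⟨z, hz⟩, hR⟩ => by
    subst hz; subst hR
    cases x <;> simp [sz]
  | 0, C :: R, C' :: R', x, ⟨z, h1, h2, h3⟩ => by
    cases x with
    | zero => simp [sz, h2, h1]
    | succ x => simpa [sz] using RelA_sz R R' _ _ x h3
  | c + 1, C :: R, C' :: R', x, ⟨h1, h2⟩ => by
    cases x with
    | zero => simp [sz, h1]
    | succ x =>
      have := RelB_sz c R R' x h2
      simpa [sz] using this



/-! ### Slides on cell functions -/

def updC (f : ℕ → ℕ → Option ℕ) (r c : ℕ) (v : Option ℕ) : ℕ → ℕ → Option ℕ :=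
  fun a b => if a = r ∧ b = c then v else f a b

theorem updC_same (f r c v) : updC f r c v r c = v := by simp [updC]

theorem updC_ne (f : ℕ → ℕ → Option ℕ) {r c : ℕ} (v) {a b : ℕ} (h : ¬ (a = r ∧ b = c)) :
    updC f r c v a b = f a b := by simp only [updC, if_neg h]

inductive Slide : (ℕ → ℕ → Option ℕ) → ℕ → ℕ → (ℕ → ℕ → Option ℕ) → ℕ → ℕ → Prop
  | halt (f r c) : f r (c + 1) = none → f (r + 1) c = none →
      Slide f r c (updC f r c none) r c
  | right (f r c f' re ce x) : f r (c + 1) = some x → (∀ y, f (r + 1) c = some y → x < y) →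
      Slide (updC f r c (some x)) r (c + 1) f' re ce → Slide f r c f' re ce
  | down (f r c f' re ce y) : f (r + 1) c = some y → (∀ x, f r (c + 1) = some x → y ≤ x) →
      Slide (updC f r c (some y)) (r + 1) c f' re ce → Slide f r c f' re ce

theorem updC_comm (f : ℕ → ℕ → Option ℕ) {r c a b : ℕ} (u v) (h : ¬ (a = r ∧ b = c)) :
    updC (updC f r c u) a b v = updC (updC f a b v) r c u := by
  funext x y
  unfold updC
  split_ifs with h1 h2 <;> first | rfl | (exfalso; apply h; omega)

theorem updC_updC (f : ℕ → ℕ → Option ℕ) (r c : ℕ) (u v) :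
    updC (updC f r c u) r c v = updC f r c v := by
  funext x y
  unfold updC
  split_ifs <;> rfl

theorem updC_self (f : ℕ → ℕ → Option ℕ) (r c : ℕ) (v) (h : f r c = v) :
    updC f r c v = f := by
  funext x y
  unfold updC
  split_ifs with h1
  · rw [h1.1, h1.2, h]
  · rfl

theorem slide_add {f : ℕ → ℕ → Option ℕ} {r c f' re ce} (hS : Slide f r c f' re ce) :
    ∀ (pr pc m : ℕ), f pr pc = none → f r c ≠ none → f pr (pc + 1) = none →
    f (pr + 1) pc = none → (∀ a b x, f a b = some x → x ≤ m) →
    (∀ a b, f a b = some m → b < pc) →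
    (¬ (pr = re ∧ pc = ce + 1) → ¬ (pr = re + 1 ∧ pc = ce) →
      Slide (updC f pr pc (some m)) r c (updC f' pr pc (some m)) re ce) ∧
    ((pr = re ∧ pc = ce + 1) ∨ (pr = re + 1 ∧ pc = ce) →
      Slide (updC f pr pc (some m)) r c (updC f' re ce (some m)) pr pc) := by
  induction hS with
  | halt f r c h1 h2 =>
    intro pr pc m hp hrc n1 n2 K1 K2
    have hpr : ¬ (r = pr ∧ c = pc) := by rintro ⟨rfl, rfl⟩; exact hrc hp
    constructor
    · intro a1 a2
      rw [updC_comm _ _ _ (by omega)]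
      apply Slide.halt
      · rw [updC_ne _ _ (by omega)]; exact h1
      · rw [updC_ne _ _ (by omega)]; exact h2
    · intro ha
      have e : updC (updC f r c none) r c (some m) =
          updC (updC (updC f pr pc (some m)) r c (some m)) pr pc none := by
        rw [updC_updC, updC_comm _ _ _ hpr, updC_updC, updC_comm _ _ _ (by omega),
          updC_self _ _ _ _ hp]
      rw [e]
      rcases ha with ⟨rfl, rfl⟩ | ⟨rfl, rfl⟩
      · refine Slide.right _ _ _ _ _ _ m (updC_same _ _ _ _) ?_ ?_
        · intro y hy
          rw [updC_ne _ _ (by omega), h2] at hy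
          simp at hy
        · apply Slide.halt
          · rw [updC_ne _ _ (by omega), updC_ne _ _ (by omega)]; exact n1
          · rw [updC_ne _ _ (by omega), updC_ne _ _ (by omega)]; exact n2
      · refine Slide.down _ _ _ _ _ _ m (updC_same _ _ _ _) ?_ ?_
        · intro y hy
          rw [updC_ne _ _ (by omega), h1] at hy
          simp at hy
        · apply Slide.halt
          · rw [updC_ne _ _ (by omega), updC_ne _ _ (by omega)]; exact n1
          · rw [updC_ne _ _ (by omega), updC_ne _ _ (by omega)]; exact n2
  | right f r c f' re ce x hx hy hS ih =>
    intro pr pc m hp hrc n1 n2 K1 K2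
    have hpr : ¬ (r = pr ∧ c = pc) := by rintro ⟨rfl, rfl⟩; exact hrc hp
    have hpr1 : ¬ (r = pr ∧ c + 1 = pc) := by rintro ⟨rfl, rfl⟩; rw [hp] at hx; simp at hx
    have hA : ¬ (pr = r ∧ pc + 1 = c) := by rintro ⟨rfl, rfl⟩; exact hrc n1
    have hB : ¬ (pr + 1 = r ∧ pc = c) := by rintro ⟨rfl, rfl⟩; exact hrc n2
    have ih' := ih pr pc m (by rw [updC_ne _ _ (by omega)]; exact hp)
      (by rw [updC_ne _ _ (by omega), hx]; simp)
      (by rw [updC_ne _ _ (by omega)]; exact n1)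
      (by rw [updC_ne _ _ (by omega)]; exact n2)
      (by
        intro a b x' hx'
        unfold updC at hx'
        split_ifs at hx'
        · simp at hx'; subst hx'; exact K1 _ _ _ hx
        · exact K1 _ _ _ hx')
      (by
        intro a b hx'
        unfold updC at hx'
        split_ifs at hx' with h
        · simp at hx'; subst hx'; have := K2 _ _ hx; omega
        · exact K2 _ _ hx')
    rw [updC_comm _ _ _ (by omega)] at ih'
    have key : ∀ F re ce, Slide (updC (updC f pr pc (some m)) r c (some x)) r (c + 1) F re ce →
        Slide (updC f pr pc (some m)) r c F re ce := by
      intro F re ce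
      apply Slide.right
      · rw [updC_ne _ _ (by omega)]; exact hx
      · intro y hy'
        unfold updC at hy'
        split_ifs at hy' with h
        · simp at hy'; subst hy'
          have k1 := K1 _ _ _ hx
          have k2 : x ≠ m := by
            rintro rfl
            have := K2 _ _ hx
            omega
          omega
        · exact hy y hy'
    exact ⟨fun a b => key _ _ _ (ih'.1 a b), fun a => key _ _ _ (ih'.2 a)⟩
  | down f r c f' re ce x hx hy hS ih =>
    intro pr pc m hp hrc n1 n2 K1 K2
    have hpr : ¬ (r = pr ∧ c = pc) := by rintro ⟨rfl, rfl⟩; exact hrc hp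
    have hpr1 : ¬ (r + 1 = pr ∧ c = pc) := by rintro ⟨rfl, rfl⟩; rw [hp] at hx; simp at hx
    have hA : ¬ (pr = r ∧ pc + 1 = c) := by rintro ⟨rfl, rfl⟩; exact hrc n1
    have hB : ¬ (pr + 1 = r ∧ pc = c) := by rintro ⟨rfl, rfl⟩; exact hrc n2
    have ih' := ih pr pc m (by rw [updC_ne _ _ (by omega)]; exact hp)
      (by rw [updC_ne _ _ (by omega), hx]; simp)
      (by rw [updC_ne _ _ (by omega)]; exact n1)
      (by rw [updC_ne _ _ (by omega)]; exact n2)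
      (by
        intro a b x' hx'
        unfold updC at hx'
        split_ifs at hx'
        · simp at hx'; subst hx'; exact K1 _ _ _ hx
        · exact K1 _ _ _ hx')
      (by
        intro a b hx'
        unfold updC at hx'
        split_ifs at hx' with h
        · simp at hx'; subst hx'; have := K2 _ _ hx; omega
        · exact K2 _ _ hx')
    rw [updC_comm _ _ _ (by omega)] at ih'
    have key : ∀ F re ce, Slide (updC (updC f pr pc (some m)) r c (some x)) (r + 1) c F re ce →
        Slide (updC f pr pc (some m)) r c F re ce := by
      intro F re ce
      apply Slide.down
      · rw [updC_ne _ _ (by omega)]; exact hx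
      · intro y hy'
        unfold updC at hy'
        split_ifs at hy' with h
        · simp at hy'; subst hy'
          exact K1 _ _ _ hx
        · exact hy y hy'
    exact ⟨fun a b => key _ _ _ (ih'.1 a b), fun a => key _ _ _ (ih'.2 a)⟩

theorem slide_le {f r c f' re ce} (hS : Slide f r c f' re ce) : r ≤ re ∧ c ≤ ce := by
  induction hS with
  | halt => exact ⟨le_rfl, le_rfl⟩
  | right => omega
  | down => omega

/-! ### jdt on lists of rows -/

def cellR (T : List (List ℕ)) (r c : ℕ) : Option ℕ := (T.getD r [])[c]?
def cellQ (Q : List (List ℕ)) (r c : ℕ) : Option ℕ := (Q.getD c [])[r]?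

def NE (T : List (List ℕ)) : Prop := ∀ row ∈ T, row ≠ []

theorem cellR_setEntry {T : List (List ℕ)} {r c x : ℕ} (h : cellR T r c ≠ none) :
    cellR (setEntry T r c x) = updC (cellR T) r c (some x) := by
  have hr : r < T.length := by
    by_contra hr
    simp [cellR, List.getElem?_eq_none (Nat.not_lt.1 hr)] at h
  have hc : c < (T[r]).length := by
    simpa [cellR, hr] using h
  funext a b
  simp only [cellR, setEntry, updC, List.getD_eq_getElem?_getD, List.getElem?_set]
  by_cases ha : r = a
  · subst ha
    simp only [hr, if_true, true_and, Option.getD_some, List.getElem?_set]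
    by_cases hb : c = b
    · subst hb
      simp [hr, hc]
    · simp [hb, Ne.symm hb]
  · simp [ha, Ne.symm ha]

theorem NE_setEntry {T : List (List ℕ)} {r c x : ℕ} (h : NE T) : NE (setEntry T r c x) := by
  intro row hrow
  unfold setEntry at hrow
  by_cases hr : r < T.length
  · rcases List.mem_or_eq_of_mem_set hrow with h1 | h1
    · exact h row h1
    · subst h1
      intro h2
      have := congrArg List.length h2
      simp [hr] at this
      exact h _ (List.getElem_mem hr) this
  · rw [List.set_eq_of_length_le (by omega)] at hrow
    exact h row hrow

theorem cellR_stop {T : List (List ℕ)} {r c : ℕ} (h : cellR T r c ≠ none) (hT : NE T)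
    (h1 : cellR T r (c + 1) = none) (h2 : cellR T (r + 1) c = none) :
    cellR ((T.set r ((T.getD r []).take c)).filter (fun row => !row.isEmpty)) =
      updC (cellR T) r c none := by
  have hr : r < T.length := by
    by_contra hr
    simp [cellR, List.getElem?_eq_none (Nat.not_lt.1 hr)] at h
  have hc : c < (T[r]).length := by
    simpa [cellR, hr] using h
  have hc1 : (T[r]).length = c + 1 := by
    have : (T[r]).length ≤ c + 1 := by simpa [cellR, hr] using h1
    omega
  rcases Nat.eq_zero_or_pos c with h0 | h0
  · subst h0
    have hl : T.length = r + 1 := by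
      by_contra hne
      have hr2 : r + 1 < T.length := by omega
      have := hT _ (List.getElem_mem hr2)
      simp [cellR, hr2] at h2
      exact this h2
    have e : (T.set r ((T.getD r []).take 0)).filter (fun row => !row.isEmpty) = T.take r := by
      have : T.set r ((T.getD r []).take 0) = T.take r ++ [[]] := by
        rw [List.set_eq_take_append_cons_drop, if_pos hr]
        simp [hl]
      rw [this, List.filter_append]
      have : (T.take r).filter (fun row => !row.isEmpty) = T.take r := by
        rw [List.filter_eq_self]
        intro a ha
        have := hT a (List.mem_of_mem_take ha)
        simpa using this
      rw [this]
      simp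
    rw [e]
    funext a b
    simp only [cellR, updC, List.getD_eq_getElem?_getD, List.getElem?_take]
    by_cases ha : a < r
    · simp only [ha, if_true]
      rw [if_neg (by omega)]
    · simp only [ha, if_false]
      by_cases ha2 : a = r
      · subst ha2
        by_cases hb : b = 0
        · simp [hb]
        · simp [hb, hr]; omega
      · rw [if_neg (by omega), List.getElem?_eq_none (l := T) (by omega)]
  · have e : (T.set r ((T.getD r []).take c)).filter (fun row => !row.isEmpty) =
        T.set r ((T.getD r []).take c) := by
      rw [List.filter_eq_self]
      intro a ha
      rcases List.mem_or_eq_of_mem_set ha with h3 | h3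
      · simpa using hT a h3
      · subst h3
        have : ((T.getD r []).take c) ≠ [] := by
          intro h4
          have := congrArg List.length h4
          rw [List.length_take, List.getD_eq_getElem _ _ hr, List.length_nil] at this
          omega
        simpa using this
    rw [e]
    funext a b
    simp only [cellR, updC, List.getD_eq_getElem?_getD, List.getElem?_set]
    by_cases ha : r = a
    · subst ha
      simp only [hr, if_true, true_and, Option.getD_some, List.getElem?_take]
      by_cases hb : b = c
      · simp [hb]
      · rw [if_neg hb]
        split_ifs
        · simp [hr]
        · simp [hr]; omega
    · simp [ha, Ne.symm ha]

theorem NE_filter (T : List (List ℕ)) : NE (T.filter (fun row => !row.isEmpty)) := by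
  intro row hrow
  simpa using (List.mem_filter.1 hrow).2

theorem jdtAux_slide {f r c f' re ce} (hS : Slide f r c f' re ce) :
    ∀ (T : List (List ℕ)) (fuel : ℕ), cellR T = f → (re - r) + (ce - c) < fuel → NE T →
    cellR T r c ≠ none → cellR (jdtAux fuel T r c) = f' ∧ NE (jdtAux fuel T r c) := by
  induction hS with
  | halt f r c h1 h2 =>
    intro T fuel hf hfu hT hrc
    subst hf
    obtain ⟨fuel, rfl⟩ : ∃ k, fuel = k + 1 := ⟨fuel - 1, by omega⟩
    have h1' := h1
    have h2' := h2
    unfold cellR at h1' h2'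
    unfold jdtAux
    simp only [h1', h2']
    exact ⟨cellR_stop hrc hT h1 h2, NE_filter _⟩
  | right f r c f' re ce x hx hy hS ih =>
    intro T fuel hf hfu hT hrc
    subst hf
    have hle := slide_le hS
    obtain ⟨fuel, rfl⟩ : ∃ k, fuel = k + 1 := ⟨fuel - 1, by omega⟩
    have ih' := ih (setEntry T r c x) fuel (cellR_setEntry hrc) (by omega) (NE_setEntry hT)
      (by rw [cellR_setEntry hrc, updC_ne _ _ (by omega), hx]; simp)
    have hx' := hx
    unfold cellR at hx'
    unfold jdtAux
    simp only [hx']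
    cases hd : cellR T (r + 1) c with
    | none =>
      have hd' := hd
      unfold cellR at hd'
      simp only [hd']
      exact ih'
    | some y =>
      have hd' := hd
      unfold cellR at hd'
      simp only [hd', if_pos (hy y hd)]
      exact ih'
  | down f r c f' re ce x hx hy hS ih =>
    intro T fuel hf hfu hT hrc
    subst hf
    have hle := slide_le hS
    obtain ⟨fuel, rfl⟩ : ∃ k, fuel = k + 1 := ⟨fuel - 1, by omega⟩
    have ih' := ih (setEntry T r c x) fuel (cellR_setEntry hrc) (by omega) (NE_setEntry hT)
      (by rw [cellR_setEntry hrc, updC_ne _ _ (by omega), hx]; simp)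
    have hx' := hx
    unfold cellR at hx'
    unfold jdtAux
    simp only [hx']
    cases hd : cellR T r (c + 1) with
    | none =>
      have hd' := hd
      unfold cellR at hd'
      simp only [hd']
      exact ih'
    | some y =>
      have hd' := hd
      unfold cellR at hd'
      have := hy y hd
      simp only [hd', if_neg (show ¬ y < x by omega)]
      exact ih'

theorem sum_bound : ∀ (T : List (List ℕ)) (r c : ℕ), NE T → cellR T r c ≠ none →
    r + c < (T.map List.length).sum
  | [], r, c, _, h => by simp [cellR] at h
  | R :: T, 0, c, _, h => by
    have : c < R.length := by simpa [cellR] using h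
    simp; omega
  | R :: T, r + 1, c, hT, h => by
    have h1 : 0 < R.length := List.length_pos_iff.2 (hT R (by simp))
    have := sum_bound T r c (fun x hx => hT x (by simp [hx])) (by simpa [cellR] using h)
    simp; omega

theorem ext_cells {T T' : List (List ℕ)} (hT : NE T) (hT' : NE T') (h : cellR T = cellR T') :
    T = T' := by
  have len : ∀ {T T' : List (List ℕ)}, NE T → cellR T = cellR T' → T.length ≤ T'.length := by
    intro T T' hT h
    by_contra hc
    have hlt : T'.length < T.length := by omega
    have h1 : 0 < (T[T'.length]).length := List.length_pos_iff.2 (hT _ (List.getElem_mem hlt))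
    have h2 := congrFun (congrFun h T'.length) 0
    simp [cellR, hlt, h1] at h2
  apply List.ext_getElem (le_antisymm (len hT h) (len hT' h.symm))
  intro i h1 h2
  apply List.ext_getElem?
  intro j
  have h3 := congrFun (congrFun h i) j
  simpa [cellR, h1, h2] using h3

/-! ### colsToRows -/

theorem filterMap_dec : ∀ (Q : List (List ℕ)) (r c : ℕ),
    (∀ x, (Q.getD (x + 1) []).length ≤ (Q.getD x []).length) →
    (Q.filterMap (fun col => col[r]?))[c]? = cellQ Q r c
  | [], r, c, _ => by simp [cellQ]
  | C :: Q, r, c, h => by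
    have hQ : ∀ x, (Q.getD (x + 1) []).length ≤ (Q.getD x []).length := fun x => by
      simpa using h (x + 1)
    by_cases hr : r < C.length
    · rw [List.filterMap_cons_some (b := C[r]) (by simp [hr])]
      cases c with
      | zero => simp [cellQ, hr]
      | succ c =>
        have := filterMap_dec Q r c hQ
        simpa [cellQ] using this
    · rw [List.filterMap_cons_none (by simpa using hr)]
      have hz : ∀ x, ((C :: Q).getD x []).length ≤ r := by
        intro x
        induction x with
        | zero => simp; omega
        | succ x ih => exact (h x).trans ih
      rw [filterMap_dec Q r c hQ]
      have h1 := hz c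
      have h2 := hz (c + 1)
      unfold cellQ
      rw [List.getElem?_eq_none h1, List.getElem?_eq_none]
      simpa using h2

theorem le_foldr_max : ∀ (l : List ℕ) (x : ℕ), x ∈ l → x ≤ l.foldr max 0
  | y :: l, x, h => by
    rcases List.mem_cons.1 h with rfl | h
    · simp
    · have := le_foldr_max l x h
      simp; omega

theorem lt_foldr_max : ∀ (l : List ℕ) (i : ℕ), i < l.foldr max 0 → ∃ x ∈ l, i < x
  | [], i, h => by simp at h
  | y :: l, i, h => by
    simp only [List.foldr_cons, lt_max_iff] at h
    rcases h with h | h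
    · exact ⟨y, by simp, h⟩
    · obtain ⟨x, hx, h⟩ := lt_foldr_max l i h
      exact ⟨x, by simp [hx], h⟩

theorem cellR_colsToRows {Q : List (List ℕ)}
    (h : ∀ x, (Q.getD (x + 1) []).length ≤ (Q.getD x []).length) :
    cellR (colsToRows Q) = cellQ Q := by
  funext r c
  unfold cellR colsToRows
  by_cases hr : r < (Q.map List.length).foldr max 0
  · rw [List.getD_eq_getElem?_getD, List.getElem?_map, List.getElem?_range hr]
    exact filterMap_dec Q r c h
  · rw [List.getD_eq_getElem?_getD, List.getElem?_map,
      List.getElem?_eq_none (l := List.range _) (by simpa using hr)]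
    simp only [Option.map_none, Option.getD_none, List.getElem?_nil]
    unfold cellQ
    symm
    apply List.getElem?_eq_none
    by_cases hc : c < Q.length
    · have := le_foldr_max (Q.map List.length) (Q[c]).length
        (List.mem_map.2 ⟨_, List.getElem_mem hc, rfl⟩)
      simp [hc]; omega
    · simp [List.getElem?_eq_none (Nat.not_lt.1 hc)]

theorem NE_colsToRows (Q : List (List ℕ)) : NE (colsToRows Q) := by
  intro row hrow
  unfold colsToRows at hrow
  obtain ⟨i, hi, rfl⟩ := List.mem_map.1 hrow
  rw [List.mem_range] at hi
  obtain ⟨x, hx, hix⟩ := lt_foldr_max _ _ hi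
  obtain ⟨C, hC, rfl⟩ := List.mem_map.1 hx
  apply List.ne_nil_of_mem (a := C[i])
  rw [List.mem_filterMap]
  exact ⟨C, hC, by simp [hix]⟩



/-! ### Fold invariant -/

structure St (L : Finset ℕ) (P Q : List (List ℕ)) : Prop where
  sorted : ∀ C ∈ P, C.Pairwise (· < ·)
  inv : Inv L (toF P)
  tab : Tab (toF P)
  len : Q.length = (toF P).length
  cols : ∀ c, (Q.getD c []).length = sz (toF P) c

theorem St_step {L P Q} (h : St L P Q) {m y : ℕ} (hy : y ∉ L) :
    St (updL L y) (egStep (P, Q) (m, y)).1 (egStep (P, Q) (m, y)).2 ∧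
    toF (egStep (P, Q) (m, y)).1 = (fins (toF P) y).1 ∧
    cellQ (egStep (P, Q) (m, y)).2 =
      updC (cellQ Q) (sz (toF P) (fins (toF P) y).2) (fins (toF P) y).2 (some m) := by
  obtain ⟨e1, e2, e3⟩ := egInsert_fins P L y h.sorted h.inv hy
  obtain ⟨f1, f2, f3⟩ := fins_sz (toF P) L y h.inv hy
  set i := (fins (toF P) y).2 with hi
  have hcell : cellQ (egStep (P, Q) (m, y)).2 = updC (cellQ Q) (sz (toF P) i) i (some m) := by
    funext a b
    have hl := h.cols i
    simp only [egStep, e2, cellQ, updC]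
    by_cases hiQ : i < Q.length
    · rw [if_pos hiQ]
      rw [List.getD_eq_getElem?_getD, List.getElem?_set]
      by_cases hb : i = b
      · rw [if_pos hb, if_pos (by omega), Option.getD_some, ← hb, ← hl]
        rcases lt_trichotomy a (Q.getD i []).length with h1 | h1 | h1
        · rw [List.getElem?_append_left h1, if_neg (by omega)]
        · rw [h1]; simp
        · rw [List.getElem?_eq_none (by simp at h1 ⊢; omega), if_neg (by omega),
            List.getElem?_eq_none (by omega)]
      · rw [if_neg hb, if_neg (by omega), List.getD_eq_getElem?_getD]
    · rw [if_neg hiQ]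
      have hiQ' : i = Q.length := by have := h.len; omega
      have hz : sz (toF P) i = 0 := by rw [← hl, hiQ']; simp
      rw [hz]
      rcases lt_trichotomy b Q.length with h1 | h1 | h1
      · rw [List.getD_append _ _ _ _ h1, if_neg (by omega)]
      · rw [h1, ← hiQ']
        rw [List.getD_append_right _ _ _ _ (by omega)]
        have : Q.getD i [] = [] := by rw [hiQ']; simp
        rw [this]
        cases a <;> simp [hiQ']
      · rw [if_neg (by omega), List.getD_eq_default _ _ (by simp; omega),
          List.getD_eq_default _ _ (by omega)]
  refine ⟨⟨e3, ?_, ?_, ?_, ?_⟩, e1, hcell⟩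
  · show Inv _ (toF (egInsert P y).1)
    rw [e1]; exact Inv_step _ _ _ h.inv hy
  · show Tab (toF (egInsert P y).1)
    rw [e1]; exact Tab_step _ _ _ h.inv hy h.tab
  · show _ = (toF (egInsert P y).1).length
    rw [e1, f3]
    simp only [egStep, e2, h.len]
    split_ifs <;> simp [h.len]
  · intro c
    show _ = sz (toF (egInsert P y).1) c
    rw [e1, f2]
    have hl := h.cols i
    rw [← h.cols c]
    simp only [egStep, e2]
    by_cases hiQ : i < Q.length
    · rw [if_pos hiQ]
      rw [List.getD_eq_getElem?_getD, List.getElem?_set]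
      by_cases hb : i = c
      · rw [if_pos hb, if_pos (by omega), Option.getD_some, ← hb]
        simp
      · rw [if_neg hb, if_neg (by omega), List.getD_eq_getElem?_getD]; rfl
    · rw [if_neg hiQ]
      have hiQ' : i = Q.length := by have := h.len; omega
      rcases lt_trichotomy c Q.length with h1 | h1 | h1
      · rw [List.getD_append _ _ _ _ h1, if_neg (by omega)]; rfl
      · rw [if_pos (by omega), h1, List.getD_append_right _ _ _ _ (by omega)]
        simp
      · rw [if_neg (by omega), List.getD_eq_default _ _ (by simp; omega),
          List.getD_eq_default _ _ (by omega)]; rfl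

theorem St_cell {L P Q} (h : St L P Q) (r c : ℕ) : cellQ Q r c = none ↔ sz (toF P) c ≤ r := by
  rw [← h.cols c]
  exact List.getElem?_eq_none_iff

theorem St_dec {L P Q} (h : St L P Q) (x : ℕ) :
    (Q.getD (x + 1) []).length ≤ (Q.getD x []).length := by
  rw [h.cols, h.cols]; exact Tab_sz _ _ h.tab

/-- Joint invariant of the two runs. -/
structure JI (L L' : Finset ℕ) (S S' : List (List ℕ) × List (List ℕ)) (m a : ℕ) : Prop where
  sub : L' ⊆ L
  st : St L S.1 S.2
  st' : St L' S'.1 S'.2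
  ne : cellQ S.2 0 0 ≠ none
  rel : ∃ c, RelB c (toF S.1) (toF S'.1) ∧
    Slide (cellQ S.2) 0 0 (cellQ S'.2) (sz (toF S.1) c - 1) c
  k1 : ∀ r c x, cellQ S.2 r c = some x → x ≤ m
  k2 : ∀ r c, cellQ S.2 r c = some m → ∀ y, y ∉ L → y < a → c < (fins (toF S.1) y).2

theorem JI_step {L L' S S' m a} (h : JI L L' S S' m a) {m2 y : ℕ} (hy : y ∉ L) (hm : m ≤ m2)
    (hc : m = m2 → y < a) :
    JI (updL L y) (updL L' y) (egStep S (m2, y)) (egStep S' (m2, y)) m2 y := by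
  obtain ⟨P, Q⟩ := S
  obtain ⟨P', Q'⟩ := S'
  obtain ⟨hsub, hst, hst', hne, ⟨c, hrel, hsl⟩, k1, k2⟩ := h
  have hy' : y ∉ L' := fun h => hy (hsub h)
  obtain ⟨s1, s2, s3⟩ := St_step hst (m := m2) hy
  obtain ⟨s1', s2', s3'⟩ := St_step hst' (m := m2) hy'
  simp only at *
  have fs := fins_sz _ L y hst.inv hy
  have fs' := fins_sz _ L' y hst'.inv hy'
  have hT' := s1'.tab
  rw [s2'] at hT'
  set F := toF P with hF
  set F' := toF P' with hF'
  have K1 : ∀ a b x, cellQ Q a b = some x → x ≤ m2 := fun a b x hx => (k1 a b x hx).trans hm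
  have K2 : ∀ a b, cellQ Q a b = some m2 → b < (fins F y).2 := by
    intro r b hx
    have h1 := k1 _ _ _ hx
    have h2 : m = m2 := by omega
    subst h2
    exact k2 r b hx y hy (hc rfl)
  have hadd := slide_add hsl (sz F (fins F y).2) (fins F y).2 m2 ((St_cell hst _ _).2 le_rfl) hne
    ((St_cell hst _ _).2 (Tab_sz _ _ hst.tab)) ((St_cell hst _ _).2 (Nat.le_succ _)) K1 K2
  have hszB := RelB_sz c F F' c hrel
  rw [if_pos rfl] at hszB
  refine ⟨?_, s1, s1', ?_, ?_, ?_, ?_⟩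
  · intro x hx
    rw [mem_updL] at hx ⊢
    rcases hx with hx | ⟨hx, hx'⟩
    · exact Or.inl hx
    · exact Or.inr ⟨hx, hsub hx'⟩
  · rw [s3]
    unfold updC
    split_ifs
    · simp
    · exact hne
  · rw [s2, s2', s3, s3']
    rcases RelB_step F F' L L' c y hst.inv hst'.inv hst.tab hst'.tab hrel hy hy' with
      ⟨hi, hR⟩ | ⟨hi', hi, hR, hsz⟩
    · refine ⟨c, hR, ?_⟩
      have fc := fs.2.1 c
      rw [← hi] at fs' ⊢
      by_cases hic : c = (fins F y).2
      · rw [if_pos hic] at fc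
        have := hadd.2 (Or.inr ⟨by rw [← hic]; omega, hic.symm⟩)
        rw [← hic] at this ⊢
        have e1 : sz (fins F y).1 c - 1 = sz F c := by omega
        have e2 : sz F' c = sz F c - 1 := by omega
        rw [e1, e2]
        exact this
      · rw [if_neg hic] at fc
        have hszi := RelB_sz c F F' (fins F y).2 hrel
        rw [if_neg (Ne.symm hic)] at hszi
        have := hadd.1 ?_ (fun h => hic h.2.symm)
        · rw [Nat.add_zero] at hszi fc
          rw [fc, ← hszi]
          exact this
        · rintro ⟨h1, h2⟩
          have t1 := Tab_sz _ c hT'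
          have t2 := fs'.2.1 c
          have t3 := fs'.2.1 (c + 1)
          rw [if_neg hic] at t2
          rw [if_pos h2.symm, ← h2] at t3
          rw [h2] at hszi h1
          rw [h2] at t3
          omega
    · refine ⟨c + 1, hR, ?_⟩
      have fc := fs.2.1 (c + 1)
      rw [if_pos hi.symm] at fc
      rw [hi'] 
      rw [hi] at hadd ⊢
      have := hadd.2 (Or.inl ⟨by omega, rfl⟩)
      have e1 : sz (fins F y).1 (c + 1) - 1 = sz F (c + 1) := by omega
      have e2 : sz F' c = sz F c - 1 := by omega
      rw [e1, e2]
      exact this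
  · intro r b x hx
    rw [s3] at hx
    unfold updC at hx
    split_ifs at hx
    · simp at hx; omega
    · exact K1 _ _ _ hx
  · intro r b hx y2 hy2 hlt
    rw [s3] at hx
    rw [s2]
    have hfl := fins_lt F L y y2 hst.inv hy hy2 hlt
    unfold updC at hx
    split_ifs at hx with h1
    · omega
    · have := K2 _ _ hx
      omega

/-- Consecutive condition on words. -/
def CC : ℕ → ℕ → List (ℕ × ℕ) → Prop
  | _, _, [] => True
  | r, a, (r', a') :: W => r ≤ r' ∧ (r = r' → a' < a) ∧ CC r' a' W

theorem JI_fold : ∀ (W : List (ℕ × ℕ)) (L L' : Finset ℕ) (S S') (m a : ℕ), JI L L' S S' m a →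
    Adm L (W.map Prod.snd) → CC m a W →
    ∃ L L' m a, JI L L' (W.foldl egStep S) (W.foldl egStep S') m a
  | [], L, L', S, S', m, a, h, _, _ => ⟨L, L', m, a, h⟩
  | (r, y) :: W, L, L', S, S', m, a, h, ⟨h1, h2⟩, ⟨h3, h4, h5⟩ =>
    JI_fold W _ _ _ _ r y (JI_step h h1 h3 h4) h2 h5

theorem JI_jdt {L L' S S' m a} (h : JI L L' S S' m a) :
    jdt (colsToRows S.2) = colsToRows S'.2 := by
  obtain ⟨c, hrel, hsl⟩ := h.rel
  have e := cellR_colsToRows (St_dec h.st)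
  have e' := cellR_colsToRows (St_dec h.st')
  have hN := NE_colsToRows S.2
  have hN' := NE_colsToRows S'.2
  have hszB := RelB_sz c _ _ c hrel
  rw [if_pos rfl] at hszB
  have hb := sum_bound (colsToRows S.2) (sz (toF S.1) c - 1) c hN (by
    rw [e]; intro h0
    rw [St_cell h.st] at h0
    omega)
  have := jdtAux_slide hsl (colsToRows S.2) (((colsToRows S.2).map List.length).sum + 1) e
    (by omega) hN (by rw [e]; exact h.ne)
  exact ext_cells this.2 hN' (this.1.trans e'.symm)

theorem jdt_word (r a : ℕ) (W : List (ℕ × ℕ)) (hA : Adm ∅ (a :: W.map Prod.snd))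
    (hC : CC r a W) :
    jdt (colsToRows (((r, a) :: W).foldl egStep ([], [])).2) =
      colsToRows (W.foldl egStep ([], [])).2 := by
  have h0 : St ∅ [] [] := ⟨by simp, trivial, trivial, rfl, by simp [toF, sz]⟩
  have h1 : a ∉ (∅ : Finset ℕ) := by simp
  obtain ⟨s1, s2, s3⟩ := St_step h0 (m := r) h1
  have hf : (fins (toF []) a) = ([{a}], 0) := rfl
  rw [hf] at s2 s3
  have hz : sz (toF []) 0 = 0 := rfl
  simp only [hz] at s3
  have hcq : cellQ [] = fun _ _ => none := by funext r c; simp [cellQ]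
  have hJ : JI (updL ∅ a) ∅ (egStep ([], []) (r, a)) ([], []) r a := by
    refine ⟨by simp, s1, h0, ?_, ⟨0, ?_, ?_⟩, ?_, ?_⟩
    · rw [s3, updC_same]; simp
    · rw [s2]
      exact ⟨⟨a, rfl⟩, rfl⟩
    · rw [s2, s3]
      have : sz [({a} : Finset ℕ)] 0 - 1 = 0 := by simp [sz]
      simp only [this]
      have e : cellQ ([] : List (List ℕ)) = updC (updC (cellQ []) 0 0 (some r)) 0 0 none := by
        rw [updC_updC, updC_self]
        simp [cellQ]
      conv => arg 4; rw [e]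
      apply Slide.halt
      · rw [updC_ne _ _ (by omega)]; simp [cellQ]
      · rw [updC_ne _ _ (by omega)]; simp [cellQ]
    · intro r' c x hx
      rw [s3, hcq] at hx
      unfold updC at hx
      split_ifs at hx
      simp at hx; omega
    · intro r' c hx y hy hlt
      have := fins_lt [] ∅ a y trivial h1 hy hlt
      rw [s3, hcq] at hx
      rw [s2]
      unfold updC at hx
      split_ifs at hx with h
      simp only [fins] at this ⊢
      omega
  obtain ⟨L, L', m, b, hF⟩ := JI_fold W _ _ _ _ _ _ hJ hA.2 hC
  exact JI_jdt hF



/-! ### Structure of Grassmannian bumpless pipe dreams -/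

structure Edg (g : Grid) : Prop where
  n1 : 1 ≤ g.n
  out : ∀ i j, ¬ InGrid g i j → g.tile i j = Tile.horiz
  nob : ∀ i j, g.tile i j ≠ Tile.bump
  V : ∀ i j, 1 ≤ i → i < g.n → 1 ≤ j → j ≤ g.n → hasS (g.tile i j) = hasN (g.tile (i + 1) j)
  H : ∀ i j, 1 ≤ i → i ≤ g.n → 1 ≤ j → j < g.n → hasE (g.tile i j) = hasW (g.tile i (j + 1))
  top : ∀ j, 1 ≤ j → j ≤ g.n → hasN (g.tile 1 j) = false
  bot : ∀ j, 1 ≤ j → j ≤ g.n → hasS (g.tile g.n j) = true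
  left : ∀ i, 1 ≤ i → i ≤ g.n → hasW (g.tile i 1) = false
  right : ∀ i, 1 ≤ i → i ≤ g.n → hasE (g.tile i g.n) = true

theorem IsBPD.edg {g : Grid} (h : IsBPD g) : Edg g := by
  obtain ⟨h1, h2, h3, h4, h5, h6, h7, h8, h9, _⟩ := h
  refine ⟨h1, h2, ?_, h4, h5, h6, h7, h8, h9⟩
  intro i j
  by_cases h : InGrid g i j
  · exact h3 i j h
  · rw [h2 i j h]; simp

inductive Stp (g : Grid) : ℕ × ℕ × Dir → ℕ × ℕ × Dir → Prop
  | north (x y d) : outDir (g.tile x y) d = some Dir.north → 1 < x →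
      Stp g (x, y, d) (x - 1, y, Dir.north)
  | east (x y d) : outDir (g.tile x y) d = some Dir.east → y < g.n →
      Stp g (x, y, d) (x, y + 1, Dir.east)

def Rch (g : Grid) (c : ℕ) (s : ℕ × ℕ × Dir) : Prop :=
  Relation.ReflTransGen (Stp g) (g.n, c, Dir.north) s

theorem Stp_unique (g : Grid) : Relator.RightUnique (Stp g) := by
  intro a b c h1 h2
  cases h1 <;> cases h2 <;> simp_all

def Val (g : Grid) (x y : ℕ) (d : Dir) : Prop :=
  1 ≤ x ∧ x ≤ g.n ∧ 1 ≤ y ∧ y ≤ g.n ∧ (d = Dir.north → hasS (g.tile x y) = true) ∧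
    (d = Dir.east → hasW (g.tile x y) = true)

theorem outN {t : Tile} {d : Dir} (h : outDir t d = some Dir.north) : hasN t = true := by
  cases t <;> cases d <;> simp_all [outDir, hasN]

theorem outE {t : Tile} {d : Dir} (h : outDir t d = some Dir.east) : hasE t = true := by
  cases t <;> cases d <;> simp_all [outDir, hasE]

theorem Stp_val {g : Grid} (hE : Edg g) {s s' : ℕ × ℕ × Dir} (h : Stp g s s')
    (hv : Val g s.1 s.2.1 s.2.2) : Val g s'.1 s'.2.1 s'.2.2 := by
  cases h with
  | north x y d h1 h2 =>
    obtain ⟨v1, v2, v3, v4, -⟩ := hv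
    simp only at *
    refine ⟨by omega, by omega, v3, v4, ?_, by simp⟩
    intro _
    rw [hE.V (x - 1) y (by omega) (by omega) v3 v4, Nat.sub_add_cancel v1]
    exact outN h1
  | east x y d h1 h2 =>
    obtain ⟨v1, v2, v3, v4, -⟩ := hv
    simp only at *
    refine ⟨by omega, by omega, by omega, by omega, by simp, ?_⟩
    intro _
    rw [← hE.H x y (by omega) (by omega) v3 h2]
    exact outE h1

theorem Rch_val {g : Grid} (hE : Edg g) {c : ℕ} (h1 : 1 ≤ c) (h2 : c ≤ g.n) {s : ℕ × ℕ × Dir}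
    (h : Rch g c s) : Val g s.1 s.2.1 s.2.2 := by
  induction h with
  | refl => exact ⟨hE.n1, le_rfl, h1, h2, fun _ => hE.bot _ h1 h2, by simp⟩
  | tail _ h ih => exact Stp_val hE h ih

theorem Rch_fuel {g : Grid} (hE : Edg g) {c : ℕ} (h1 : 1 ≤ c) (h2 : c ≤ g.n) {s : ℕ × ℕ × Dir}
    (h : Rch g c s) : ∃ f, f + (g.n - s.1) + (s.2.1 - c) = 2 * g.n + 2 ∧ c ≤ s.2.1 ∧ 0 < f ∧
      (∀ t ∈ pathAux g f s.1 s.2.1 s.2.2, t ∈ pipePath g c) ∧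
      exitRow g c = traceAux g f s.1 s.2.1 s.2.2 := by
  induction h with
  | refl => exact ⟨2 * g.n + 2, by simp, le_rfl, by omega, fun t ht => ht, rfl⟩
  | tail hr h ih =>
    have v := Rch_val hE h1 h2 hr
    have v' := Stp_val hE h v
    obtain ⟨w1, w2, w3, w4, -⟩ := v
    obtain ⟨f, f1, f2, f3, f4, f5⟩ := ih
    obtain ⟨f, rfl⟩ : ∃ e, f = e + 1 := ⟨f - 1, by omega⟩
    obtain ⟨v1, v2, v3, v4, -⟩ := v'
    cases h with
    | north x y d e1 e2 =>
      simp only at *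
      refine ⟨f, by omega, f2, by omega, ?_, ?_⟩
      · intro t ht
        apply f4
        unfold pathAux
        simp only [e1, if_neg (show ¬ x ≤ 1 by omega)]
        exact List.mem_cons_of_mem _ ht
      · rw [f5]
        conv => lhs; unfold traceAux
        simp only [e1, if_neg (show ¬ x ≤ 1 by omega)]
    | east x y d e1 e2 =>
      simp only at *
      refine ⟨f, by omega, by omega, by omega, ?_, ?_⟩
      · intro t ht
        apply f4
        unfold pathAux
        simp only [e1, if_neg (show ¬ g.n ≤ y by omega)]
        exact List.mem_cons_of_mem _ ht
      · rw [f5]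
        conv => lhs; unfold traceAux
        simp only [e1, if_neg (show ¬ g.n ≤ y by omega)]

theorem trace_le (g : Grid) : ∀ (f x y : ℕ) (d : Dir) (r : ℕ), traceAux g f x y d = some r → r ≤ x
  | 0, x, y, d, r, h => by simp [traceAux] at h
  | f + 1, x, y, d, r, h => by
    unfold traceAux at h
    cases ho : outDir (g.tile x y) d with
    | none => simp [ho] at h
    | some d' =>
      cases d' with
      | north =>
        simp only [ho] at h
        split_ifs at h
        have := trace_le g f (x - 1) y Dir.north r h
        omega
      | east =>
        simp only [ho] at h
        split_ifs at h
        · simp at h; omega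
        · exact trace_le g f x (y + 1) Dir.east r h

theorem Rch_exit_le {g : Grid} (hE : Edg g) {c : ℕ} (h1 : 1 ≤ c) (h2 : c ≤ g.n) {s : ℕ × ℕ × Dir}
    (h : Rch g c s) {e : ℕ} (he : exitRow g c = some e) : e ≤ s.1 := by
  obtain ⟨f, _, _, _, _, f5⟩ := Rch_fuel hE h1 h2 h
  rw [f5] at he
  exact trace_le _ _ _ _ _ _ he

theorem Rch_passes {g : Grid} (hE : Edg g) {c : ℕ} (h1 : 1 ≤ c) (h2 : c ≤ g.n) {x y : ℕ} {d : Dir}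
    (h : Rch g c (x, y, d)) : passes g c (x, y) := by
  obtain ⟨f, _, _, f3, f4, _⟩ := Rch_fuel hE h1 h2 h
  refine ⟨d, f4 _ ?_⟩
  obtain ⟨f, rfl⟩ : ∃ e, f = e + 1 := ⟨f - 1, by omega⟩
  unfold pathAux
  simp

theorem Rch_exit_now {g : Grid} (hE : Edg g) {c : ℕ} (h1 : 1 ≤ c) (h2 : c ≤ g.n) {x : ℕ} {d : Dir}
    (h : Rch g c (x, g.n, d)) (ho : outDir (g.tile x g.n) d = some Dir.east) :
    exitRow g c = some x := by
  obtain ⟨f, _, _, f3, _, f5⟩ := Rch_fuel hE h1 h2 h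
  obtain ⟨f, rfl⟩ : ∃ e, f = e + 1 := ⟨f - 1, by omega⟩
  rw [f5]
  unfold traceAux
  simp [ho]

/-- Behaviour of an eastbound pipe within a row. -/
theorem east_run {g : Grid} (hE : Edg g) {c : ℕ} (h1 : 1 ≤ c) (h2 : c ≤ g.n) {x : ℕ} :
    ∀ (m y : ℕ), g.n - y = m → Rch g c (x, y, Dir.east) →
    ∃ t, y ≤ t ∧ t ≤ g.n + 1 ∧
      (t ≤ g.n → 1 < x ∧ Rch g c (x - 1, t, Dir.north) ∧ g.tile x t = Tile.nw) ∧
      (t = g.n + 1 → exitRow g c = some x) ∧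
      (∀ u, y ≤ u → u < t → Rch g c (x, u, Dir.east) ∧
        (g.tile x u = Tile.horiz ∨ g.tile x u = Tile.cross)) := by
  intro m
  induction m with
  | zero =>
    intro y hy hr
    have v := Rch_val hE h1 h2 hr
    obtain ⟨v1, v2, v3, v4, -, v6⟩ := v
    simp only [true_implies] at *
    have hyn : y = g.n := by omega
    subst hyn
    have hR := hE.right x v1 v2
    have hnb := hE.nob x g.n
    have ht : g.tile x g.n = Tile.horiz ∨ g.tile x g.n = Tile.cross := by
      cases h : g.tile x g.n <;> simp_all [hasW, hasE]
    refine ⟨g.n + 1, by omega, le_rfl, by omega, ?_, ?_⟩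
    · intro _
      apply Rch_exit_now hE h1 h2 hr
      rcases ht with h | h <;> simp [h, outDir]
    · intro u hu hu'
      have : u = g.n := by omega
      subst this
      exact ⟨hr, ht⟩
  | succ m ih =>
    intro y hy hr
    have v := Rch_val hE h1 h2 hr
    obtain ⟨v1, v2, v3, v4, -, v6⟩ := v
    simp only [true_implies] at *
    have hnb := hE.nob x y
    have ht : g.tile x y = Tile.nw ∨ (g.tile x y = Tile.horiz ∨ g.tile x y = Tile.cross) := by
      cases h : g.tile x y <;> simp_all [hasW]
    rcases ht with ht | ht
    · have hx : 1 < x := by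
        by_contra hx
        have : x = 1 := by omega
        subst this
        have := hE.top y v3 v4
        rw [ht] at this
        simp [hasN] at this
      refine ⟨y, le_rfl, by omega, ?_, by omega, by omega⟩
      intro _
      refine ⟨hx, hr.tail (Stp.north x y _ (by simp [ht, outDir]) hx), ht⟩
    · have hr' : Rch g c (x, y + 1, Dir.east) := hr.tail (Stp.east x y _ (by
        rcases ht with h | h <;> simp [h, outDir]) (by omega))
      obtain ⟨t, t1, t2, t3, t4, t5⟩ := ih (y + 1) (by omega) hr'
      refine ⟨t, by omega, t2, t3, t4, ?_⟩
      intro u hu hu'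
      by_cases h : u = y
      · subst h; exact ⟨hr, ht⟩
      · exact t5 u (by omega) hu'

/-- Behaviour within a row of a pipe entering from the south. -/
theorem row_out {g : Grid} (hE : Edg g) {c : ℕ} (h1 : 1 ≤ c) (h2 : c ≤ g.n) {x a : ℕ}
    (hr : Rch g c (x, a, Dir.north)) :
    ∃ t, a ≤ t ∧ t ≤ g.n + 1 ∧
      (t ≤ g.n → 1 < x ∧ Rch g c (x - 1, t, Dir.north)) ∧
      (t = g.n + 1 → exitRow g c = some x) ∧
      (t = a → g.tile x a = Tile.vert ∨ g.tile x a = Tile.cross) ∧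
      (a < t → g.tile x a = Tile.se ∧ (t ≤ g.n → g.tile x t = Tile.nw)) ∧
      (∀ u, a < u → u < t → Rch g c (x, u, Dir.east) ∧
        (g.tile x u = Tile.horiz ∨ g.tile x u = Tile.cross)) := by
  have v := Rch_val hE h1 h2 hr
  obtain ⟨v1, v2, v3, v4, v5, -⟩ := v
  simp only [true_implies] at *
  have hnb := hE.nob x a
  have ht : g.tile x a = Tile.se ∨ (g.tile x a = Tile.vert ∨ g.tile x a = Tile.cross) := by
    cases h : g.tile x a <;> simp_all [hasS]
  rcases ht with ht | ht
  · by_cases ha : a = g.n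
    · subst ha
      refine ⟨g.n + 1, by omega, le_rfl, by omega, ?_, by omega, ?_, by omega⟩
      · intro _
        exact Rch_exit_now hE h1 h2 hr (by simp [ht, outDir])
      · intro _; exact ⟨ht, by omega⟩
    · have hr' : Rch g c (x, a + 1, Dir.east) := hr.tail (Stp.east x a _ (by
        simp [ht, outDir]) (by omega))
      obtain ⟨t, t1, t2, t3, t4, t5⟩ := east_run hE h1 h2 _ (a + 1) rfl hr'
      refine ⟨t, by omega, t2, fun h => ⟨(t3 h).1, (t3 h).2.1⟩, t4, by omega,
        fun _ => ⟨ht, fun h => (t3 h).2.2⟩, fun u hu hu' => t5 u (by omega) hu'⟩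
  · have hx : 1 < x := by
      by_contra hx
      have : x = 1 := by omega
      subst this
      have := hE.top a v3 v4
      rcases ht with ht | ht <;> rw [ht] at this <;> simp [hasN] at this
    refine ⟨a, le_rfl, by omega, ?_, by omega, fun _ => ht, by omega, by omega⟩
    intro _
    refine ⟨hx, hr.tail (Stp.north x a _ ?_ hx)⟩
    rcases ht with ht | ht <;> simp [ht, outDir]

/-- Two pipes in a row: either they stay in order or share a crossing. -/
theorem row_two {g : Grid} (hE : Edg g) {p q : ℕ} (p1 : 1 ≤ p) (p2 : p ≤ g.n) (q1 : 1 ≤ q)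
    (q2 : q ≤ g.n) {x a b : ℕ} (hp : Rch g p (x, a, Dir.north)) (hq : Rch g q (x, b, Dir.north))
    (hab : a < b) :
    (∃ y, g.tile x y = Tile.cross ∧ passes g p (x, y) ∧ passes g q (x, y)) ∨
    (exitRow g q = some x ∧ ∃ t, 1 < x ∧ Rch g p (x - 1, t, Dir.north)) ∨
    (1 < x ∧ ∃ t t', t < t' ∧ Rch g p (x - 1, t, Dir.north) ∧ Rch g q (x - 1, t', Dir.north)) := by
  have v := Rch_val hE q1 q2 hq
  obtain ⟨v1, v2, v3, v4, v5, -⟩ := v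
  simp only [true_implies] at *
  obtain ⟨t, t1, t2, t3, t4, t5, t6, t7⟩ := row_out hE p1 p2 hp
  obtain ⟨t', t1', t2', t3', t4', t5', t6', t7'⟩ := row_out hE q1 q2 hq
  rcases lt_trichotomy t b with h | h | h
  · right
    by_cases ht' : t' ≤ g.n
    · right
      exact ⟨(t3' ht').1, t, t', by omega, (t3 (by omega)).2, (t3' ht').2⟩
    · left
      exact ⟨t4' (by omega), t, (t3 (by omega)).1, (t3 (by omega)).2⟩
  · exfalso
    have := (t6 (by omega)).2 (by omega)
    rw [h] at this
    rw [this] at v5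
    simp [hasS] at v5
  · left
    obtain ⟨r1, r2⟩ := t7 b hab h
    refine ⟨b, ?_, Rch_passes hE p1 p2 r1, Rch_passes hE q1 q2 hq⟩
    rcases r2 with r2 | r2
    · rw [r2] at v5; simp [hasS] at v5
    · exact r2

theorem order_up {g : Grid} (hE : Edg g) {p q : ℕ} (p1 : 1 ≤ p) (p2 : p ≤ g.n) (q1 : 1 ≤ q)
    (q2 : q ≤ g.n) {ep eq : ℕ} (hep : exitRow g p = some ep) (heq : exitRow g q = some eq)
    (hlt : eq < ep) : ∀ (x a b : ℕ), Rch g p (x, a, Dir.north) → Rch g q (x, b, Dir.north) →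
    a < b → ∃ x' y, x' ≤ x ∧ g.tile x' y = Tile.cross ∧ passes g p (x', y) ∧ passes g q (x', y) := by
  intro x
  induction x with
  | zero =>
    intro a b hp
    have := (Rch_val hE p1 p2 hp).1
    simp at this
  | succ x ih =>
    intro a b hp hq hab
    rcases row_two hE p1 p2 q1 q2 hp hq hab with ⟨y, h⟩ | ⟨h, t, h1, h2⟩ | ⟨h, t, t', h1, h2, h3⟩
    · exact ⟨x + 1, y, le_rfl, h⟩
    · exfalso
      have := Rch_exit_le hE p1 p2 h2 hep
      rw [heq] at h
      simp at h this
      omega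
    · obtain ⟨x', y, h4, h5⟩ := ih t t' h2 h3 h1
      exact ⟨x', y, by omega, h5⟩

theorem order_down {g : Grid} (hE : Edg g) {p q : ℕ} (p1 : 1 ≤ p) (p2 : p ≤ g.n) (q1 : 1 ≤ q)
    (q2 : q ≤ g.n) (hlt : p < q) : ∀ (m x : ℕ), x + m = g.n → 1 ≤ x →
    (∃ x' y, x < x' ∧ g.tile x' y = Tile.cross ∧ passes g p (x', y) ∧ passes g q (x', y)) ∨
    (∃ e, exitRow g q = some e ∧ x < e) ∨
    (∃ a b, a < b ∧ Rch g p (x, a, Dir.north) ∧ Rch g q (x, b, Dir.north)) := by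
  intro m
  induction m with
  | zero =>
    intro x hx _
    right; right
    have : x = g.n := by omega
    subst this
    exact ⟨p, q, hlt, Relation.ReflTransGen.refl, Relation.ReflTransGen.refl⟩
  | succ m ih =>
    intro x hx hx1
    rcases ih (x + 1) (by omega) (by omega) with ⟨x', y, h, h'⟩ | ⟨e, h, h'⟩ | ⟨a, b, h, hp, hq⟩
    · exact Or.inl ⟨x', y, by omega, h'⟩
    · exact Or.inr (Or.inl ⟨e, h, by omega⟩)
    · rcases row_two hE p1 p2 q1 q2 hp hq h with ⟨y, h⟩ | ⟨h, _⟩ | ⟨h, t, t', h1, h2, h3⟩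
      · exact Or.inl ⟨x + 1, y, by omega, h⟩
      · exact Or.inr (Or.inl ⟨_, h, by omega⟩)
      · exact Or.inr (Or.inr ⟨t, t', h1, h2, h3⟩)

theorem RF_mono {g : Grid} {s s' : ℕ × ℕ × Dir} (h : Relation.ReflTransGen (Stp g) s s') :
    s'.1 ≤ s.1 ∧ s.2.1 ≤ s'.2.1 ∧
      (s = s' ∨ s'.1 < s.1 ∨ (s'.1 = s.1 ∧ s'.2.2 = Dir.east ∧ s.2.1 < s'.2.1)) := by
  induction h with
  | refl => simp
  | tail _ h ih =>
    obtain ⟨i1, i2, i3⟩ := ih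
    cases h with
    | north x y d e1 e2 =>
      simp only at *
      exact ⟨by omega, by omega, Or.inr (Or.inl (by omega))⟩
    | east x y d e1 e2 =>
      simp only at *
      refine ⟨by omega, by omega, Or.inr ?_⟩
      rcases Nat.lt_or_ge x s.1 with h | h
      · exact Or.inl h
      · exact Or.inr ⟨by omega, trivial, by omega⟩

theorem Rch_cover {g : Grid} (hE : Edg g) : ∀ (m x y : ℕ) (d : Dir), (g.n - x) + y = m →
    Val g x y d → ∃ c, 1 ≤ c ∧ c ≤ g.n ∧ Rch g c (x, y, d) := by
  intro m
  induction m with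
  | zero =>
    intro x y d h v
    have := v.2.2.1
    omega
  | succ m ih =>
    intro x y d h v
    obtain ⟨v1, v2, v3, v4, v5, v6⟩ := v
    cases d with
    | north =>
      simp only [true_implies] at v5
      by_cases hx : x = g.n
      · subst hx
        exact ⟨y, v3, v4, Relation.ReflTransGen.refl⟩
      · rw [hE.V x y v1 (by omega) v3 v4] at v5
        have hnb := hE.nob (x + 1) y
        have key : ∀ d, Val g (x + 1) y d → outDir (g.tile (x + 1) y) d = some Dir.north →
            ∃ c, 1 ≤ c ∧ c ≤ g.n ∧ Rch g c (x, y, Dir.north) := by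
          intro d hv ho
          obtain ⟨c, c1, c2, c3⟩ := ih (x + 1) y d (by omega) hv
          exact ⟨c, c1, c2, c3.tail (Stp.north (x + 1) y d ho (by omega))⟩
        cases ht : g.tile (x + 1) y with
        | vert =>
          exact key Dir.north ⟨by omega, by omega, v3, v4, by simp [ht, hasS], by simp⟩
            (by simp [ht, outDir])
        | cross =>
          exact key Dir.north ⟨by omega, by omega, v3, v4, by simp [ht, hasS], by simp⟩
            (by simp [ht, outDir])
        | nw =>
          exact key Dir.east ⟨by omega, by omega, v3, v4, by simp, by simp [ht, hasW]⟩
            (by simp [ht, outDir])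
        | bump => exact absurd ht hnb
        | blank => simp [ht, hasN] at v5
        | horiz => simp [ht, hasN] at v5
        | se => simp [ht, hasN] at v5
    | east =>
      simp only [true_implies] at v6
      have hy : 1 < y := by
        by_contra hy
        have : y = 1 := by omega
        subst this
        rw [hE.left x v1 v2] at v6
        simp at v6
      obtain ⟨y, rfl⟩ : ∃ u, y = u + 1 := ⟨y - 1, by omega⟩
      rw [← hE.H x y v1 v2 (by omega) (by omega)] at v6
      have hnb := hE.nob x y
      have key : ∀ d, Val g x y d → outDir (g.tile x y) d = some Dir.east →
          ∃ c, 1 ≤ c ∧ c ≤ g.n ∧ Rch g c (x, y + 1, Dir.east) := by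
        intro d hv ho
        obtain ⟨c, c1, c2, c3⟩ := ih x y d (by omega) hv
        exact ⟨c, c1, c2, c3.tail (Stp.east x y d ho (by omega))⟩
      cases ht : g.tile x y with
      | horiz =>
        exact key Dir.east ⟨by omega, by omega, by omega, by omega, by simp, by simp [ht, hasW]⟩
          (by simp [ht, outDir])
      | cross =>
        exact key Dir.east ⟨by omega, by omega, by omega, by omega, by simp, by simp [ht, hasW]⟩
          (by simp [ht, outDir])
      | se =>
        exact key Dir.north ⟨by omega, by omega, by omega, by omega, by simp [ht, hasS], by simp⟩
          (by simp [ht, outDir])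
      | bump => exact absurd ht hnb
      | blank => simp [ht, hasE] at v6
      | vert => simp [ht, hasE] at v6
      | nw => simp [ht, hasE] at v6



/-- Local structure of a bumpless pipe dream of a Grassmannian permutation with descent `k`. -/
structure Str (g : Grid) (k : ℕ) : Prop where
  E : Edg g
  kn : k ≤ g.n
  nc : ∀ i j, i ≤ k → 1 ≤ i → g.tile i j ≠ Tile.cross
  nl : ∀ i j, k < i → g.tile i j ≠ Tile.nw ∧ g.tile i j ≠ Tile.blank

theorem vert_of {t : Tile} (h1 : hasS t = true) (h2 : hasE t = false) : t = Tile.vert := by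
  cases t <;> simp_all [hasE, hasS]

theorem gr_desc {w : Perm'} (hG : Grassmannian w) {n : ℕ} (hn : ∀ k, n < k → w k = k) :
    ∃ k, k ≤ n ∧ ∀ x, 1 ≤ x → x ≠ k → w x < w (x + 1) := by
  have key : ∀ x, 1 ≤ x → ¬ Descent w x → w x < w (x + 1) := by
    intro x hx h
    have h' : w x ≤ w (x + 1) := by
      by_contra hc
      exact h ⟨hx, by omega⟩
    have : w x ≠ w (x + 1) := fun hc => by
      have := w.injective hc
      omega
    omega
  by_cases h : ∃ k, Descent w k
  · obtain ⟨k, hk⟩ := h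
    refine ⟨k, ?_, ?_⟩
    · by_contra hc
      have h1 := hn k (by omega)
      have h2 := hn (k + 1) (by omega)
      have := hk.2
      omega
    · intro x hx hxk
      exact key x hx (fun hd => hxk (hG.2 hd hk))
  · refine ⟨0, by omega, fun x hx _ => key x hx (fun hd => h ⟨x, hd⟩)⟩

theorem gr_mono {w : Perm'} {k : ℕ} (h : ∀ x, 1 ≤ x → x ≠ k → w x < w (x + 1)) (a : ℕ)
    (ha : 1 ≤ a) : ∀ m, (a + m < k ∨ k < a) → w a < w (a + m + 1) := by
  intro m
  induction m with
  | zero => intro hh; exact h a ha (by omega)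
  | succ m ih =>
    intro hh
    have h1 := ih (by omega)
    have h2 := h (a + m + 1) (by omega) (by omega)
    exact h1.trans h2

theorem Rch_same {g : Grid} {c c' x y : ℕ} {d d' : Dir} {u : ℕ} (_h : c = c')
    (h1 : Rch g c (x, y, d)) (h2 : Rch g c' (x, u, d')) : 
    (y = u ∧ d = d') ∨ (y < u ∧ d' = Dir.east) ∨ (u < y ∧ d = Dir.east) := by
  subst _h
  rcases Relation.ReflTransGen.total_of_right_unique (Stp_unique g) h1 h2 with h | h
  · have := (RF_mono h).2.2
    simp only [Prod.mk.injEq] at this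
    rcases this with ⟨_, h1, h2⟩ | h | ⟨_, h1, h2⟩
    · exact Or.inl ⟨h1, h2⟩
    · omega
    · exact Or.inr (Or.inl ⟨h2, h1⟩)
  · have := (RF_mono h).2.2
    simp only [Prod.mk.injEq] at this
    rcases this with ⟨_, h1, h2⟩ | h | ⟨_, h1, h2⟩
    · exact Or.inl ⟨h1.symm, h2.symm⟩
    · omega
    · exact Or.inr (Or.inr ⟨h2, h1⟩)

theorem str_low {g : Grid} (hE : Edg g) {w : Perm'} {k : ℕ} (h0 : w 0 = 0)
    (hn : ∀ k, g.n < k → w k = k)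
    (hex : ∀ c, 1 ≤ c → c ≤ g.n → exitRow g c = some (w.symm c))
    (hk : ∀ x, 1 ≤ x → x ≠ k → w x < w (x + 1)) :
    ∀ m x, x + m = g.n → k ≤ x → ∀ i, x < i → i ≤ g.n →
      (∀ j, 1 ≤ j → j < w i → g.tile i j = Tile.vert) ∧ g.tile i (w i) = Tile.se ∧
      (∀ j, w i < j → j ≤ g.n → g.tile i j = Tile.horiz ∨ g.tile i j = Tile.cross) := by
  intro m
  induction m with
  | zero => intro x hx _ i hi hi'; omega
  | succ m ih =>
    intro x hx hkx i hi hin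
    have IH := ih (x + 1) (by omega) (by omega)
    by_cases hix : i = x + 1
    swap
    · exact IH i (by omega) hin
    have hwi1 : 1 ≤ w i := by
      rcases Nat.eq_zero_or_pos (w i) with h | h
      · have : w i = w 0 := by rw [h, h0]
        have := w.injective this
        omega
      · exact h
    have hwin : w i ≤ g.n := by
      by_contra hc
      have := hn (w i) (by omega)
      have := w.injective this
      omega
    have hmono : ∀ i', i < i' → w i < w i' := by
      intro i' h
      have := gr_mono hk i (by omega) (i' - i - 1) (by omega)
      rwa [show i + (i' - i - 1) + 1 = i' by omega] at this
    have hreach : ∀ m' x', x' + m' = g.n → i ≤ x' → Rch g (w i) (x', w i, Dir.north) := by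
      intro m'
      induction m' with
      | zero =>
        intro x' h1 _
        have : x' = g.n := by omega
        subst this
        exact Relation.ReflTransGen.refl
      | succ m' ih' =>
        intro x' h1 h2
        have h3 := ih' (x' + 1) (by omega) (by omega)
        have h4 := (IH (x' + 1) (by omega) (by omega)).1 (w i) hwi1 (hmono _ (by omega))
        exact h3.tail (Stp.north (x' + 1) _ _ (by simp [h4, outDir]) (by omega))
    have hr := hreach (g.n - i) i (by omega) le_rfl
    have he := hex (w i) hwi1 hwin
    rw [Equiv.symm_apply_apply] at he
    obtain ⟨t, t1, t2, t3, t4, t5, t6, t7⟩ := row_out hE hwi1 hwin hr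
    have ht : t = g.n + 1 := by
      by_contra hc
      have h1 := t3 (by omega)
      have h2 := Rch_exit_le hE hwi1 hwin h1.2 he
      simp only at h2
      omega
    subst ht
    have hse := (t6 (by omega)).1
    refine ⟨?_, hse, fun j h1 h2 => (t7 j h1 (by omega)).2⟩
    have hS : ∀ j, 1 ≤ j → j < w i → hasS (g.tile i j) = true := by
      intro j h1 h2
      by_cases hi' : i = g.n
      · rw [hi']; exact hE.bot j h1 (by omega)
      · rw [hE.V i j (by omega) (by omega) h1 (by omega)]
        have h3 := hmono (i + 1) (by omega)
        rw [(IH (i + 1) (by omega) (by omega)).1 j h1 (by omega)]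
        rfl
    have hEv : ∀ m' j, j + m' + 1 = w i → 1 ≤ j → g.tile i j = Tile.vert := by
      intro m'
      induction m' with
      | zero =>
        intro j h1 h2
        have h3 := hE.H i j (by omega) hin h2 (by omega)
        rw [show j + 1 = w i by omega, hse] at h3
        have h4 := hS j h2 (by omega)
        exact vert_of h4 h3
      | succ m' ih' =>
        intro j h1 h2
        have h3 := hE.H i j (by omega) hin h2 (by omega)
        rw [ih' (j + 1) (by omega) (by omega)] at h3
        have h4 := hS j h2 (by omega)
        exact vert_of h4 h3
    intro j h1 h2
    exact hEv (w i - j - 1) j (by omega) h1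

theorem str_high {g : Grid} (hB : IsBPD g) {w : Perm'} {k : ℕ} (hkn : k ≤ g.n)
    (h0 : w 0 = 0)
    (hex : ∀ c, 1 ≤ c → c ≤ g.n → exitRow g c = some (w.symm c))
    (hk : ∀ x, 1 ≤ x → x ≠ k → w x < w (x + 1)) (i y : ℕ) (hi : i ≤ k) (hi1 : 1 ≤ i) :
    g.tile i y ≠ Tile.cross := by
  intro hc
  have hE := hB.edg
  have hG : InGrid g i y := by
    by_contra h
    rw [hE.out i y h] at hc
    simp at hc
  obtain ⟨_, _, y1, y2⟩ := hG
  obtain ⟨P, P1, P2, P3⟩ := Rch_cover hE _ i y Dir.east rfl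
    ⟨hi1, by omega, y1, y2, by simp, by simp [hc, hasW]⟩
  obtain ⟨Q, Q1, Q2, Q3⟩ := Rch_cover hE _ i y Dir.north rfl
    ⟨hi1, by omega, y1, y2, by simp [hc, hasS], by simp⟩
  have hPQ : P ≠ Q := by
    intro h
    have := Rch_same h P3 Q3
    simp at this
  have eP := hex P P1 P2
  have eQ := hex Q Q1 Q2
  have lP := Rch_exit_le hE P1 P2 P3 eP
  have lQ := Rch_exit_le hE Q1 Q2 Q3 eQ
  simp only at lP lQ
  have hsub := hB.2.2.2.2.2.2.2.2.2 P Q P1 P2 Q1 Q2 hPQ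
  have hz : ((i, y) : ℕ × ℕ) ∈ {z : ℕ × ℕ | g.tile z.1 z.2 = Tile.cross ∧ passes g P z ∧ passes g Q z} :=
    ⟨hc, Rch_passes hE P1 P2 P3, Rch_passes hE Q1 Q2 Q3⟩
  have pos : ∀ c, 1 ≤ c → 1 ≤ w.symm c := by
    intro c hc
    rcases Nat.eq_zero_or_pos (w.symm c) with h | h
    · rw [Equiv.symm_apply_eq, h0] at h
      omega
    · exact h
  have ord : ∀ c c', 1 ≤ c → 1 ≤ c' → w.symm c ≤ k → w.symm c' ≤ k → c < c' →
      w.symm c < w.symm c' := by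
    intro c c' h1 h2 h3 h4 h5
    by_contra hcon
    have hne : w.symm c ≠ w.symm c' := fun h => by
      have := w.symm.injective h
      omega
    have := gr_mono hk (w.symm c') (pos c' h2) (w.symm c - w.symm c' - 1) (by omega)
    rw [show w.symm c' + (w.symm c - w.symm c' - 1) + 1 = w.symm c by omega] at this
    simp at this
    omega
  rcases Nat.lt_or_gt_of_ne hPQ with h | h
  · have he := ord P Q P1 Q1 (by omega) (by omega) h
    have hi2 : 1 < i := by
      have := pos P P1
      omega
    have Q4 : Rch g Q (i - 1, y, Dir.north) :=
      Q3.tail (Stp.north i y _ (by simp [hc, outDir]) hi2)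
    obtain ⟨t, t1, t2, t3, t4, t5⟩ := east_run hE P1 P2 _ y rfl P3
    have ht : t ≤ g.n := by
      by_contra hcon
      have := t4 (by omega)
      rw [eP] at this
      simp at this
      omega
    obtain ⟨_, P4, P5⟩ := t3 ht
    have hty : y < t := by
      rcases Nat.lt_or_ge y t with h | h
      · exact h
      · have : t = y := by omega
        rw [this, hc] at P5
        simp at P5
    obtain ⟨x', y', a1, a2, a3, a4⟩ := order_up hE Q1 Q2 P1 P2 eQ eP he (i - 1) y t Q4 P4 hty
    have := hsub hz (show ((x', y') : ℕ × ℕ) ∈ _ from ⟨a2, a4, a3⟩)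
    simp at this
    omega
  · rcases order_down hE Q1 Q2 P1 P2 h (g.n - i) i (by omega) hi1 with
      ⟨x', y', a1, a2, a3, a4⟩ | ⟨e, a1, a2⟩ | ⟨a, b, a1, a2, a3⟩
    · have := hsub hz (show ((x', y') : ℕ × ℕ) ∈ _ from ⟨a2, a4, a3⟩)
      simp at this
      omega
    · rw [eP] at a1
      simp at a1
      omega
    · have h1 := Rch_same rfl Q3 a2
      have h2 := Rch_same rfl P3 a3
      simp at h1 h2
      omega

theorem MemBPD.str {w : Perm'} (hG : Grassmannian w) {g : Grid} (hB : MemBPD w g) :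
    ∃ k, Str g k := by
  obtain ⟨h1, h2, h3, h4⟩ := hB
  obtain ⟨k, k1, k2⟩ := gr_desc hG h3
  have hE := h1.edg
  refine ⟨k, hE, k1, fun i j hi hi1 => str_high h1 k1 h2 h4 k2 i j hi hi1, ?_⟩
  intro i j hi
  by_cases hG : InGrid g i j
  · obtain ⟨i1, i2, j1, j2⟩ := hG
    obtain ⟨a1, a2, a3⟩ := str_low hE h2 h3 h4 k2 (g.n - k) k (by omega) le_rfl i hi i2
    rcases lt_trichotomy j (w i) with h | h | h
    · simp [a1 j j1 h]
    · simp [h, a2]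
    · rcases a3 j h j2 with h | h <;> simp [h]
  · simp [hE.out i j hG]



/-! ### The undroop step -/

structure Und (g : Grid) (i i' j : ℕ) : Prop where
  i1 : 1 ≤ i
  ii : i < i'
  i'n : i' ≤ g.n
  j1 : 1 ≤ j
  jn : j < g.n
  a : g.tile i j = Tile.blank
  b : g.tile i' j = Tile.se ∨ g.tile i' j = Tile.horiz
  c : g.tile i (j + 1) = Tile.se ∨ g.tile i (j + 1) = Tile.vert
  d : g.tile i' (j + 1) = Tile.nw ∨ g.tile i' (j + 1) = Tile.cross
  m : ∀ x, i < x → x < i' → (g.tile x j = Tile.blank ∧ g.tile x (j + 1) = Tile.vert) ∨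
    (g.tile x j = Tile.horiz ∧ g.tile x (j + 1) = Tile.cross)

def und (g : Grid) (i i' j : ℕ) : Grid := ⟨g.n, nablaUndroop g.tile i i' j⟩

theorem Und.iter {g : Grid} {i i' j : ℕ} (h : Und g i i' j) :
    nablaIter g i i' j = und g i i' j := by
  have : qPairs g i i' j = [] := by
    unfold qPairs
    rw [List.filterMap_eq_nil_iff]
    intro k _
    rw [if_neg]
    rintro ⟨h1, h2, h3⟩
    rcases h.m k h1 h2 with h4 | h4 <;> simp [h4.1] at h3
  unfold nablaIter und
  rw [this]
  rfl

namespace Und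
variable {g : Grid} {i i' j : ℕ}

theorem t1 (h : Und g i i' j) : (und g i i' j).tile i j = Tile.se := by
  simp [und, nablaUndroop, h.a]

theorem t2 (h : Und g i i' j) : (g.tile i' j = Tile.se ∧ (und g i i' j).tile i' j = Tile.vert) ∨
    (g.tile i' j = Tile.horiz ∧ (und g i i' j).tile i' j = Tile.nw) := by
  have := h.ii
  have h1 : ¬ i' = i := by omega
  rcases h.b with h2 | h2
  · left; simp [und, nablaUndroop, h2, h1]
  · right; simp [und, nablaUndroop, h2, h1]

theorem t3 (h : Und g i i' j) :
    (g.tile i (j + 1) = Tile.se ∧ (und g i i' j).tile i (j + 1) = Tile.horiz) ∨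
    (g.tile i (j + 1) = Tile.vert ∧ (und g i i' j).tile i (j + 1) = Tile.nw) := by
  rcases h.c with h2 | h2
  · left; simp [und, nablaUndroop, h2]
  · right; simp [und, nablaUndroop, h2]

theorem t4 (h : Und g i i' j) :
    (g.tile i' (j + 1) = Tile.nw ∧ (und g i i' j).tile i' (j + 1) = Tile.blank) ∨
    (g.tile i' (j + 1) = Tile.cross ∧ (und g i i' j).tile i' (j + 1) = Tile.se) := by
  have := h.ii
  have h1 : ¬ i' = i := by omega
  rcases h.d with h2 | h2
  · left; simp [und, nablaUndroop, h2, h1]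
  · right; simp [und, nablaUndroop, h2, h1]

theorem t5 (h : Und g i i' j) (x : ℕ) (h1 : i < x) (h2 : x < i') :
    (g.tile x j = Tile.blank ∧ g.tile x (j + 1) = Tile.vert ∧
      (und g i i' j).tile x j = Tile.vert ∧ (und g i i' j).tile x (j + 1) = Tile.blank) ∨
    (g.tile x j = Tile.horiz ∧ g.tile x (j + 1) = Tile.cross ∧
      (und g i i' j).tile x j = Tile.cross ∧ (und g i i' j).tile x (j + 1) = Tile.horiz) := by
  have e1 : ¬ x = i := by omega
  have e2 : ¬ x = i' := by omega
  rcases h.m x h1 h2 with ⟨h3, h4⟩ | ⟨h3, h4⟩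
  · left; simp [und, nablaUndroop, h3, h4, e1, e2, h1, h2]
  · right; simp [und, nablaUndroop, h3, h4, e1, e2, h1, h2]

theorem t6 (x y : ℕ) (hh : x < i ∨ i' < x ∨ (y ≠ j ∧ y ≠ j + 1)) (hii : i < i') :
    (und g i i' j).tile x y = g.tile x y := by
  have e1 : ¬ (x = i ∧ y = j) := by omega
  have e2 : ¬ (x = i' ∧ y = j) := by omega
  have e3 : ¬ (x = i ∧ y = j + 1) := by omega
  have e4 : ¬ (x = i' ∧ y = j + 1) := by omega
  have e5 : ¬ (y = j ∧ i < x ∧ x < i') := by omega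
  have e6 : ¬ (y = j + 1 ∧ i < x ∧ x < i') := by omega
  simp only [und, nablaUndroop, if_neg e1, if_neg e2, if_neg e3, if_neg e4, if_neg e5, if_neg e6]

/-- Case analysis of the tiles. -/
theorem cs (h : Und g i i' j) (x y : ℕ) (P : Prop)
    (c0 : (x < i ∨ i' < x ∨ (y ≠ j ∧ y ≠ j + 1)) →
      (und g i i' j).tile x y = g.tile x y → P)
    (c1 : x = i → y = j → P) (c2 : x = i' → y = j → P)
    (c3 : x = i → y = j + 1 → P) (c4 : x = i' → y = j + 1 → P)
    (c5 : i < x → x < i' → y = j → P) (c6 : i < x → x < i' → y = j + 1 → P) : P := by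
  by_cases hh : x < i ∨ i' < x ∨ (y ≠ j ∧ y ≠ j + 1)
  · exact c0 hh (t6 x y hh h.ii)
  · rcases Nat.lt_trichotomy x i with h1 | h1 | h1
    · omega
    · by_cases hy : y = j
      · exact c1 h1 hy
      · exact c3 h1 (by omega)
    · rcases Nat.lt_trichotomy x i' with h2 | h2 | h2
      · by_cases hy : y = j
        · exact c5 h1 h2 hy
        · exact c6 h1 h2 (by omega)
      · by_cases hy : y = j
        · exact c2 h2 hy
        · exact c4 h2 (by omega)
      · omega

theorem eS (h : Und g i i' j) (x y : ℕ) : hasS ((und g i i' j).tile x y) =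
    if i ≤ x ∧ x < i' ∧ y = j then true else if i ≤ x ∧ x < i' ∧ y = j + 1 then false
    else hasS (g.tile x y) := by
  have hii := h.ii
  apply h.cs x y
  · intro h1 h2
    rw [if_neg (by omega), if_neg (by omega), h2]
  · rintro rfl rfl
    rw [if_pos (by omega), h.t1]; rfl
  · rintro rfl rfl
    rw [if_neg (by omega), if_neg (by omega)]
    rcases h.t2 with ⟨h1, h2⟩ | ⟨h1, h2⟩ <;> rw [h1, h2] <;> rfl
  · rintro rfl rfl
    rw [if_neg (by omega), if_pos (by omega)]
    rcases h.t3 with ⟨h1, h2⟩ | ⟨h1, h2⟩ <;> rw [h2] <;> rfl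
  · rintro rfl rfl
    rw [if_neg (by omega), if_neg (by omega)]
    rcases h.t4 with ⟨h1, h2⟩ | ⟨h1, h2⟩ <;> rw [h1, h2] <;> rfl
  · rintro h1 h2 rfl
    rw [if_pos (by omega)]
    rcases h.t5 x h1 h2 with ⟨-, -, h3, h4⟩ | ⟨-, -, h3, h4⟩ <;> rw [h3] <;> rfl
  · rintro h1 h2 rfl
    rw [if_neg (by omega), if_pos (by omega)]
    rcases h.t5 x h1 h2 with ⟨-, -, h3, h4⟩ | ⟨-, -, h3, h4⟩ <;> rw [h4] <;> rfl

theorem eN (h : Und g i i' j) (x y : ℕ) : hasN ((und g i i' j).tile x y) =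
    if i < x ∧ x ≤ i' ∧ y = j then true else if i < x ∧ x ≤ i' ∧ y = j + 1 then false
    else hasN (g.tile x y) := by
  have hii := h.ii
  apply h.cs x y
  · intro h1 h2
    rw [if_neg (by omega), if_neg (by omega), h2]
  · rintro rfl rfl
    rw [if_neg (by omega), if_neg (by omega), h.t1, h.a]; rfl
  · rintro rfl rfl
    rw [if_pos (by omega)]
    rcases h.t2 with ⟨h1, h2⟩ | ⟨h1, h2⟩ <;> rw [h2] <;> rfl
  · rintro rfl rfl
    rw [if_neg (by omega), if_neg (by omega)]
    rcases h.t3 with ⟨h1, h2⟩ | ⟨h1, h2⟩ <;> rw [h1, h2] <;> rfl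
  · rintro rfl rfl
    rw [if_neg (by omega), if_pos (by omega)]
    rcases h.t4 with ⟨h1, h2⟩ | ⟨h1, h2⟩ <;> rw [h2] <;> rfl
  · rintro h1 h2 rfl
    rw [if_pos (by omega)]
    rcases h.t5 x h1 h2 with ⟨-, -, h3, h4⟩ | ⟨-, -, h3, h4⟩ <;> rw [h3] <;> rfl
  · rintro h1 h2 rfl
    rw [if_neg (by omega), if_pos (by omega)]
    rcases h.t5 x h1 h2 with ⟨-, -, h3, h4⟩ | ⟨-, -, h3, h4⟩ <;> rw [h4] <;> rfl

theorem eE (h : Und g i i' j) (x y : ℕ) : hasE ((und g i i' j).tile x y) =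
    if x = i ∧ y = j then true else if x = i' ∧ y = j then false
    else hasE (g.tile x y) := by
  have hii := h.ii
  apply h.cs x y
  · intro h1 h2
    rw [if_neg (by omega), if_neg (by omega), h2]
  · rintro rfl rfl
    rw [if_pos (by omega), h.t1]; rfl
  · rintro rfl rfl
    rw [if_neg (by omega), if_pos (by omega)]
    rcases h.t2 with ⟨h1, h2⟩ | ⟨h1, h2⟩ <;> rw [h2] <;> rfl
  · rintro rfl rfl
    rw [if_neg (by omega), if_neg (by omega)]
    rcases h.t3 with ⟨h1, h2⟩ | ⟨h1, h2⟩ <;> rw [h1, h2] <;> rfl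
  · rintro rfl rfl
    rw [if_neg (by omega), if_neg (by omega)]
    rcases h.t4 with ⟨h1, h2⟩ | ⟨h1, h2⟩ <;> rw [h1, h2] <;> rfl
  · rintro h1 h2 rfl
    rw [if_neg (by omega), if_neg (by omega)]
    rcases h.t5 x h1 h2 with ⟨h5, -, h3, h4⟩ | ⟨h5, -, h3, h4⟩ <;> rw [h3, h5] <;> rfl
  · rintro h1 h2 rfl
    rw [if_neg (by omega), if_neg (by omega)]
    rcases h.t5 x h1 h2 with ⟨-, h5, h3, h4⟩ | ⟨-, h5, h3, h4⟩ <;> rw [h4, h5] <;> rfl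

theorem eW (h : Und g i i' j) (x y : ℕ) : hasW ((und g i i' j).tile x y) =
    if x = i ∧ y = j + 1 then true else if x = i' ∧ y = j + 1 then false
    else hasW (g.tile x y) := by
  have hii := h.ii
  apply h.cs x y
  · intro h1 h2
    rw [if_neg (by omega), if_neg (by omega), h2]
  · rintro rfl rfl
    rw [if_neg (by omega), if_neg (by omega), h.t1, h.a]; rfl
  · rintro rfl rfl
    rw [if_neg (by omega), if_neg (by omega)]
    rcases h.t2 with ⟨h1, h2⟩ | ⟨h1, h2⟩ <;> rw [h1, h2] <;> rfl
  · rintro rfl rfl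
    rw [if_pos (by omega)]
    rcases h.t3 with ⟨h1, h2⟩ | ⟨h1, h2⟩ <;> rw [h2] <;> rfl
  · rintro rfl rfl
    rw [if_neg (by omega), if_pos (by omega)]
    rcases h.t4 with ⟨h1, h2⟩ | ⟨h1, h2⟩ <;> rw [h2] <;> rfl
  · rintro h1 h2 rfl
    rw [if_neg (by omega), if_neg (by omega)]
    rcases h.t5 x h1 h2 with ⟨h5, -, h3, h4⟩ | ⟨h5, -, h3, h4⟩ <;> rw [h3, h5] <;> rfl
  · rintro h1 h2 rfl
    rw [if_neg (by omega), if_neg (by omega)]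
    rcases h.t5 x h1 h2 with ⟨-, h5, h3, h4⟩ | ⟨-, h5, h3, h4⟩ <;> rw [h4, h5] <;> rfl

theorem edg (h : Und g i i' j) (hE : Edg g) : Edg (und g i i' j) := by
  have hii := h.ii
  have h2 := h.i1
  have h3 := h.i'n
  have h4 := h.j1
  have h5 := h.jn
  have hn : (und g i i' j).n = g.n := rfl
  refine ⟨hE.n1, ?_, ?_, ?_, ?_, ?_, ?_, ?_, ?_⟩
  · intro x y hG
    have hG' : ¬ InGrid g x y := hG
    rw [t6 x y ?_ hii]
    · exact hE.out x y hG'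
    · by_contra hc
      apply hG'
      unfold InGrid
      omega
  · intro x y
    apply h.cs x y
    · intro _ e; rw [e]; exact hE.nob x y
    · rintro rfl rfl; rw [h.t1]; simp
    · rintro rfl rfl; rcases h.t2 with ⟨_, e⟩ | ⟨_, e⟩ <;> rw [e] <;> simp
    · rintro rfl rfl; rcases h.t3 with ⟨_, e⟩ | ⟨_, e⟩ <;> rw [e] <;> simp
    · rintro rfl rfl; rcases h.t4 with ⟨_, e⟩ | ⟨_, e⟩ <;> rw [e] <;> simp
    · rintro e1 e2 rfl
      rcases h.t5 x e1 e2 with ⟨_, _, e, _⟩ | ⟨_, _, e, _⟩ <;> rw [e] <;> simp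
    · rintro e1 e2 rfl
      rcases h.t5 x e1 e2 with ⟨_, _, _, e⟩ | ⟨_, _, _, e⟩ <;> rw [e] <;> simp
  · intro x y e1 e2 e3 e4
    rw [h.eS, h.eN, hE.V x y e1 e2 e3 e4]
    congr 1
    · simp only [eq_iff_iff]; omega
    · congr 1
      simp only [eq_iff_iff]; omega
  · intro x y e1 e2 e3 e4
    rw [h.eE, h.eW, hE.H x y e1 e2 e3 e4]
    congr 1
    · simp only [eq_iff_iff]; omega
    · congr 1
      simp only [eq_iff_iff]; omega
  · intro y e1 e2
    rw [h.eN, if_neg (by omega), if_neg (by omega)]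
    exact hE.top y e1 e2
  · intro y e1 e2
    rw [h.eS, hn, if_neg (by omega), if_neg (by omega)]
    exact hE.bot y e1 e2
  · intro y e1 e2
    rw [h.eW, if_neg (by omega), if_neg (by omega)]
    exact hE.left y e1 e2
  · intro y e1 e2
    rw [h.eE, hn, if_neg (by omega), if_neg (by omega)]
    exact hE.right y e1 e2

theorem str (h : Und g i i' j) {k : ℕ} (hS : Str g k)
    (hc : (i' ≤ k ∧ g.tile i' (j + 1) = Tile.nw) ∨
      (k < i' ∧ i ≤ k ∧ g.tile i' j = Tile.se ∧ g.tile i' (j + 1) = Tile.cross)) :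
    Str (und g i i' j) k := by
  have hii := h.ii
  have hi1 := h.i1
  refine ⟨h.edg hS.E, hS.kn, ?_, ?_⟩
  · intro x y hx hx1
    apply h.cs x y
    · intro _ e; rw [e]; exact hS.nc x y hx hx1
    · rintro rfl rfl; rw [h.t1]; simp
    · rintro rfl rfl; rcases h.t2 with ⟨_, e⟩ | ⟨_, e⟩ <;> rw [e] <;> simp
    · rintro rfl rfl; rcases h.t3 with ⟨_, e⟩ | ⟨_, e⟩ <;> rw [e] <;> simp
    · rintro rfl rfl; rcases h.t4 with ⟨_, e⟩ | ⟨_, e⟩ <;> rw [e] <;> simp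
    · rintro e1 e2 rfl
      rcases h.t5 x e1 e2 with ⟨_, _, e, _⟩ | ⟨_, e', e, _⟩
      · rw [e]; simp
      · exact absurd e' (hS.nc _ _ hx hx1)
    · rintro e1 e2 rfl
      rcases h.t5 x e1 e2 with ⟨_, _, _, e⟩ | ⟨_, _, _, e⟩ <;> rw [e] <;> simp
  · intro x y hx
    apply h.cs x y
    · intro _ e; rw [e]; exact hS.nl x y hx
    · rintro rfl rfl; rw [h.t1]; simp
    · rintro rfl rfl
      rcases hc with hc | hc
      · omega
      · rcases h.t2 with ⟨e', e⟩ | ⟨e', e⟩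
        · rw [e]; simp
        · rw [hc.2.2.1] at e'; simp at e'
    · rintro rfl rfl; omega
    · rintro rfl rfl
      rcases hc with hc | hc
      · omega
      · rcases h.t4 with ⟨e', e⟩ | ⟨e', e⟩
        · rw [hc.2.2.2] at e'; simp at e'
        · rw [e]; simp
    · rintro e1 e2 rfl
      rcases h.t5 x e1 e2 with ⟨_, _, e, _⟩ | ⟨_, e', e, _⟩ <;> rw [e] <;> simp
    · rintro e1 e2 rfl
      rcases h.t5 x e1 e2 with ⟨e', _, _, e⟩ | ⟨_, _, _, e⟩
      · exact absurd e' (hS.nl _ _ hx).2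
      · rw [e]; simp

end Und

/-! ### Counting crossings -/

def crossSet (g : Grid) : Finset (ℕ × ℕ) :=
  (Finset.Icc 1 g.n ×ˢ Finset.Icc 1 g.n).filter (fun p => g.tile p.1 p.2 = Tile.cross)

theorem range'_toFinset (n : ℕ) : (List.range' 1 n).toFinset = Finset.Icc 1 n := by
  ext x
  simp only [List.mem_toFinset, List.mem_range'_1, Finset.mem_Icc]
  omega

theorem crossCount_eq (g : Grid) : crossCount g = (crossSet g).card := by
  unfold crossCount crossSet
  rw [← List.sum_toFinset _ List.nodup_range', range'_toFinset, Finset.card_filter,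
    Finset.sum_product]
  apply Finset.sum_congr rfl
  intro x _
  rw [← Finset.card_filter, ← range'_toFinset, ← List.toFinset_card_of_nodup
    (List.Nodup.filter _ List.nodup_range')]
  congr 1
  ext y
  simp

theorem mem_crossSet {g : Grid} (hE : Edg g) (p : ℕ × ℕ) :
    p ∈ crossSet g ↔ g.tile p.1 p.2 = Tile.cross := by
  unfold crossSet
  simp only [Finset.mem_filter, Finset.mem_product, Finset.mem_Icc]
  constructor
  · exact fun h => h.2
  · intro h
    refine ⟨?_, h⟩
    by_contra hc
    have : ¬ InGrid g p.1 p.2 := by unfold InGrid; tauto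
    rw [hE.out _ _ this] at h
    simp at h

theorem Und.countA {g : Grid} {i i' j : ℕ} (h : Und g i i' j) {k : ℕ} (hS : Str g k)
    (hc : i' ≤ k ∧ g.tile i' (j + 1) = Tile.nw) :
    crossCount (und g i i' j) = crossCount g := by
  have hi1 := h.i1
  rw [crossCount_eq, crossCount_eq]
  congr 1
  ext ⟨x, y⟩
  rw [mem_crossSet (h.edg hS.E), mem_crossSet hS.E]
  simp only
  apply h.cs x y
  · intro _ e; rw [e]
  · rintro rfl rfl; rw [h.t1, h.a]; simp
  · rintro rfl rfl; rcases h.t2 with ⟨e', e⟩ | ⟨e', e⟩ <;> rw [e, e'] <;> simp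
  · rintro rfl rfl; rcases h.t3 with ⟨e', e⟩ | ⟨e', e⟩ <;> rw [e, e'] <;> simp
  · rintro rfl rfl
    rcases h.t4 with ⟨e', e⟩ | ⟨e', e⟩
    · rw [e, e']; simp
    · rw [hc.2] at e'; simp at e'
  · rintro e1 e2 rfl
    rcases h.t5 x e1 e2 with ⟨e', _, e, _⟩ | ⟨_, e', e, _⟩
    · rw [e, e']; simp
    · exact absurd e' (hS.nc _ _ (by omega) (by omega))
  · rintro e1 e2 rfl
    rcases h.t5 x e1 e2 with ⟨_, e', _, e⟩ | ⟨_, e', _, e⟩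
    · rw [e, e']; simp
    · exact absurd e' (hS.nc _ _ (by omega) (by omega))

def sg (i i' j : ℕ) (p : ℕ × ℕ) : ℕ × ℕ :=
  if i < p.1 ∧ p.1 < i' then
    (if p.2 = j then (p.1, j + 1) else if p.2 = j + 1 then (p.1, j) else p) else p

theorem sg_sg (i i' j : ℕ) (p : ℕ × ℕ) : sg i i' j (sg i i' j p) = p := by
  obtain ⟨x, y⟩ := p
  unfold sg
  by_cases h : i < x ∧ x < i'
  · by_cases h1 : y = j
    · simp [h, h1]
    · by_cases h2 : y = j + 1
      · simp [h, h2]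
      · simp [h, h1, h2]
  · simp [h]

theorem Und.countB {g : Grid} {i i' j : ℕ} (h : Und g i i' j) (hE : Edg g)
    (hc : g.tile i' (j + 1) = Tile.cross) :
    crossCount g = crossCount (und g i i' j) + 1 := by
  have hii := h.ii
  have hmem : ((i', j + 1) : ℕ × ℕ) ∈ crossSet g := by
    rw [mem_crossSet hE]; exact hc
  rw [crossCount_eq, crossCount_eq, ← Finset.card_erase_add_one hmem]
  congr 1
  have key : ∀ p, p ∈ crossSet (und g i i' j) ↔ sg i i' j p ∈ (crossSet g).erase (i', j + 1) := by
    rintro ⟨x, y⟩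
    rw [Finset.mem_erase, mem_crossSet (h.edg hE), mem_crossSet hE]
    simp only
    apply h.cs x y
    · intro e1 e2
      have : sg i i' j (x, y) = (x, y) := by
        unfold sg
        simp only
        split_ifs <;> first | rfl | omega
      rw [this, e2]
      simp only [ne_eq, Prod.mk.injEq]
      constructor
      · intro e; exact ⟨by omega, e⟩
      · exact fun e => e.2
    · rintro rfl rfl
      simp [sg, h.t1, h.a]
    · rintro rfl rfl
      rcases h.t2 with ⟨e', e⟩ | ⟨e', e⟩ <;> simp [sg, e, e']
    · rintro rfl rfl
      rcases h.t3 with ⟨e', e⟩ | ⟨e', e⟩ <;> simp [sg, e, e']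
    · rintro rfl rfl
      rcases h.t4 with ⟨e', e⟩ | ⟨e', e⟩ <;> simp [sg, e]
    · rintro e1 e2 rfl
      rcases h.t5 x e1 e2 with ⟨a1, a2, a3, a4⟩ | ⟨a1, a2, a3, a4⟩
      · simp [sg, e1, e2, a2, a3]
      · simp [sg, e1, e2, a2, a3]; omega
    · rintro e1 e2 rfl
      rcases h.t5 x e1 e2 with ⟨a1, a2, a3, a4⟩ | ⟨a1, a2, a3, a4⟩
      · simp [sg, e1, e2, a1, a4]
      · simp [sg, e1, e2, a1, a4]
  apply Finset.card_nbij' (sg i i' j) (sg i i' j)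
  · intro p hp
    have := (key (sg i i' j p))
    rw [sg_sg] at this
    exact this.2 hp
  · intro p hp
    exact (key p).1 hp
  · intro p _; exact sg_sg _ _ _ _
  · intro p _; exact sg_sg _ _ _ _



/-! ### The marked-tile loop -/

theorem takeWhile_range' (p : ℕ → Bool) : ∀ (t s m : ℕ), (∀ y, s ≤ y → y < s + t → p y = true) →
    p (s + t) = false → t < m → (List.range' s m).takeWhile p = List.range' s t := by
  intro t
  induction t with
  | zero =>
    intro s m _ h2 h3
    obtain ⟨m, rfl⟩ : ∃ e, m = e + 1 := ⟨m - 1, by omega⟩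
    rw [List.range'_succ, List.takeWhile_cons_of_neg (by simpa using h2)]
    rfl
  | succ t ih =>
    intro s m h1 h2 h3
    obtain ⟨m, rfl⟩ : ∃ e, m = e + 1 := ⟨m - 1, by omega⟩
    rw [List.range'_succ, List.range'_succ, List.takeWhile_cons_of_pos (h1 s le_rfl (by omega)),
      ih (s + 1) m (fun y a b => h1 y (by omega) (by omega)) (by
        rw [show s + 1 + t = s + (t + 1) by omega]; exact h2) (by omega)]

theorem slideEast_eq {g : Grid} {i j0 j : ℕ} (hj : j0 ≤ j) (hjn : j < g.n)
    (h1 : ∀ y, j0 ≤ y → y ≤ j → g.tile i y = Tile.blank) (h2 : g.tile i (j + 1) ≠ Tile.blank) :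
    slideEast g i j0 = j := by
  unfold slideEast
  rw [takeWhile_range' _ (j - j0 + 1) j0 (g.n + 1) ?_ ?_ (by omega), List.range'_concat,
    List.getLastD_concat]
  · omega
  · intro y a b
    simp [h1 y a (by omega)]
  · rw [show j0 + (j - j0 + 1) = j + 1 by omega]
    simpa using h2

theorem blank_run {g : Grid} (hE : Edg g) {i j0 : ℕ} (hi : 1 ≤ i) (hin : i ≤ g.n) 
    (hj : j0 ≤ g.n) (hb : g.tile i j0 = Tile.blank) :
    ∃ j, j0 ≤ j ∧ j < g.n ∧ (∀ y, j0 ≤ y → y ≤ j → g.tile i y = Tile.blank) ∧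
      g.tile i (j + 1) ≠ Tile.blank := by
  have hn : g.tile i g.n ≠ Tile.blank := by
    intro h
    have := hE.right i hi hin
    rw [h] at this
    simp [hasE] at this
  have hex : ∃ t, g.tile i (j0 + t + 1) ≠ Tile.blank := by
    have : j0 ≠ g.n := fun h => hn (h ▸ hb)
    exact ⟨g.n - j0 - 1, by rwa [show j0 + (g.n - j0 - 1) + 1 = g.n by omega]⟩
  classical
  let t := Nat.find hex
  have ht : g.tile i (j0 + t + 1) ≠ Tile.blank := Nat.find_spec hex
  have hmin : ∀ s, s < t → g.tile i (j0 + s + 1) = Tile.blank := by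
    intro s hs
    have := Nat.find_min hex hs
    simpa using this
  have hbl : ∀ y, j0 ≤ y → y ≤ j0 + t → g.tile i y = Tile.blank := by
    intro y h1 h2
    by_cases h : y = j0
    · rw [h]; exact hb
    · have := hmin (y - j0 - 1) (by omega)
      rwa [show j0 + (y - j0 - 1) + 1 = y by omega] at this
  refine ⟨j0 + t, by omega, ?_, hbl, ht⟩
  by_contra hc
  exact hn (hbl g.n hj (by omega))

theorem back_gen {g : Grid} (hE : Edg g) : ∀ (f x y : ℕ) (v : Bool), 1 ≤ x → x ≤ g.n → 1 ≤ y →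
    y ≤ g.n → (v = true → hasN (g.tile x y) = true) → (v = false → hasE (g.tile x y) = true) →
    (g.n - x) + y < f → ∃ p, p ≤ y ∧ backAux g f x y v = some p := by
  intro f
  induction f with
  | zero => intro x y v _ _ _ _ _ _ h; omega
  | succ f ih =>
    intro x y v x1 xn y1 yn h1 h2 hf
    have hdown : hasS (g.tile x y) = true → ∃ p, p ≤ y ∧
        (if x = g.n then some y else backAux g f (x + 1) y true) = some p := by
      intro hs
      by_cases hx : x = g.n
      · exact ⟨y, le_rfl, by rw [if_pos hx]⟩
      · rw [if_neg hx]
        rw [hE.V x y x1 (by omega) y1 yn] at hs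
        exact ih (x + 1) y true (by omega) (by omega) y1 yn (fun _ => hs) (by simp) (by omega)
    have hleft : hasW (g.tile x y) = true → ∃ p, p ≤ y ∧
        backAux g f x (y - 1) false = some p := by
      intro hw
      have hy : 1 < y := by
        by_contra hc
        have : y = 1 := by omega
        rw [this, hE.left x x1 xn] at hw
        simp at hw
      have := hE.H x (y - 1) x1 xn (by omega) (by omega)
      rw [Nat.sub_add_cancel y1, hw] at this
      obtain ⟨p, p1, p2⟩ := ih x (y - 1) false x1 xn (by omega) (by omega) (by simp)
        (fun _ => this) (by omega)
      exact ⟨p, by omega, p2⟩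
    unfold backAux
    rw [if_neg (by omega)]
    have hnb := hE.nob x y
    cases v with
    | true =>
      simp only [true_implies] at h1
      cases ht : g.tile x y with
      | vert => simpa [ht] using hdown (by rw [ht]; rfl)
      | cross => simpa [ht] using hdown (by rw [ht]; rfl)
      | nw => simpa [ht] using hleft (by rw [ht]; rfl)
      | bump => exact absurd ht hnb
      | blank => rw [ht] at h1; simp [hasN] at h1
      | horiz => rw [ht] at h1; simp [hasN] at h1
      | se => rw [ht] at h1; simp [hasN] at h1
    | false =>
      simp only [true_implies] at h2
      cases ht : g.tile x y with
      | horiz => simpa [ht] using hleft (by rw [ht]; rfl)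
      | cross => simpa [ht] using hleft (by rw [ht]; rfl)
      | se => simpa [ht] using hdown (by rw [ht]; rfl)
      | bump => exact absurd ht hnb
      | blank => rw [ht] at h2; simp [hasE] at h2
      | vert => rw [ht] at h2; simp [hasE] at h2
      | nw => rw [ht] at h2; simp [hasE] at h2

theorem back_col {g : Grid} {y : ℕ} : ∀ (f x : ℕ), x ≤ g.n →
    (∀ x', x ≤ x' → x' ≤ g.n → g.tile x' y = Tile.vert ∨ g.tile x' y = Tile.cross) →
    g.n - x < f → backAux g f x y true = some y := by
  intro f
  induction f with
  | zero => intro x _ _ h; omega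
  | succ f ih =>
    intro x hx h hf
    unfold backAux
    rw [if_neg (by omega)]
    have hstep : (if x = g.n then some y else backAux g f (x + 1) y true) = some y := by
      by_cases hxn : x = g.n
      · rw [if_pos hxn]
      · rw [if_neg hxn]
        exact ih (x + 1) (by omega) (fun x' a b => h x' (by omega) b) (by omega)
    rcases h x le_rfl hx with ht | ht <;> simpa [ht] using hstep

theorem back_nw {g : Grid} (hE : Edg g) {y i' : ℕ} (hy : 1 < y) (hyn : y ≤ g.n) (hi' : i' ≤ g.n)
    (hnw : g.tile i' y = Tile.nw) : ∀ (d f x : ℕ), x + d = i' → 1 ≤ x →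
    (∀ x', x ≤ x' → x' < i' → g.tile x' y = Tile.vert) →
    (g.n - x) + y < f → ∃ p, p < y ∧ backAux g f x y true = some p := by
  intro d
  induction d with
  | zero =>
    intro f x hx x1 _ hf
    have : x = i' := by omega
    subst this
    obtain ⟨f, rfl⟩ : ∃ e, f = e + 1 := ⟨f - 1, by omega⟩
    unfold backAux
    rw [if_neg (by omega)]
    have hEd := hE.H x (y - 1) x1 hi' (by omega) (by omega)
    rw [Nat.sub_add_cancel (by omega), hnw] at hEd
    obtain ⟨p, p1, p2⟩ := back_gen hE f x (y - 1) false x1 hi' (by omega) (by omega) (by simp)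
      (fun _ => hEd) (by omega)
    refine ⟨p, by omega, ?_⟩
    simpa [hnw] using p2
  | succ d ih =>
    intro f x hx x1 hv hf
    obtain ⟨f, rfl⟩ : ∃ e, f = e + 1 := ⟨f - 1, by omega⟩
    unfold backAux
    rw [if_neg (by omega)]
    obtain ⟨p, p1, p2⟩ := ih f (x + 1) (by omega) (by omega)
      (fun x' a b => hv x' (by omega) b) (by omega)
    refine ⟨p, p1, ?_⟩
    have hne : ¬ x = g.n := by omega
    simpa [hv x le_rfl (by omega), hne] using p2

theorem tile_SNnW {t : Tile} (h1 : hasN t = true) (h2 : t ≠ Tile.nw) (h3 : t ≠ Tile.bump) :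
    t = Tile.vert ∨ t = Tile.cross := by
  cases t <;> simp_all [hasN]

theorem tile_blank {t : Tile} (h1 : hasN t = false) (h2 : hasE t = false) : t = Tile.blank := by
  cases t <;> simp_all [hasN, hasE]

theorem tile_seh {t : Tile} (h1 : hasN t = false) (h2 : hasE t = true) :
    t = Tile.se ∨ t = Tile.horiz := by
  cases t <;> simp_all [hasN, hasE]

theorem tile_vse {t : Tile} (h1 : hasW t = false) (h2 : t ≠ Tile.blank) :
    t = Tile.se ∨ t = Tile.vert := by
  cases t <;> simp_all [hasW]

/-- Facts at the start of an iteration. -/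
theorem start {g : Grid} (hE : Edg g) {i j : ℕ} (hi : 1 ≤ i) (hin : i ≤ g.n) (hj : 1 ≤ j)
    (hjn : j < g.n) (hb : g.tile i j = Tile.blank) (hnb : g.tile i (j + 1) ≠ Tile.blank) :
    g.tile i (j + 1) = Tile.se ∨ g.tile i (j + 1) = Tile.vert := by
  apply tile_vse _ hnb
  rw [← hE.H i j hi hin hj hjn, hb]
  rfl

/-- Columns `j`, `j+1` strictly below row `i`, until the first `nw` in column `j+1`. -/
theorem cols {g : Grid} {k : ℕ} (hS : Str g k) {i j z : ℕ} (hi : 1 ≤ i) (hzk : z ≤ k) (hj : 1 ≤ j)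
    (hjn : j < g.n) (hb : g.tile i j = Tile.blank) (hnb : g.tile i (j + 1) ≠ Tile.blank)
    (hnw : ∀ x, i < x → x ≤ z → g.tile x (j + 1) ≠ Tile.nw) :
    ∀ d x, x = i + d → 0 < d → x ≤ z → g.tile x j = Tile.blank ∧ g.tile x (j + 1) = Tile.vert := by
  have hE := hS.E
  have hkn := hS.kn
  intro d
  induction d with
  | zero => intro x _ h; omega
  | succ d ih =>
    intro x hx _ hxz
    have prev : hasS (g.tile (i + d) j) = false ∧ hasS (g.tile (i + d) (j + 1)) = true := by
      rcases Nat.eq_zero_or_pos d with h | h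
      · subst h
        have := start hE hi (by omega) hj hjn hb hnb
        rw [Nat.add_zero, hb]
        refine ⟨rfl, ?_⟩
        rcases this with h | h <;> rw [h] <;> rfl
      · obtain ⟨h1, h2⟩ := ih (i + d) rfl h (by omega)
        rw [h1, h2]
        exact ⟨rfl, rfl⟩
    rw [hE.V _ _ (by omega) (by omega) (by omega) (by omega),
      hE.V _ _ (by omega) (by omega) (by omega) (by omega), show i + d + 1 = x by omega] at prev
    have hv : g.tile x (j + 1) = Tile.vert := by
      rcases tile_SNnW prev.2 (hnw x (by omega) hxz) (hE.nob _ _) with h | h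
      · exact h
      · exact absurd h (hS.nc _ _ (by omega) (by omega))
    refine ⟨tile_blank prev.1 ?_, hv⟩
    rw [hE.H x j (by omega) (by omega) hj hjn, hv]
    rfl

theorem und_A {g : Grid} {k : ℕ} (hS : Str g k) {i i' j : ℕ} (hi : 1 ≤ i) (hii : i < i')
    (hi'k : i' ≤ k) (hj : 1 ≤ j)
    (hjn : j < g.n) (hb : g.tile i j = Tile.blank) (hnb : g.tile i (j + 1) ≠ Tile.blank)
    (hnw : ∀ x, i < x → x < i' → g.tile x (j + 1) ≠ Tile.nw) (hw : g.tile i' (j + 1) = Tile.nw) :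
    Und g i i' j := by
  have hE := hS.E
  have hkn := hS.kn
  have hc := cols hS (z := i' - 1) hi (by omega) hj hjn hb hnb (fun x a b => hnw x a (by omega))
  refine ⟨hi, hii, by omega, hj, hjn, hb, ?_, start hE hi (by omega) hj hjn hb hnb, Or.inl hw, ?_⟩
  · apply tile_seh
    · have := hE.V (i' - 1) j (by omega) (by omega) hj (by omega)
      rw [Nat.sub_add_cancel (by omega)] at this
      rw [← this]
      by_cases h : i' - 1 = i
      · rw [h, hb]; rfl
      · rw [(hc (i' - 1 - i) (i' - 1) (by omega) (by omega) le_rfl).1]; rfl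
    · rw [hE.H i' j (by omega) (by omega) hj hjn, hw]; rfl
  · intro x h1 h2
    exact Or.inl (hc (x - i) x (by omega) (by omega) (by omega))

theorem blank_le {g : Grid} {k : ℕ} (hS : Str g k) {i j : ℕ} (h : g.tile i j = Tile.blank) :
    i ≤ k := by
  by_contra hc
  exact (hS.nl i j (by omega)).2 h

/-- The final iteration. -/
theorem und_B {g : Grid} {k : ℕ} (hS : Str g k) {i j : ℕ} (hi : 1 ≤ i) (hj : 1 ≤ j)
    (hjn : j < g.n) (hb : g.tile i j = Tile.blank) (hnb : g.tile i (j + 1) ≠ Tile.blank)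
    (hnw : ∀ x, i < x → g.tile x (j + 1) ≠ Tile.nw) :
    ∃ i', k < i' ∧ Und g i i' j ∧ g.tile i' j = Tile.se ∧ g.tile i' (j + 1) = Tile.cross ∧
      (∀ x, k < x → x < i' → g.tile x j = Tile.horiz) ∧
      (∀ x, i' < x → x ≤ g.n → g.tile x j = Tile.vert ∨ g.tile x j = Tile.cross) ∧
      (∀ x, i < x → x ≤ g.n → g.tile x (j + 1) = Tile.vert ∨ g.tile x (j + 1) = Tile.cross) := by
  have hE := hS.E
  have hkn := hS.kn
  have hik := blank_le hS hb
  have hc := cols hS (z := k) hi le_rfl hj hjn hb hnb (fun x a b => hnw x a)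
  have hst := start hE hi (by omega) hj hjn hb hnb
  have hkS : hasS (g.tile k j) = false := by
    by_cases h : k = i
    · rw [h, hb]; rfl
    · rw [(hc (k - i) k (by omega) (by omega) le_rfl).1]; rfl
  have hkn' : k < g.n := by
    rcases Nat.lt_or_ge k g.n with h | h
    · exact h
    · have : k = g.n := by omega
      rw [this, hE.bot j hj (by omega)] at hkS
      simp at hkS
  have hcol1 : ∀ d x, x = i + d → 0 < d → x ≤ g.n →
      g.tile x (j + 1) = Tile.vert ∨ g.tile x (j + 1) = Tile.cross := by
    intro d
    induction d with
    | zero => intro x _ h; omega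
    | succ d ih =>
      intro x hx _ hxn
      have prev : hasS (g.tile (i + d) (j + 1)) = true := by
        rcases Nat.eq_zero_or_pos d with h | h
        · subst h
          rcases hst with h | h <;> rw [Nat.add_zero, h] <;> rfl
        · rcases ih (i + d) rfl h (by omega) with h | h <;> rw [h] <;> rfl
      rw [hE.V _ _ (by omega) (by omega) (by omega) (by omega), show i + d + 1 = x by omega] at prev
      exact tile_SNnW prev (hnw x (by omega)) (hE.nob _ _)
  have hex : ∃ t, k + t < g.n ∧ hasS (g.tile (k + t + 1) j) = true :=
    ⟨g.n - k - 1, by omega, by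
      rw [show k + (g.n - k - 1) + 1 = g.n by omega]; exact hE.bot j hj (by omega)⟩
  classical
  obtain ⟨t, ⟨ht1, ht2⟩, ht3⟩ : ∃ t, (k + t < g.n ∧ hasS (g.tile (k + t + 1) j) = true) ∧
      ∀ s, s < t → hasS (g.tile (k + s + 1) j) = false := by
    refine ⟨Nat.find hex, Nat.find_spec hex, ?_⟩
    intro s hs
    have h1 := Nat.find_min hex hs
    have h2 := (Nat.find_spec hex).1
    by_contra h3
    apply h1
    exact ⟨by omega, by simpa using h3⟩
  have hN : ∀ x, k < x → x ≤ k + t + 1 → hasN (g.tile x j) = false := by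
    intro x h1 h2
    have := hE.V (x - 1) j (by omega) (by omega) hj (by omega)
    rw [Nat.sub_add_cancel (by omega)] at this
    rw [← this]
    by_cases h : x - 1 = k
    · rw [h]; exact hkS
    · have := ht3 (x - 1 - k - 1) (by omega)
      rwa [show k + (x - 1 - k - 1) + 1 = x - 1 by omega] at this
  have hhor : ∀ x, k < x → x < k + t + 1 → g.tile x j = Tile.horiz := by
    intro x h1 h2
    have h3 := hN x h1 (by omega)
    have h4 := ht3 (x - k - 1) (by omega)
    rw [show k + (x - k - 1) + 1 = x by omega] at h4
    have h5 := (hS.nl x j h1).2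
    cases h : g.tile x j <;> rw [h] at h3 h4 h5 <;> simp_all [hasN, hasS]
  have hse : g.tile (k + t + 1) j = Tile.se := by
    have h3 := hN (k + t + 1) (by omega) le_rfl
    cases h : g.tile (k + t + 1) j <;> rw [h] at h3 ht2 <;> simp_all [hasN, hasS]
  have hcr : ∀ x, k < x → x ≤ k + t + 1 → g.tile x (j + 1) = Tile.cross := by
    intro x h1 h2
    have h3 := hE.H x j (by omega) (by omega) hj hjn
    have h4 : hasE (g.tile x j) = true := by
      by_cases h : x = k + t + 1
      · rw [h, hse]; rfl
      · rw [hhor x h1 (by omega)]; rfl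
    rw [h4] at h3
    rcases hcol1 (x - i) x (by omega) (by omega) (by omega) with h | h
    · rw [h] at h3; simp [hasW] at h3
    · exact h
  refine ⟨k + t + 1, by omega, ⟨hi, by omega, by omega, hj, hjn, hb, Or.inl hse, hst,
    Or.inr (hcr _ (by omega) le_rfl), ?_⟩, hse, hcr _ (by omega) le_rfl, hhor, ?_, ?_⟩
  · intro x h1 h2
    by_cases h : x ≤ k
    · exact Or.inl (hc (x - i) x (by omega) (by omega) h)
    · exact Or.inr ⟨hhor x (by omega) h2, hcr x (by omega) (by omega)⟩
  · have : ∀ d x, x = k + t + 1 + d → 0 < d → x ≤ g.n →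
        g.tile x j = Tile.vert ∨ g.tile x j = Tile.cross := by
      intro d
      induction d with
      | zero => intro x _ h; omega
      | succ d ih =>
        intro x hx _ hxn
        have prev : hasS (g.tile (k + t + 1 + d) j) = true := by
          rcases Nat.eq_zero_or_pos d with h | h
          · subst h; exact ht2
          · rcases ih (k + t + 1 + d) rfl h (by omega) with h | h <;> rw [h] <;> rfl
        rw [hE.V _ _ (by omega) (by omega) (by omega) (by omega),
          show k + t + 1 + d + 1 = x by omega] at prev
        exact tile_SNnW prev (hS.nl x j (by omega)).1 (hE.nob _ _)
    intro x h1 h2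
    exact this (x - (k + t + 1)) x (by omega) (by omega) h2
  · intro x h1 h2
    exact hcol1 (x - i) x (by omega) (by omega) h2



theorem back_west {g : Grid} {f x y : ℕ} (hx : x ≤ g.n)
    (h : g.tile x y = Tile.cross ∨ g.tile x y = Tile.horiz) :
    backAux g (f + 1) x y false = backAux g f x (y - 1) false := by
  conv => lhs; unfold backAux
  rw [if_neg (by omega)]
  rcases h with h | h <;> simp [h]

theorem back_se {g : Grid} {f x y : ℕ} (hx : x ≤ g.n) (h : g.tile x y = Tile.se) :
    backAux g (f + 1) x y false = if x = g.n then some y else backAux g f (x + 1) y true := by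
  conv => lhs; unfold backAux
  rw [if_neg (by omega)]
  simp [h]

theorem loop_B {g : Grid} {k : ℕ} (hS : Str g k) {i j0 j f i' : ℕ} (hi : 1 ≤ i) (hj : 1 ≤ j)
    (hjn : j < g.n) (hsl : slideEast g i j0 = j)
    (hk : k < i') (hU : Und g i i' j) (h1 : g.tile i' j = Tile.se)
    (h2 : g.tile i' (j + 1) = Tile.cross)
    (h3 : ∀ x, k < x → x < i' → g.tile x j = Tile.horiz)
    (h4 : ∀ x, i' < x → x ≤ g.n → g.tile x j = Tile.vert ∨ g.tile x j = Tile.cross)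
    (h5 : ∀ x, i < x → x ≤ g.n → g.tile x (j + 1) = Tile.vert ∨ g.tile x (j + 1) = Tile.cross) :
    nablaLoop g (f + 1) (i, j0) = (und g i i' j, j) := by
  have hE := hS.E
  have hii := hU.ii
  have hin := hU.i'n
  have hp : pipeFromS g i (j + 1) = some (j + 1) := by
    unfold pipeFromS
    rw [if_neg (by omega)]
    exact back_col _ _ (by omega) (fun x a b => h5 x (by omega) b) (by omega)
  have hf : (List.range' 1 g.n).find? (fun x =>
            decide (i < x) && (g.tile x (j + 1) == Tile.cross) &&
            (backAux g (2 * g.n + 2) x (j + 1) false == some j)) = some i' := by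
    rw [List.find?_range'_eq_some]
    refine ⟨?_, by rw [List.mem_range'_1]; omega, ?_⟩
    · have hb : backAux g (2 * g.n + 2) i' (j + 1) false = some j := by
        rw [show 2 * g.n + 2 = 2 * g.n + 1 + 1 by omega, back_west (by omega) (Or.inl h2),
          Nat.add_sub_cancel, back_se (by omega) h1]
        by_cases h : i' = g.n
        · simp [h]
        · have := back_col (y := j) (2 * g.n) (i' + 1) (by omega)
            (fun x a b => h4 x (by omega) b) (by omega)
          simpa [h] using this
      simp [hii, h2, hb]
    · intro x a b
      by_cases hxi : i < x
      · by_cases hxk : x ≤ k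
        · have := hS.nc x (j + 1) hxk a
          simp [this]
        · by_cases hxc : g.tile x (j + 1) = Tile.cross
          · have hb : backAux g (2 * g.n + 2) x (j + 1) false ≠ some j := by
              rw [show 2 * g.n + 2 = 2 * g.n + 1 + 1 by omega]
              have hh := h3 x (by omega) b
              have hj' : 1 < j := by
                by_contra hc
                have := hE.left x a (by omega)
                rw [show 1 = j by omega, hh] at this
                simp [hasW] at this
              have hH := hE.H x (j - 1) a (by omega) (by omega) (by omega)
              rw [Nat.sub_add_cancel hj, hh] at hH
              obtain ⟨p, p1, p2⟩ := back_gen hE (2 * g.n) x (j - 1) false a (by omega) (by omega)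
                (by omega) (by simp) (fun _ => hH) (by omega)
              rw [back_west (by omega) (Or.inl hxc), Nat.add_sub_cancel,
                back_west (by omega) (Or.inr hh), p2]
              simp only [ne_eq, Option.some.injEq]
              omega
            simp [hb]
          · simp [hxc]
      · simp [hxi]
  unfold nablaLoop
  simp only [hsl, hp, hf, if_true, hU.iter]

theorem loop_A {g : Grid} {k : ℕ} (hS : Str g k) {i j0 j f i' : ℕ} (hi : 1 ≤ i) (hj : 1 ≤ j)
    (hjn : j < g.n) (hsl : slideEast g i j0 = j)
    (hk : i' ≤ k) (hU : Und g i i' j) (h2 : g.tile i' (j + 1) = Tile.nw)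
    (hnw : ∀ x, i < x → x < i' → g.tile x (j + 1) ≠ Tile.nw) :
    nablaLoop g (f + 1) (i, j0) = nablaLoop (und g i i' j) f (i', j + 1) := by
  have hE := hS.E
  have hkn := hS.kn
  have hii := hU.ii
  have hin := hU.i'n
  obtain ⟨p, p1, p2⟩ : ∃ p, p < j + 1 ∧ pipeFromS g i (j + 1) = some p := by
    unfold pipeFromS
    rw [if_neg (by omega)]
    apply back_nw hE (by omega) (by omega) (by omega) h2 (i' - (i + 1)) _ _ (by omega) (by omega) _
      (by omega)
    intro x a b
    rcases hU.m x (by omega) b with h | h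
    · exact h.2
    · exact absurd h.2 (hS.nc _ _ (by omega) (by omega))
  have hf : (List.range' 1 g.n).find? (fun x =>
            decide (i < x) && (g.tile x (j + 1) == Tile.nw)) = some i' := by
    rw [List.find?_range'_eq_some]
    refine ⟨by simp [hii, h2], by rw [List.mem_range'_1]; omega, ?_⟩
    intro x a b
    by_cases hxi : i < x
    · simp [hnw x hxi b]
    · simp [hxi]
  have hne : ¬ p = j + 1 := by omega
  rw [nablaLoop]
  simp only [hsl, p2, hf, hne, if_false, hU.iter]

/-- Output specification of the loop. -/
structure LO (g g' : Grid) (k i j0 a : ℕ) (y : ℕ → ℕ) : Prop where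
  n : g'.n = g.n
  S : Str g' k
  ct : crossCount g = crossCount g' + 1
  av : a + 1 = y k
  y0 : j0 < y i
  s0 : ∀ z, j0 ≤ z → z < y i → hasS (g.tile i z) = false
  ys : ∀ x, i ≤ x → x < k → y x ≤ y (x + 1) ∧
    ∀ z, y x ≤ z → z < y (x + 1) → hasS (g.tile (x + 1) z) = false
  yr : ∀ x, i ≤ x → x ≤ k → 2 ≤ y x ∧ hasS (g.tile x (y x)) = true ∧
    hasS (g.tile x (y x - 1)) = false ∧
    (∀ z, hasS (g'.tile x z) = true ↔ z = y x - 1 ∨ (hasS (g.tile x z) = true ∧ z ≠ y x))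
  tu : ∀ x z, x < i → g'.tile x z = g.tile x z
  ti : ∀ z, y i < z → g'.tile i z = g.tile i z
  tb : g'.tile i (y i) ≠ Tile.blank

theorem und_row {g : Grid} {i i' j : ℕ} (hU : Und g i i' j) (x : ℕ) (h1 : i ≤ x) (h2 : x < i')
    (hx : i < x → g.tile x j = Tile.blank ∧ g.tile x (j + 1) = Tile.vert) :
    hasS (g.tile x (j + 1)) = true ∧ hasS (g.tile x j) = false ∧
    (∀ z, hasS ((und g i i' j).tile x z) = true ↔
      z = j ∨ (hasS (g.tile x z) = true ∧ z ≠ j + 1)) := by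
  refine ⟨?_, ?_, ?_⟩
  · rcases Nat.eq_or_lt_of_le h1 with h | h
    · subst h; rcases hU.c with h | h <;> rw [h] <;> rfl
    · rw [(hx h).2]; rfl
  · rcases Nat.eq_or_lt_of_le h1 with h | h
    · subst h; rw [hU.a]; rfl
    · rw [(hx h).1]; rfl
  · intro z
    rw [hU.eS]
    by_cases hz : z = j
    · simp [h1, h2, hz]
    · by_cases hz' : z = j + 1
      · simp [h1, h2, hz']
      · simp [hz, hz']

theorem loop_spec : ∀ (f : ℕ) (g : Grid) (k : ℕ), Str g k → ∀ i j0, 1 ≤ i → 1 ≤ j0 → j0 ≤ g.n →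
    g.tile i j0 = Tile.blank → k - i < f →
    ∃ y, LO g (nablaLoop g f (i, j0)).1 k i j0 (nablaLoop g f (i, j0)).2 y := by
  intro f
  induction f with
  | zero => intro g k _ i j0 _ _ _ _ h; omega
  | succ f ih =>
    intro g k hS i j0 hi hj0 hj0n hb hf
    have hE := hS.E
    have hkn := hS.kn
    have hik := blank_le hS hb
    obtain ⟨j, hjj, hjn, hbl, hnb⟩ := blank_run hE hi (by omega) hj0n hb
    have hsl := slideEast_eq hjj hjn hbl hnb
    have hbj := hbl j hjj le_rfl
    have hs0 : ∀ z, j0 ≤ z → z < j + 1 → hasS (g.tile i z) = false := by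
      intro z a b
      rw [hbl z a (by omega)]; rfl
    by_cases hex : ∃ x, i < x ∧ g.tile x (j + 1) = Tile.nw
    · classical
      obtain ⟨i', ⟨hii, hnw⟩, hmin⟩ : ∃ i', (i < i' ∧ g.tile i' (j + 1) = Tile.nw) ∧
          ∀ x, i < x → x < i' → g.tile x (j + 1) ≠ Tile.nw := by
        refine ⟨Nat.find hex, Nat.find_spec hex, ?_⟩
        intro x a b c
        exact Nat.find_min hex b ⟨a, c⟩
      have hi'k : i' ≤ k := by
        by_contra hc
        exact (hS.nl i' (j + 1) (by omega)).1 hnw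
      have hU := und_A hS hi hii hi'k (by omega) hjn hbj hnb hmin hnw
      rw [loop_A hS hi (by omega) hjn hsl hi'k hU hnw hmin]
      have hS1 := hU.str hS (Or.inl ⟨hi'k, hnw⟩)
      have hb1 : (und g i i' j).tile i' (j + 1) = Tile.blank := by
        rcases hU.t4 with h | h
        · exact h.2
        · rw [hnw] at h; simp at h
      obtain ⟨y, hy⟩ := ih (und g i i' j) k hS1 i' (j + 1) (by omega) (by omega)
        (by show j + 1 ≤ g.n; omega) hb1 (by omega)
      have hmid : ∀ x, i < x → x < i' → g.tile x j = Tile.blank ∧ g.tile x (j + 1) = Tile.vert := by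
        intro x a b
        rcases hU.m x a b with h | h
        · exact h
        · exact absurd h.2 (hS.nc _ _ (by omega) (by omega))
      have hrow : ∀ x z, i' ≤ x → hasS ((und g i i' j).tile x z) = hasS (g.tile x z) := by
        intro x z h
        rw [hU.eS, if_neg (by omega), if_neg (by omega)]
      generalize hg' : (nablaLoop (und g i i' j) f (i', j + 1)).1 = g' at hy ⊢
      generalize ha' : (nablaLoop (und g i i' j) f (i', j + 1)).2 = a at hy ⊢
      refine ⟨fun x => if x < i' then j + 1 else y x, ?_⟩
      refine ⟨hy.n, hy.S, ?_, ?_, ?_, ?_, ?_, ?_, ?_, ?_, ?_⟩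
      · rw [← hU.countA hS ⟨hi'k, hnw⟩]; exact hy.ct
      · simp only [if_neg (show ¬ k < i' by omega)]; exact hy.av
      · simp only [if_pos hii]; omega
      · simp only [if_pos hii]; exact hs0
      · intro x h1 h2
        by_cases h3 : x + 1 < i'
        · simp only [if_pos h3, if_pos (show x < i' by omega)]
          exact ⟨le_rfl, by omega⟩
        · by_cases h4 : x < i'
          · simp only [if_neg h3, if_pos h4]
            have e : x + 1 = i' := by omega
            rw [e]
            refine ⟨by have := hy.y0; omega, ?_⟩
            intro z a b
            rw [← hrow _ _ le_rfl]
            exact hy.s0 z a b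
          · simp only [if_neg h3, if_neg h4]
            refine ⟨(hy.ys x (by omega) h2).1, ?_⟩
            intro z a b
            rw [← hrow _ _ (by omega)]
            exact (hy.ys x (by omega) h2).2 z a b
      · intro x h1 h2
        by_cases h4 : x < i'
        · simp only [if_pos h4, Nat.add_sub_cancel]
          obtain ⟨r1, r2, r3⟩ := und_row hU x h1 h4 (fun h => hmid x h h4)
          refine ⟨by omega, r1, r2, ?_⟩
          intro z
          rw [hy.tu x z h4]
          exact r3 z
        · simp only [if_neg h4]
          obtain ⟨r0, r1, r2, r3⟩ := hy.yr x (by omega) h2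
          rw [hrow _ _ (by omega)] at r1 r2
          refine ⟨r0, r1, r2, ?_⟩
          intro z
          rw [r3 z, hrow _ _ (by omega)]
      · intro x z h
        rw [hy.tu x z (by omega), Und.t6 x z (by omega) hii]
      · intro z h
        simp only [if_pos hii] at h
        rw [hy.tu i z hii, Und.t6 i z (by omega) hii]
      · simp only [if_pos hii]
        rw [hy.tu i _ hii]
        rcases hU.t3 with h | h <;> rw [h.2] <;> simp
    · push Not at hex
      obtain ⟨i', hk, hU, h1, h2, h3, h4, h5⟩ := und_B hS hi (by omega) hjn hbj hnb hex
      rw [loop_B hS hi (by omega) hjn hsl hk hU h1 h2 h3 h4 h5]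
      have hii := hU.ii
      have hmid : ∀ x, i < x → x ≤ k → g.tile x j = Tile.blank ∧ g.tile x (j + 1) = Tile.vert := by
        intro x a b
        rcases hU.m x a (by omega) with h | h
        · exact h
        · exact absurd h.2 (hS.nc _ _ (by omega) (by omega))
      refine ⟨fun _ => j + 1, rfl, hU.str hS (Or.inr ⟨hk, hik, h1, h2⟩), hU.countB hE h2, rfl,
        by omega, hs0, ?_, ?_, ?_, ?_, ?_⟩
      · intro x _ _
        exact ⟨le_rfl, by omega⟩
      · intro x a b
        obtain ⟨r1, r2, r3⟩ := und_row hU x a (by omega) (fun h => hmid x h b)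
        exact ⟨by omega, r1, r2, r3⟩
      · intro x z h
        exact Und.t6 x z (by omega) hii
      · intro z h
        exact Und.t6 i z (by omega) hii
      · simp only
        rcases hU.t3 with h | h <;> rw [h.2] <;> simp



/-! ### Assembling the word -/

theorem tile_nb {t : Tile} (h : t ≠ Tile.blank) (h2 : ¬ (hasN t = true ∧ hasW t = true)) :
    hasE t = !hasN t ∧ hasS t = !hasW t := by
  cases t <;> simp_all [hasN, hasE, hasS, hasW]

theorem no_blank_row {g : Grid} (hE : Edg g) (hb : ∀ i j, g.tile i j ≠ Tile.blank) (i : ℕ)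
    (hi : 1 ≤ i) (hin : i ≤ g.n)
    (hN : ∀ j, 1 ≤ j → j ≤ g.n → hasN (g.tile i j) = decide (j < i)) :
    ∀ d, d < g.n → hasW (g.tile i (d + 1)) = decide (i < d + 1) := by
  intro d
  induction d with
  | zero =>
    intro _
    rw [Nat.zero_add, hE.left i hi hin]
    simp; omega
  | succ d ih =>
    intro hd
    have h1 := ih (by omega)
    have h2 := hN (d + 1) (by omega) (by omega)
    rw [← hE.H i (d + 1) hi hin (by omega) (by omega), (tile_nb (hb i (d + 1)) ?_).1, h2]
    · rw [← decide_not]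
      congr 1
      simp only [eq_iff_iff]; omega
    · rw [h1, h2]; simp; omega

theorem no_blank_N {g : Grid} (hE : Edg g) (hb : ∀ i j, g.tile i j ≠ Tile.blank) :
    ∀ d, d < g.n → ∀ j, 1 ≤ j → j ≤ g.n → hasN (g.tile (d + 1) j) = decide (j < d + 1) := by
  intro d
  induction d with
  | zero =>
    intro _ j h1 h2
    rw [Nat.zero_add, hE.top j h1 h2]
    simp; omega
  | succ d ih =>
    intro hd j h1 h2
    have h3 := ih (by omega)
    have h4 := no_blank_row hE hb (d + 1) (by omega) (by omega) h3 (j - 1) (by omega)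
    rw [Nat.sub_add_cancel h1] at h4
    rw [← hE.V (d + 1) j (by omega) (by omega) h1 h2, (tile_nb (hb _ _) ?_).2, h4]
    · rw [← decide_not]
      congr 1
      simp only [eq_iff_iff]; omega
    · rw [h3 j h1 h2, h4]; simp; omega

theorem no_blank_cross {g : Grid} (hE : Edg g) (hb : ∀ i j, g.tile i j ≠ Tile.blank) :
    crossCount g = 0 := by
  rw [crossCount_eq, Finset.card_eq_zero, Finset.eq_empty_iff_forall_notMem]
  rintro ⟨i, j⟩ h
  have hc := (mem_crossSet hE _).1 h
  simp only at hc
  unfold crossSet at h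
  simp only [Finset.mem_filter, Finset.mem_product, Finset.mem_Icc] at h
  obtain ⟨⟨⟨h1, h2⟩, h3, h4⟩, -⟩ := h
  have a1 := no_blank_N hE hb (i - 1) (by omega)
  rw [Nat.sub_add_cancel h1] at a1
  have a2 := no_blank_row hE hb i h1 h2 a1 (j - 1) (by omega)
  have a3 := a1 j h3 h4
  rw [Nat.sub_add_cancel h3] at a2
  rw [hc] at a2 a3
  simp [hasN, hasW] at a2 a3
  omega

theorem getLast_filter (p : ℕ → Bool) : ∀ n, (∃ z, 1 ≤ z ∧ z ≤ n ∧ p z = true) →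
    let m := ((List.range' 1 n).filter p).getLastD 0
    1 ≤ m ∧ m ≤ n ∧ p m = true ∧ ∀ z, m < z → z ≤ n → p z = false := by
  intro n
  induction n with
  | zero => rintro ⟨z, h1, h2, _⟩; omega
  | succ n ih =>
    rintro ⟨z, h1, h2, h3⟩
    rw [List.range'_concat, List.filter_append, Nat.one_mul]
    by_cases hp : p (1 + n) = true
    · rw [List.filter_cons_of_pos hp, List.filter_nil, List.getLastD_concat]
      exact ⟨by omega, by omega, hp, by omega⟩
    · rw [List.filter_cons_of_neg hp, List.filter_nil, List.append_nil]
      have hz : z ≠ 1 + n := fun h => hp (h ▸ h3)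
      obtain ⟨a1, a2, a3, a4⟩ := ih ⟨z, h1, by omega, h3⟩
      refine ⟨a1, by omega, a3, ?_⟩
      intro u b1 b2
      by_cases hu : u = 1 + n
      · rw [hu]; simpa using hp
      · exact a4 u b1 (by omega)

theorem blank_in {g : Grid} (hE : Edg g) {i j : ℕ} (h : g.tile i j = Tile.blank) : InGrid g i j := by
  by_contra hc
  rw [hE.out i j hc] at h
  simp at h

theorem nabla_none {g : Grid} (hb : ∀ i j, g.tile i j ≠ Tile.blank) : nabla g = g := by
  have : (List.range' 1 g.n).find?
      (fun i => (List.range' 1 g.n).any (fun j => g.tile i j == Tile.blank)) = none := by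
    simp [hb]
  unfold nabla nablaPop
  rw [this]

theorem pop_spec {g : Grid} {k : ℕ} (hS : Str g k) (hb : ∃ i j, g.tile i j = Tile.blank) :
    ∃ r j0 y a, pop g = (r, a) ∧ LO g (nabla g) k r j0 a y ∧ r ≤ k ∧
      (∀ x z, x < r → g.tile x z ≠ Tile.blank) ∧ g.tile r j0 = Tile.blank ∧
      (∀ z, j0 < z → g.tile r z ≠ Tile.blank) := by
  have hE := hS.E
  have hkn := hS.kn
  classical
  have hex : ∃ i, ∃ j, g.tile i j = Tile.blank := hb
  obtain ⟨r, ⟨j, hj⟩, hmin⟩ : ∃ r, (∃ j, g.tile r j = Tile.blank) ∧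
      ∀ x z, x < r → g.tile x z ≠ Tile.blank :=
    ⟨Nat.find hex, Nat.find_spec hex, fun x z hx hz => Nat.find_min hex hx ⟨z, hz⟩⟩
  obtain ⟨g1, g2, g3, g4⟩ := blank_in hE hj
  have hf : (List.range' 1 g.n).find?
      (fun i => (List.range' 1 g.n).any (fun j => g.tile i j == Tile.blank)) = some r := by
    rw [List.find?_range'_eq_some]
    refine ⟨?_, by rw [List.mem_range'_1]; omega, ?_⟩
    · rw [List.any_eq_true]
      exact ⟨j, by rw [List.mem_range'_1]; omega, by simp [hj]⟩
    · intro x _ hx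
      simp [fun z => hmin x z hx]
  obtain ⟨m1, m2, m3, m4⟩ := getLast_filter (fun j => g.tile r j == Tile.blank) g.n
    ⟨j, g3, g4, by simp [hj]⟩
  generalize hj0 : ((List.range' 1 g.n).filter (fun j => g.tile r j == Tile.blank)).getLastD 0 = j0
    at m1 m2 m3 m4
  have hbr : g.tile r j0 = Tile.blank := by simpa using m3
  have hpop : nablaPop g = ((nablaLoop g (g.n + 1) (r, j0)).1, r,
      (nablaLoop g (g.n + 1) (r, j0)).2) := by
    unfold nablaPop
    rw [hf]
    simp only [hj0]
  obtain ⟨y, hy⟩ := loop_spec (g.n + 1) g k hS r j0 g1 m1 m2 hbr (by omega)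
  refine ⟨r, j0, y, (nablaLoop g (g.n + 1) (r, j0)).2, ?_, ?_, blank_le hS hj, hmin, hbr, ?_⟩
  · unfold pop; rw [hpop]
  · unfold nabla; rw [hpop]; exact hy
  · intro z hz hz'
    have := (blank_in hE hz').2.2.2
    have := m4 z hz this
    simp [hz'] at this

structure Prv (g : Grid) (k r : ℕ) (y : ℕ → ℕ) : Prop where
  up : ∀ x z, x < r → g.tile x z ≠ Tile.blank
  rt : ∀ z, y r ≤ z → g.tile r z ≠ Tile.blank
  rk : r ≤ k
  yx : ∀ x, r ≤ x → x ≤ k → 2 ≤ y x ∧ hasS (g.tile x (y x - 1)) = true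
  ym : ∀ x, r ≤ x → x < k → y x ≤ y (x + 1)

theorem LO.prv {g g' : Grid} {k r j0 a : ℕ} {y : ℕ → ℕ} (h : LO g g' k r j0 a y) (hrk : r ≤ k)
    (h1 : ∀ x z, x < r → g.tile x z ≠ Tile.blank)
    (h2 : ∀ z, j0 < z → g.tile r z ≠ Tile.blank) : Prv g' k r y := by
  refine ⟨?_, ?_, hrk, ?_, fun x a b => (h.ys x a b).1⟩
  · intro x z hx
    rw [h.tu x z hx]; exact h1 x z hx
  · intro z hz
    rcases Nat.eq_or_lt_of_le hz with e | e
    · rw [← e]; exact h.tb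
    · rw [h.ti z e]
      have := h.y0
      exact h2 z (by omega)
  · intro x a b
    obtain ⟨r0, r1, r2, r3⟩ := h.yr x a b
    exact ⟨r0, (r3 _).2 (Or.inl rfl)⟩

theorem has_blank {g : Grid} (hE : Edg g) (h : crossCount g ≠ 0) :
    ∃ i j, g.tile i j = Tile.blank := by
  by_contra hc
  push Not at hc
  exact h (no_blank_cross hE hc)

theorem word_CC : ∀ (l : ℕ) (g : Grid) (k r : ℕ) (y : ℕ → ℕ), Str g k → crossCount g = l →
    Prv g k r y → CC r (y k - 1) (phiAux l g) := by
  intro l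
  induction l with
  | zero => intros; trivial
  | succ l ih =>
    intro g k r y hS hl hp
    obtain ⟨r', j0, y', a, e, hL, hrk, h1, h2, h3⟩ := pop_spec hS (has_blank hS.E (by omega))
    have hct := hL.ct
    have hav := hL.av
    unfold phiAux
    rw [e]
    have hrr : r ≤ r' := by
      by_contra hc
      exact hp.up r' j0 (by omega) h2
    have ha : a = y' k - 1 := by omega
    refine ⟨hrr, ?_, ?_⟩
    · intro hr
      subst hr
      have key : ∀ d x, x = r + d → x ≤ k → y' x + 1 ≤ y x := by
        intro d
        induction d with
        | zero =>
          intro x hx hxk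
          rw [Nat.add_zero] at hx
          subst hx
          obtain ⟨q1, q2⟩ := hp.yx x le_rfl hxk
          have hj : j0 < y x := by
            by_contra hc
            exact hp.rt j0 (by omega) h2
          by_contra hc
          rw [hL.s0 (y x - 1) (by omega) (by omega)] at q2
          simp at q2
        | succ d ihd =>
          intro x hx hxk
          have h4 := ihd (r + d) rfl (by omega)
          have h5 := hp.ym (r + d) (by omega) (by omega)
          obtain ⟨q1, q2⟩ := hp.yx x (by omega) hxk
          have h6 := (hL.ys (r + d) (by omega) (by omega)).2 (y x - 1)
          rw [show r + d + 1 = x by omega] at h5 h6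
          by_contra hc
          rw [h6 (by omega) (by omega)] at q2
          simp at q2
      have := key (k - r) k (by omega) le_rfl
      omega
    · rw [ha]
      exact ih (nabla g) k r' y' hL.S (by omega) (hL.prv hrk h1 h3)

theorem word_Adm : ∀ (l : ℕ) (g : Grid) (k : ℕ) (L : Finset ℕ), Str g k → crossCount g = l →
    (∀ z ∈ L, hasS (g.tile k z) = true) → Adm L ((phiAux l g).map Prod.snd) := by
  intro l
  induction l with
  | zero => intros; trivial
  | succ l ih =>
    intro g k L hS hl hL'
    obtain ⟨r', j0, y', a, e, hL, hrk, h1, h2, h3⟩ := pop_spec hS (has_blank hS.E (by omega))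
    have hct := hL.ct
    have hav := hL.av
    obtain ⟨r0, r1, r2, r3⟩ := hL.yr k hrk le_rfl
    have ha : y' k - 1 = a := by omega
    rw [ha] at r2 r3
    unfold phiAux
    rw [e, List.map_cons]
    refine ⟨?_, ?_⟩
    · intro hm
      rw [hL' a hm] at r2
      simp at r2
    · apply ih (nabla g) k _ hL.S (by omega)
      intro z hz
      rw [mem_updL] at hz
      rw [r3]
      rcases hz with hz | ⟨hz1, hz2⟩
      · exact Or.inl hz
      · exact Or.inr ⟨hL' z hz2, by omega⟩

theorem zip_fst_snd (W : List (ℕ × ℕ)) : (W.map Prod.fst).zip (W.map Prod.snd) = W := by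
  induction W with
  | nil => rfl
  | cons p W ih => simpa using ih

theorem Qtilde_phi (g : Grid) :
    Qtilde (phi g) = colsToRows ((phiAux (crossCount g) g).foldl egStep ([], [])).2 := by
  unfold Qtilde egPQ phi
  simp only [zip_fst_snd]

theorem main_str {g : Grid} {k : ℕ} (hS : Str g k) :
    jdt (Qtilde (phi g)) = Qtilde (phi (nabla g)) := by
  by_cases hb : ∃ i j, g.tile i j = Tile.blank
  · obtain ⟨r, j0, y, a, e, hL, hrk, h1, h2, h3⟩ := pop_spec hS hb
    have hct := hL.ct
    have hav := hL.av
    have hA := word_Adm _ g k ∅ hS rfl (by simp)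
    have hC := word_CC _ (nabla g) k r y hL.S rfl (hL.prv hrk h1 h3)
    rw [Qtilde_phi, Qtilde_phi]
    rw [hct] at hA ⊢
    unfold phiAux at hA
    conv_lhs => unfold phiAux
    rw [e] at hA ⊢
    rw [show y k - 1 = a by omega] at hC
    exact jdt_word r a _ hA hC
  · push Not at hb
    rw [nabla_none hb, Qtilde_phi, no_blank_cross hS.E hb]
    rfl


/-- For `w` Grassmannian with `ℓ(w) ≥ 1` and `B ∈ BPD(w)`:
`jdt(Q̃(φ(B))) = Q̃(φ(∇B))`. -/
theorem stmt4 (w : Perm') (hG : Grassmannian w) (hl : 1 ≤ plen w)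
    (B : Grid) (hB : MemBPD w B) :
    jdt (Qtilde (phi B)) = Qtilde (phi (nabla B)) := by
  obtain ⟨k, hS⟩ := hB.str hG
  exact main_str hS

end BPDPaper
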